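/- arXiv:1909.05737 — 7 statements merged into one kernel-verified Lean document; each statement's English description precedes it below -/
import Mathlib

section
/- Let Ω be an open bounded real interval, κ : Ω → [κ_0, ∞) with κ_0 > 0 a Lebesgue integrable function, and f(s) = 2s²(1−s). Assume r_ab, r_Ab, r_aB, r_AB : Ω → ℝ are Lebesgue integrable and, with ω^{ab} = r_ab − r_Ab, ω^{aB} = r_aB − r_AB, ω^{ba} = r_ab − r_aB, ω^{bA} = r_Ab − r_AB, α_a = min{ω^{ab}, ω^{aB}}/κ, β_a = max{ω^{ab}, ω^{aB}}/κ, α_b = min{ω^{ba}, ω^{bA}}/κ, β_b = max{ω^{ba}, ω^{bA}}/κ, suppose: (i) there exist intervals I_p, I_q ⊆ Ω with α_a(x) > 0 for every x ∈ I_p and α_b(x) > 0 for every x ∈ I_q; (ii) ∫_Ω β_a(x) dx < 0 and ∫_Ω β_b(x) dx < 0. Then there exists λ* > 0 such that for every λ > λ* the Neumann problem for the system p'' + λ [q² ω^{ab}(x) + (1−q²) ω^{aB}(x)] f(p)/κ(x) = 0, q'' + λ [p² ω^{ba}(x) + (1−p²) ω^{bA}(x)] f(q)/κ(x) = 0 in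 Ω, with p' = q' = 0 on ∂Ω, admits at least four fully nontrivial solutions. -/
open MeasureTheory Set

/-- One scalar component of a Neumann problem on `cl(Ω) = Icc a b`: `u : cl(Ω) → [0,1]` is
`C¹` on `cl(Ω)`, its derivative is absolutely continuous (with integrable a.e. second
derivative `u''`), `u'' + G(x) = 0` a.e. in `Ω = Ioo a b`, and `u'(a) = u'(b) = 0`. -/
def NeumannComp (a b : ℝ) (G : ℝ → ℝ) (u : ℝ → ℝ) : Prop :=
  (∀ x ∈ Set.Icc a b, u x ∈ Set.Icc (0:ℝ) 1) ∧
  ∃ u' u'' : ℝ → ℝ,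
    (∀ x ∈ Set.Icc a b, HasDerivWithinAt u (u' x) (Set.Icc a b) x) ∧
    ContinuousOn u' (Set.Icc a b) ∧
    IntegrableOn u'' (Set.Ioo a b) ∧
    (∀ x ∈ Set.Icc a b, u' x = u' a + ∫ t in a..x, u'' t) ∧
    (∀ᵐ x ∂(volume.restrict (Set.Ioo a b)), u'' x + G x = 0) ∧
    u' a = 0 ∧ u' b = 0


lemma tlc_sin_gap {φ : ℝ → ℝ} (hφ : Continuous φ) {l r : ℝ} (hlr : l ≤ r)
    (h : ∀ x ∈ Icc l r, 0 < Real.sin (φ x)) : |φ r - φ l| < Real.pi := by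
  by_contra hcon
  push Not at hcon
  have hl := h l ⟨le_rfl, hlr⟩
  rcases le_abs.1 hcon with h1 | h1
  · obtain ⟨x, hx, hx2⟩ := intermediate_value_Icc hlr hφ.continuousOn
      (show φ l + Real.pi ∈ Icc (φ l) (φ r) from ⟨by linarith [Real.pi_pos], by linarith⟩)
    have := h x hx
    rw [hx2, Real.sin_add_pi] at this
    linarith
  · obtain ⟨x, hx, hx2⟩ := intermediate_value_Icc' hlr hφ.continuousOn
      (show φ l - Real.pi ∈ Icc (φ r) (φ l) from ⟨by linarith, by linarith [Real.pi_pos]⟩)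
    have := h x hx
    rw [hx2, Real.sin_sub_pi] at this
    linarith

lemma tlc_sin_pos {δ : ℝ} (h : |δ| < Real.pi) (h2 : 0 < Real.sin δ) : 0 < δ := by
  by_contra hc
  push Not at hc
  have := Real.sin_nonpos_of_nonpos_of_neg_pi_le hc (by linarith [neg_abs_le δ])
  linarith

lemma tlc_pm {h1 h2 : ℝ × ℝ → ℝ} (c1 : Continuous h1) (c2 : Continuous h2) {l r : ℝ} (hlr : l ≤ r)
    (hL : ∀ t ∈ Icc l r, 0 < h1 (l, t)) (hR : ∀ t ∈ Icc l r, h1 (r, t) < 0)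
    (hB : ∀ s ∈ Icc l r, 0 < h2 (s, l)) (hT : ∀ s ∈ Icc l r, h2 (s, r) < 0) :
    ∃ s ∈ Icc l r, ∃ t ∈ Icc l r, h1 (s, t) = 0 ∧ h2 (s, t) = 0 := by
  by_contra hcon
  push Not at hcon
  let cl : ℝ → ℝ := fun x => max l (min r x)
  have hclc : Continuous cl := by fun_prop
  have hcl : ∀ x, cl x ∈ Icc l r := fun x => ⟨le_max_left _ _, max_le hlr (min_le_left _ _)⟩
  have hcl2 : ∀ x ∈ Icc l r, cl x = x := fun x hx => by
    simp [cl, min_eq_right hx.2, max_eq_right hx.1]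
  let H : ℝ × ℝ → ℂ := fun z => ⟨h1 (cl z.1, cl z.2), h2 (cl z.1, cl z.2)⟩
  have hH : Continuous H := by
    have : H = fun z => ((h1 (cl z.1, cl z.2) : ℝ) : ℂ) + ((h2 (cl z.1, cl z.2) : ℝ) : ℂ) * Complex.I := by
      funext z
      apply Complex.ext <;> simp [H]
    rw [this]
    fun_prop
  have hH0 : (0:ℂ) ∉ H '' univ := by
    rintro ⟨z, -, hz⟩
    have e1 := congrArg Complex.re hz
    have e2 := congrArg Complex.im hz
    exact hcon _ (hcl z.1) _ (hcl z.2) e1 e2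
  have hsc : IsSimplyConnected (univ : Set (ℝ × ℝ)) := by
    have := (convex_univ (𝕜 := ℝ) (E := ℝ × ℝ)).contractibleSpace ⟨0, trivial⟩
    exact SimplyConnectedSpace.ofContractible _
  obtain ⟨f, hfc, hf⟩ := Complex.exists_continuousOn_eqOn_exp_comp hsc isOpen_univ hH.continuousOn hH0
  rw [continuousOn_univ] at hfc
  have hre : ∀ s ∈ Icc l r, ∀ t ∈ Icc l r, h1 (s,t) = Real.exp (f (s,t)).re * Real.cos (f (s,t)).im := by
    intro s hs t ht
    have := congrArg Complex.re (hf (mem_univ (s,t)))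
    simp only [Function.comp, Complex.exp_re, H, hcl2 s hs, hcl2 t ht] at this
    exact this.symm
  have him : ∀ s ∈ Icc l r, ∀ t ∈ Icc l r, h2 (s,t) = Real.exp (f (s,t)).re * Real.sin (f (s,t)).im := by
    intro s hs t ht
    have := congrArg Complex.im (hf (mem_univ (s,t)))
    simp only [Function.comp, Complex.exp_im, H, hcl2 s hs, hcl2 t ht] at this
    exact this.symm
  have ml : l ∈ Icc l r := ⟨le_rfl, hlr⟩
  have mr : r ∈ Icc l r := ⟨hlr, le_rfl⟩
  let θ : ℝ × ℝ → ℝ := fun z => (f z).im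
  have hθ : Continuous θ := by fun_prop
  have cL : ∀ t ∈ Icc l r, 0 < Real.cos (θ (l,t)) := fun t ht => by
    have := hL t ht; rw [hre l ml t ht] at this
    exact (mul_pos_iff_of_pos_left (Real.exp_pos _)).1 this
  have cR : ∀ t ∈ Icc l r, Real.cos (θ (r,t)) < 0 := fun t ht => by
    have := hR t ht; rw [hre r mr t ht] at this
    exact (pos_iff_neg_of_mul_neg this).1 (Real.exp_pos _)
  have sB : ∀ t ∈ Icc l r, 0 < Real.sin (θ (t,l)) := fun t ht => by
    have := hB t ht; rw [him t ht l ml] at this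
    exact (mul_pos_iff_of_pos_left (Real.exp_pos _)).1 this
  have sT : ∀ t ∈ Icc l r, Real.sin (θ (t,r)) < 0 := fun t ht => by
    have := hT t ht; rw [him t ht r mr] at this
    exact (pos_iff_neg_of_mul_neg this).1 (Real.exp_pos _)
  have d1 : 0 < θ (r,l) - θ (l,l) := by
    apply tlc_sin_pos (tlc_sin_gap (φ := fun x => θ (x, l)) (by fun_prop) hlr sB)
    rw [Real.sin_sub]
    nlinarith [mul_pos (sB r mr) (cL l ml), mul_pos (neg_pos.2 (cR l ml)) (sB l ml)]
  have d2 : 0 < θ (r,r) - θ (r,l) := by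
    apply tlc_sin_pos
    · have := tlc_sin_gap (φ := fun x => θ (r, x) - Real.pi/2) (by fun_prop) hlr (fun x hx => by
        rw [Real.sin_sub_pi_div_two]; linarith [cR x hx])
      simpa using this
    rw [Real.sin_sub]
    nlinarith [mul_pos (neg_pos.2 (sT r mr)) (neg_pos.2 (cR l ml)), mul_pos (neg_pos.2 (cR r mr)) (sB r mr)]
  have d3 : 0 < θ (l,r) - θ (r,r) := by
    apply tlc_sin_pos
    · have := tlc_sin_gap (φ := fun x => θ (x, r) - Real.pi) (by fun_prop) hlr (fun x hx => by
        rw [Real.sin_sub_pi]; linarith [sT x hx])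
      rw [abs_sub_comm] at this
      simpa using this
    rw [Real.sin_sub]
    nlinarith [mul_pos (neg_pos.2 (sT l ml)) (neg_pos.2 (cR r mr)), mul_pos (cL r mr) (neg_pos.2 (sT r mr))]
  have d4 : 0 < θ (l,l) - θ (l,r) := by
    apply tlc_sin_pos
    · have := tlc_sin_gap (φ := fun x => θ (l, x) + Real.pi/2) (by fun_prop) hlr (fun x hx => by
        rw [Real.sin_add_pi_div_two]; linarith [cL x hx])
      rw [abs_sub_comm] at this
      simpa using this
    rw [Real.sin_sub]
    nlinarith [mul_pos (sB l ml) (cL r mr), mul_pos (cL l ml) (neg_pos.2 (sT l ml))]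
  linarith

lemma tlc_ac_comp {f : ℝ → ℝ} {a b : ℝ} (hf : AbsolutelyContinuousOnInterval f a b)
    {g : ℝ → ℝ} {s : Set ℝ} {K : NNReal} (hg : LipschitzOnWith K g s)
    (hs : ∀ x ∈ uIcc a b, f x ∈ s) :
    AbsolutelyContinuousOnInterval (fun x => g (f x)) a b := by
  rw [absolutelyContinuousOnInterval_iff] at hf ⊢
  intro ε hε
  obtain ⟨δ, hδ, h⟩ := hf (ε / (K + 1)) (by positivity)
  refine ⟨δ, hδ, fun E hE hE2 => ?_⟩
  have h3 := h E hE hE2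
  have : ∑ i ∈ Finset.range E.1, dist (g (f (E.2 i).1)) (g (f (E.2 i).2)) ≤
      (K + 1) * ∑ i ∈ Finset.range E.1, dist (f (E.2 i).1) (f (E.2 i).2) := by
    rw [Finset.mul_sum]
    refine Finset.sum_le_sum fun i hi => ?_
    have hm := hE.1 i hi
    have := hg.dist_le_mul _ (hs _ hm.1) _ (hs _ hm.2)
    nlinarith [dist_nonneg (x := f (E.2 i).1) (y := f (E.2 i).2)]
  refine this.trans_lt ?_
  rw [lt_div_iff₀ (by positivity)] at h3
  linarith

lemma tlc_weight {L : ℝ → ℝ} {a b : ℝ} (hL : IntervalIntegrable L volume a b) (k : ℝ) (hab : a ≤ b)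
    {x y : ℝ} (hx : x ∈ Icc a b) (hy : y ∈ Icc a b) :
    k * ∫ t in x..y, L t * Real.exp (k * ∫ u in a..t, L u) =
      Real.exp (k * ∫ u in a..y, L u) - Real.exp (k * ∫ u in a..x, L u) := by
  have hac := (hL.absolutelyContinuousOnInterval_intervalIntegral (c := a) (by simp)).const_mul k
  obtain ⟨C, hC⟩ := hac.exists_bound
  have hsub : uIcc x y ⊆ uIcc a b := by
    rw [uIcc_of_le hab]; exact uIcc_subset_Icc hx hy
  have hexp : ∃ K, LipschitzOnWith K Real.exp (Icc (-C) C) := by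
    have : ContDiffOn ℝ 1 Real.exp (Icc (-C) C) := Real.contDiff_exp.contDiffOn
    exact this.exists_lipschitzOnWith one_ne_zero (convex_Icc _ _) isCompact_Icc
  obtain ⟨K, hK⟩ := hexp
  have hac2 := tlc_ac_comp hac hK (fun x hx => abs_le.1 (by simpa using hC x hx))
  rw [← (hac2.mono hsub).integral_deriv_eq_sub, ← intervalIntegral.integral_const_mul]
  apply intervalIntegral.integral_congr_ae
  filter_upwards [hL.ae_hasDerivAt_integral] with t ht htm
  have h1 := ((ht (hsub (uIoc_subset_uIcc htm)) a (by simp)).const_mul k).exp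
  rw [h1.deriv]; ring

lemma tlc_gronwall {L φ : ℝ → ℝ} {a b c : ℝ} (hab : a ≤ b) (hL : IntervalIntegrable L volume a b)
    (hL0 : ∀ t ∈ Ioo a b, 0 ≤ L t) (hφ : Continuous φ)
    (h : ∀ x ∈ Icc a b, φ x ≤ c + ∫ t in a..x, L t * φ t) (hφ0 : ∀ x, 0 ≤ φ x) :
    ∀ x ∈ Icc a b, φ x ≤ 2 * c * Real.exp (2 * ∫ t in a..b, L t) := by
  have hΛc : ContinuousOn (fun x => ∫ t in a..x, L t) (Icc a b) := by
    have := (hL.absolutelyContinuousOnInterval_intervalIntegral (c := a) (by simp)).continuousOn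
    rwa [uIcc_of_le hab] at this
  have hc : ContinuousOn (fun x => Real.exp (-(2 * ∫ t in a..x, L t)) * φ x) (Icc a b) := by fun_prop
  obtain ⟨m, hm, hmax⟩ := isCompact_Icc.exists_isMaxOn ⟨a, le_rfl, hab⟩ hc
  set M := Real.exp (-(2 * ∫ t in a..m, L t)) * φ m with hM
  have hM0 : 0 ≤ M := mul_nonneg (Real.exp_pos _).le (hφ0 _)
  have hb : ∀ x ∈ Icc a b, φ x ≤ M * Real.exp (2 * ∫ t in a..x, L t) := by
    intro x hx
    have h1 : Real.exp (-(2 * ∫ t in a..x, L t)) * φ x ≤ M := hmax hx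
    rw [Real.exp_neg] at h1
    rw [inv_mul_le_iff₀ (Real.exp_pos _)] at h1
    linarith
  have hsub : ∀ x ∈ Icc a b, uIcc a x ⊆ uIcc a b := fun x hx => by
    rw [uIcc_of_le hab, uIcc_of_le hx.1]; exact Icc_subset_Icc_right hx.2
  have hnn : ∀ x ∈ Icc a b, 0 ≤ ∫ t in a..x, L t := fun x hx => by
    rw [intervalIntegral.integral_of_le hx.1, integral_Ioc_eq_integral_Ioo]
    exact setIntegral_nonneg measurableSet_Ioo (fun t ht => hL0 t ⟨ht.1, ht.2.trans_le hx.2⟩)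
  have key : ∀ x ∈ Icc a b, φ x ≤ c + M * ((Real.exp (2 * ∫ t in a..x, L t) - 1) / 2) := by
    intro x hx
    refine (h x hx).trans ?_
    have hw := tlc_weight hL 2 hab (x := a) (y := x) ⟨le_rfl, hab⟩ hx
    simp only [intervalIntegral.integral_same, mul_zero, Real.exp_zero] at hw
    rw [← hw]
    have hLx := hL.mono_set (hsub x hx)
    have hcx : ContinuousOn (fun t => Real.exp (2 * ∫ u in a..t, L u)) (uIcc a x) := by
      have : ContinuousOn (fun x => ∫ t in a..x, L t) (uIcc a x) :=
        hΛc.mono (by rw [uIcc_of_le hx.1]; exact Icc_subset_Icc_right hx.2)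
      fun_prop
    have : ∫ t in a..x, L t * φ t ≤ ∫ t in a..x, M * (L t * Real.exp (2 * ∫ u in a..t, L u)) := by
      rw [intervalIntegral.integral_of_le hx.1, intervalIntegral.integral_of_le hx.1,
        integral_Ioc_eq_integral_Ioo, integral_Ioc_eq_integral_Ioo]
      apply setIntegral_mono_on
      · exact ((hLx.mul_continuousOn hφ.continuousOn).1).mono_set Ioo_subset_Ioc_self
      · exact (((hLx.mul_continuousOn hcx).const_mul M).1).mono_set Ioo_subset_Ioc_self
      · exact measurableSet_Ioo
      · intro t ht
        have ht' : t ∈ Ioo a b := ⟨ht.1, ht.2.trans_le hx.2⟩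
        have := mul_le_mul_of_nonneg_left (hb t ⟨ht'.1.le, ht'.2.le⟩) (hL0 t ht')
        linarith
    rw [intervalIntegral.integral_const_mul] at this
    linarith
  have hexp1 : 1 ≤ Real.exp (2 * ∫ t in a..m, L t) := Real.one_le_exp (by linarith [hnn m hm])
  have hMc : M ≤ 2 * c := by
    have h1 := key m hm
    have h2 : φ m = M * Real.exp (2 * ∫ t in a..m, L t) := by
      rw [hM, Real.exp_neg]; field_simp
    by_contra hcon
    push Not at hcon
    nlinarith
  intro x hx
  refine (hb x hx).trans ?_
  have : ∫ t in a..x, L t ≤ ∫ t in a..b, L t := by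
    have hLx := hL.mono_set (hsub x hx)
    have hLx2 : IntervalIntegrable L volume x b := hL.mono_set (by
      rw [uIcc_of_le hab, uIcc_of_le hx.2]; exact Icc_subset_Icc_left hx.1)
    rw [← intervalIntegral.integral_add_adjacent_intervals hLx hLx2]
    have : 0 ≤ ∫ t in x..b, L t := by
      rw [intervalIntegral.integral_of_le hx.2, integral_Ioc_eq_integral_Ioo]
      exact setIntegral_nonneg measurableSet_Ioo (fun t ht => hL0 t ⟨hx.1.trans_lt ht.1, ht.2⟩)
    linarith
  gcongr
  linarith

lemma tlc_gronwall_back {L φ : ℝ → ℝ} {a b : ℝ} (hab : a ≤ b) (hL : IntervalIntegrable L volume a b)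
    (hL0 : ∀ t ∈ Ioo a b, 0 ≤ L t) (hφ : Continuous φ)
    (h : ∀ x ∈ Icc a b, φ x ≤ ∫ t in x..b, L t * φ t) (hφ0 : ∀ x, 0 ≤ φ x) :
    ∀ x ∈ Icc a b, φ x = 0 := by
  have hL' : IntervalIntegrable (fun t => L (-t)) volume (-b) (-a) := by
    have := (IntervalIntegrable.iff_comp_neg (f := L) (a := a) (b := b)).1 hL
    exact this.symm
  have := tlc_gronwall (c := 0) (L := fun t => L (-t)) (φ := fun t => φ (-t)) (a := -b) (b := -a)
    (by linarith) hL' (fun t ht => hL0 _ ⟨by linarith [ht.2], by linarith [ht.1]⟩) (by fun_prop)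
    (fun x hx => by
      have h1 := h (-x) ⟨by linarith [hx.2], by linarith [hx.1]⟩
      have h2 := intervalIntegral.integral_comp_neg (fun t => L t * φ t) (a := -b) (b := x)
      simp only [neg_neg] at h2
      rw [h2]; linarith) (fun x => hφ0 _)
  intro x hx
  have h3 := this (-x) ⟨by linarith [hx.2], by linarith [hx.1]⟩
  simp at h3
  exact le_antisymm h3 (hφ0 x)

lemma tlc_ivp {E : Type*} [NormedAddCommGroup E] [NormedSpace ℝ E] [CompleteSpace E]
    {a b : ℝ} (hab : a ≤ b) {F : ℝ → E → E} {L : ℝ → ℝ} (hL : IntervalIntegrable L volume a b)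
    (hL0 : ∀ t ∈ Ioo a b, 0 ≤ L t)
    (hLip : ∀ t ∈ Ioo a b, ∀ y z, ‖F t y - F t z‖ ≤ L t * ‖y - z‖)
    (hint : ∀ y : ℝ → E, Continuous y → IntervalIntegrable (fun t => F t (y t)) volume a b) :
    ∃ Y : E → ℝ → E, (∀ y0, Continuous (Y y0)) ∧
      (∀ y0, ∀ x ∈ Icc a b, Y y0 x = y0 + ∫ t in a..x, F t (Y y0 t)) ∧
      ∀ x ∈ Icc a b, Continuous (fun y0 => Y y0 x) := by
  classical
  let Λ : ℝ → ℝ := fun x => ∫ t in a..x, L t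
  have hsub : ∀ x ∈ Icc a b, uIcc a x ⊆ uIcc a b := fun x hx => by
    rw [uIcc_of_le hab, uIcc_of_le hx.1]; exact Icc_subset_Icc_right hx.2
  have hΛc : ContinuousOn Λ (Icc a b) := by
    have := (hL.absolutelyContinuousOnInterval_intervalIntegral (c := a) (by simp)).continuousOn
    rwa [uIcc_of_le hab] at this
  let e : ℝ → ℝ := fun x => Real.exp (2 * IccExtend hab (fun z : Icc a b => Λ z) x)
  have hec : Continuous e := by
    have : Continuous (IccExtend hab (fun z : Icc a b => Λ z)) :=
      (continuousOn_iff_continuous_domRestrict.1 hΛc).Icc_extend'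
    fun_prop
  have he : ∀ x ∈ Icc a b, e x = Real.exp (2 * Λ x) := fun x hx => by
    simp only [e]; rw [IccExtend_of_mem hab _ hx]
  have hepos : ∀ x, 0 < e x := fun x => Real.exp_pos _
  -- extension of a continuous map
  let X : C(Icc a b, E) → ℝ → E := fun z x => e x • IccExtend hab z x
  have hXc : ∀ z, Continuous (X z) := fun z => by
    have : Continuous (IccExtend hab z) := z.continuous.Icc_extend'
    exact hec.smul this
  let I : C(Icc a b, E) → ℝ → E := fun z x => ∫ t in a..x, F t (X z t)
  have hIc : ∀ z, ContinuousOn (I z) (Icc a b) := fun z => by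
    have := intervalIntegral.continuousOn_primitive_interval' (hint _ (hXc z)) (left_mem_uIcc)
    rwa [uIcc_of_le hab] at this
  let T : E → C(Icc a b, E) → C(Icc a b, E) := fun y0 z =>
    ⟨fun x => (e x)⁻¹ • (y0 + I z x), by
      have h1 := continuousOn_iff_continuous_domRestrict.1 (hIc z)
      have h2 : Continuous fun x : Icc a b => (e x)⁻¹ :=
        (hec.comp continuous_subtype_val).inv₀ (fun x => (hepos _).ne')
      exact h2.smul (continuous_const.add h1)⟩
  have hT : ∀ y0, ContractingWith (1/2) (T y0) := by
    intro y0
    refine ⟨by norm_num, LipschitzWith.of_dist_le_mul fun z z' => ?_⟩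
    rw [ContinuousMap.dist_le (by positivity)]
    intro x
    have hx := x.2
    have hle : ‖I z x - I z' x‖ ≤ ∫ t in a..x, dist z z' * (L t * Real.exp (2 * ∫ u in a..t, L u)) := by
      have i1 := (hint _ (hXc z)).mono_set (hsub x hx)
      have i2 := (hint _ (hXc z')).mono_set (hsub x hx)
      rw [show I z x - I z' x = ∫ t in a..x, (F t (X z t) - F t (X z' t)) from
        (intervalIntegral.integral_sub i1 i2).symm]
      apply intervalIntegral.norm_integral_le_of_norm_le hx.1
      · have : ∀ᵐ t : ℝ, t ≠ b := by simp [ae_iff]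
        filter_upwards [this] with t htb ht
        have ht' : t ∈ Ioo a b := ⟨ht.1, lt_of_le_of_ne (ht.2.trans hx.2) htb⟩
        have htI : t ∈ Icc a b := Ioo_subset_Icc_self ht'
        refine (hLip t ht' _ _).trans ?_
        have : ‖X z t - X z' t‖ ≤ e t * dist z z' := by
          simp only [X, ← smul_sub, norm_smul, Real.norm_eq_abs, abs_of_pos (hepos t)]
          rw [IccExtend_of_mem hab _ htI, IccExtend_of_mem hab _ htI, ← dist_eq_norm]
          exact mul_le_mul_of_nonneg_left (ContinuousMap.dist_apply_le_dist _) (hepos t).le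
        rw [he t htI] at this
        have := mul_le_mul_of_nonneg_left this (hL0 t ht')
        refine this.trans (le_of_eq ?_)
        simp only [Λ]; ring
      · apply IntervalIntegrable.const_mul
        apply (hL.mono_set (hsub x hx)).mul_continuousOn
        have : ContinuousOn (fun x => ∫ t in a..x, L t) (uIcc a x) :=
          hΛc.mono (by rw [uIcc_of_le hx.1]; exact Icc_subset_Icc_right hx.2)
        fun_prop
    rw [intervalIntegral.integral_const_mul] at hle
    have hw := tlc_weight hL 2 hab (x := a) (y := x) ⟨le_rfl, hab⟩ hx
    simp only [intervalIntegral.integral_same, mul_zero, Real.exp_zero] at hw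
    have hd : dist (T y0 z x) (T y0 z' x) = (e x)⁻¹ * ‖I z x - I z' x‖ := by
      simp only [T, ContinuousMap.coe_mk, dist_eq_norm, ← smul_sub, norm_smul, add_sub_add_left_eq_sub,
        norm_inv, Real.norm_eq_abs, abs_of_pos (hepos x)]
    rw [hd, inv_mul_le_iff₀ (hepos _), he x hx]
    refine hle.trans ?_
    have h5 : (∫ t in a..x, L t * Real.exp (2 * ∫ u in a..t, L u)) ≤ Real.exp (2 * Λ x) / 2 := by
      simp only [Λ]; linarith
    have := mul_le_mul_of_nonneg_left h5 (dist_nonneg (x := z) (y := z'))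
    refine this.trans (le_of_eq ?_)
    push_cast; ring
  let Z : E → C(Icc a b, E) := fun y0 => (hT y0).fixedPoint
  have hZ : ∀ y0, T y0 (Z y0) = Z y0 := fun y0 => (hT y0).fixedPoint_isFixedPt
  have hYeq : ∀ y0, ∀ x ∈ Icc a b, X (Z y0) x = y0 + ∫ t in a..x, F t (X (Z y0) t) := by
    intro y0 x hx
    have h1 : T y0 (Z y0) ⟨x, hx⟩ = Z y0 ⟨x, hx⟩ := by rw [hZ]
    simp only [T, ContinuousMap.coe_mk] at h1
    show e x • IccExtend hab (Z y0) x = _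
    rw [IccExtend_of_mem hab _ hx, ← h1, smul_smul, mul_inv_cancel₀ (hepos x).ne', one_smul]
  refine ⟨fun y0 => X (Z y0), fun y0 => hXc _, hYeq, ?_⟩
  intro x hx
  have hlip : LipschitzWith (Real.toNNReal (2 * Real.exp (2 * ∫ t in a..b, L t))) (fun y0 => X (Z y0) x) := by
    refine LipschitzWith.of_dist_le_mul fun y0 y1 => ?_
    have := tlc_gronwall (φ := fun t => ‖X (Z y0) t - X (Z y1) t‖) (c := ‖y0 - y1‖) hab hL hL0
      (((hXc _).sub (hXc _)).norm) (fun x hx => by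
        show ‖X (Z y0) x - X (Z y1) x‖ ≤ _
        have i1 := (hint _ (hXc (Z y0))).mono_set (hsub x hx)
        have i2 := (hint _ (hXc (Z y1))).mono_set (hsub x hx)
        have : X (Z y0) x - X (Z y1) x = (y0 - y1) + ∫ t in a..x, (F t (X (Z y0) t) - F t (X (Z y1) t)) := by
          rw [intervalIntegral.integral_sub i1 i2, hYeq y0 x hx, hYeq y1 x hx]; abel
        rw [this]
        refine (norm_add_le _ _).trans ?_
        gcongr
        apply intervalIntegral.norm_integral_le_of_norm_le hx.1
        · have : ∀ᵐ t : ℝ, t ≠ b := by simp [ae_iff]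
          filter_upwards [this] with t htb ht
          exact hLip t ⟨ht.1, lt_of_le_of_ne (ht.2.trans hx.2) htb⟩ _ _
        · exact (hL.mono_set (hsub x hx)).mul_continuousOn
            (((hXc _).sub (hXc _)).norm).continuousOn) (fun x => norm_nonneg _) x hx
    rw [dist_eq_norm, dist_eq_norm, Real.coe_toNNReal _ (by positivity)]
    refine this.trans (le_of_eq (by ring))
  exact hlip.continuous

noncomputable def tlcC (z : ℝ) : ℝ := max 0 (min 1 z)
noncomputable def tlcF (z : ℝ) : ℝ := 2 * tlcC z ^ 2 * (1 - tlcC z)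

lemma tlcC_cont : Continuous tlcC := by unfold tlcC; fun_prop
lemma tlcF_cont : Continuous tlcF := by
  have := tlcC_cont
  unfold tlcF; fun_prop
lemma tlcC_mem (z : ℝ) : 0 ≤ tlcC z ∧ tlcC z ≤ 1 := by unfold tlcC; grind
lemma tlcC_of_mem {z : ℝ} (h0 : 0 ≤ z) (h1 : z ≤ 1) : tlcC z = z := by unfold tlcC; grind
lemma tlcC_le_abs (z : ℝ) : tlcC z ≤ |z| := by unfold tlcC; grind
lemma tlcC_one_sub_le (z : ℝ) : 1 - tlcC z ≤ |1 - z| := by unfold tlcC; grind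
lemma tlcC_lip (y z : ℝ) : |tlcC y - tlcC z| ≤ |y - z| := by unfold tlcC; grind
lemma tlcF_nonneg (z : ℝ) : 0 ≤ tlcF z := by
  have := tlcC_mem z
  unfold tlcF
  have : 0 ≤ 1 - tlcC z := by linarith
  positivity
lemma tlcF_of_nonpos {z : ℝ} (h : z ≤ 0) : tlcF z = 0 := by
  have : tlcC z = 0 := by unfold tlcC; grind
  simp [tlcF, this]
lemma tlcF_of_one_le {z : ℝ} (h : 1 ≤ z) : tlcF z = 0 := by
  have : tlcC z = 1 := by unfold tlcC; grind
  simp [tlcF, this]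
lemma tlcF_of_mem {z : ℝ} (h0 : 0 ≤ z) (h1 : z ≤ 1) : tlcF z = 2 * z ^ 2 * (1 - z) := by
  simp [tlcF, tlcC_of_mem h0 h1]
lemma tlcF_le_sq (z : ℝ) : tlcF z ≤ 2 * |z| ^ 2 := by
  have h := tlcC_mem z
  have h2 := tlcC_le_abs z
  unfold tlcF
  have : tlcC z ^ 2 ≤ |z| ^ 2 := pow_le_pow_left₀ h.1 h2 2
  nlinarith [sq_nonneg (tlcC z)]
lemma tlcF_le_abs (z : ℝ) : tlcF z ≤ 2 * |z| := by
  have h := tlcC_mem z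
  have h2 := tlcC_le_abs z
  unfold tlcF
  have : tlcC z ^ 2 ≤ tlcC z := by nlinarith
  nlinarith [sq_nonneg (tlcC z)]
lemma tlcF_le_one_sub (z : ℝ) : tlcF z ≤ 2 * |1 - z| := by
  have h := tlcC_mem z
  have h2 := tlcC_one_sub_le z
  unfold tlcF
  have : tlcC z ^ 2 ≤ 1 := by nlinarith
  nlinarith [sq_nonneg (tlcC z)]
lemma tlcF_diff (y z : ℝ) : |tlcF y - tlcF z| ≤ 6 * |y - z| * (tlcC y + tlcC z) := by
  have hy := tlcC_mem y
  have hz := tlcC_mem z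
  have h := tlcC_lip y z
  have e : tlcF y - tlcF z = 2 * ((tlcC y - tlcC z) *
    (tlcC y + tlcC z - (tlcC y ^ 2 + tlcC y * tlcC z + tlcC z ^ 2))) := by unfold tlcF; ring
  rw [e, abs_mul, abs_mul, abs_two]
  have : |tlcC y + tlcC z - (tlcC y ^ 2 + tlcC y * tlcC z + tlcC z ^ 2)| ≤ 3 * (tlcC y + tlcC z) := by
    rw [abs_le]
    constructor <;> nlinarith [mul_nonneg hy.1 hz.1, mul_nonneg hy.1 (sub_nonneg.2 hy.2), mul_nonneg hz.1 (sub_nonneg.2 hz.2), mul_nonneg hy.1 (sub_nonneg.2 hz.2)]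
  calc 2 * (|tlcC y - tlcC z| * _) ≤ 2 * (|y - z| * (3 * (tlcC y + tlcC z))) := by gcongr
    _ = _ := by ring
lemma tlcF_lip (y z : ℝ) : |tlcF y - tlcF z| ≤ 12 * |y - z| := by
  have := tlcF_diff y z
  nlinarith [tlcC_mem y, tlcC_mem z, abs_nonneg (y - z)]
lemma tlcF_le_two (z : ℝ) : tlcF z ≤ 2 := by
  have h := tlcC_mem z
  unfold tlcF
  have : tlcC z ^ 2 ≤ 1 := by nlinarith
  nlinarith [sq_nonneg (tlcC z)]

structure TlcScal (a b lam s : ℝ) (w p v : ℝ → ℝ) : Prop where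
  hw : IntervalIntegrable w volume a b
  cv : Continuous v
  hp : ∀ x, HasDerivAt p (v x) x
  pa : p a = s
  hv : ∀ x ∈ Icc a b, v x = ∫ t in a..x, -(lam * w t * tlcF (p t))

lemma TlcScal.cp {a b lam s : ℝ} {w p v : ℝ → ℝ} (h : TlcScal a b lam s w p v) : Continuous p :=
  continuous_iff_continuousAt.2 fun x => (h.hp x).continuousAt

lemma TlcScal.gint {a b lam s : ℝ} {w p v : ℝ → ℝ} (h : TlcScal a b lam s w p v) :
    IntervalIntegrable (fun t => -(lam * w t * tlcF (p t))) volume a b :=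
  ((h.hw.const_mul lam).mul_continuousOn (tlcF_cont.comp h.cp).continuousOn).neg

lemma tlc_sub {a b x y : ℝ} (hx : x ∈ Icc a b) (hy : y ∈ Icc a b) : uIcc x y ⊆ uIcc a b := by
  rw [uIcc_of_le (hx.1.trans hx.2)]; exact uIcc_subset_Icc hx hy

lemma TlcScal.vsub {a b lam s : ℝ} {w p v : ℝ → ℝ} (h : TlcScal a b lam s w p v)
    {x y : ℝ} (hx : x ∈ Icc a b) (hy : y ∈ Icc a b) :
    v y - v x = ∫ t in x..y, -(lam * w t * tlcF (p t)) := by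
  have ha : a ∈ Icc a b := ⟨le_rfl, hx.1.trans hx.2⟩
  rw [h.hv x hx, h.hv y hy]
  exact intervalIntegral.integral_interval_sub_left (h.gint.mono_set (tlc_sub ha hy))
    (h.gint.mono_set (tlc_sub ha hx))

lemma TlcScal.psub {a b lam s : ℝ} {w p v : ℝ → ℝ} (h : TlcScal a b lam s w p v) (x y : ℝ) :
    p y - p x = ∫ t in x..y, v t :=
  (intervalIntegral.integral_eq_sub_of_hasDerivAt (fun t _ => h.hp t) (h.cv.intervalIntegrable _ _)).symm

lemma tlc_exit {u v : ℝ → ℝ} {a b θ : ℝ}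
    (hu : ∀ x, HasDerivAt u (v x) x)
    (hv : ∀ x ∈ Icc a b, ∀ y ∈ Icc a b, x ≤ y → (∀ t ∈ Icc x y, θ ≤ u t) → v y = v x)
    (hua : u a < θ) {x1 : ℝ} (hx1 : x1 ∈ Icc a b) (h1 : θ < u x1) : 0 < v b := by
  have cu : Continuous u := continuous_iff_continuousAt.2 fun x => (hu x).continuousAt
  have hv1 : 0 < v x1 := by
    have hcomp : IsCompact (Icc a x1 ∩ {x | u x ≤ θ}) :=
      isCompact_Icc.inter_right (isClosed_le cu continuous_const)
    obtain ⟨x0, ⟨hx0, hx0u⟩, hgr⟩ := hcomp.exists_isGreatest ⟨a, ⟨le_rfl, hx1.1⟩, hua.le⟩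
    have hx0u' : u x0 ≤ θ := hx0u
    have hlt : x0 < x1 := lt_of_le_of_ne hx0.2 (by rintro rfl; linarith)
    have hx0e : u x0 = θ := by
      obtain ⟨x, hx, hxe⟩ := intermediate_value_Icc hlt.le cu.continuousOn (show θ ∈ Icc (u x0) (u x1) from ⟨hx0u', h1.le⟩)
      have := hgr (⟨⟨hx0.1.trans hx.1, hx.2⟩, hxe.le⟩ : x ∈ Icc a x1 ∩ {x | u x ≤ θ})
      rw [← le_antisymm this hx.1, hxe]
    have hge : ∀ t ∈ Icc x0 x1, θ ≤ u t := by
      intro t ht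
      by_contra hc
      push Not at hc
      have := hgr (⟨⟨hx0.1.trans ht.1, ht.2⟩, hc.le⟩ : t ∈ Icc a x1 ∩ {x | u x ≤ θ})
      rw [le_antisymm this ht.1] at hc
      linarith
    obtain ⟨ξ, hξ, hξe⟩ := exists_hasDerivAt_eq_slope u v hlt cu.continuousOn (fun x _ => hu x)
    have m0 : x0 ∈ Icc a b := ⟨hx0.1, hx0.2.trans hx1.2⟩
    have e1 := hv x0 m0 x1 hx1 hlt.le hge
    have e2 := hv x0 m0 ξ ⟨m0.1.trans hξ.1.le, hξ.2.le.trans hx1.2⟩ hξ.1.le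
      (fun t ht => hge t ⟨ht.1, ht.2.trans hξ.2.le⟩)
    rw [e1, ← e2, hξe]
    apply div_pos <;> linarith
  have hall : ∀ y ∈ Icc x1 b, θ < u y := by
    by_contra hc
    push Not at hc
    obtain ⟨y, hy, hyu⟩ := hc
    have hcomp : IsCompact (Icc x1 b ∩ {x | u x ≤ θ}) :=
      isCompact_Icc.inter_right (isClosed_le cu continuous_const)
    obtain ⟨y0, ⟨hy0, hy0u⟩, hle⟩ := hcomp.exists_isLeast ⟨y, hy, hyu⟩
    have hy0u' : u y0 ≤ θ := hy0u
    have hlt : x1 < y0 := lt_of_le_of_ne hy0.1 (by rintro rfl; linarith)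
    obtain ⟨ξ, hξ, hξe⟩ := exists_hasDerivAt_eq_slope u v hlt cu.continuousOn (fun x _ => hu x)
    have hge : ∀ t ∈ Icc x1 ξ, θ ≤ u t := by
      intro t ht
      by_contra hc
      push Not at hc
      have := hle (⟨⟨ht.1, ht.2.trans (hξ.2.le.trans hy0.2)⟩, hc.le⟩ : t ∈ Icc x1 b ∩ {x | u x ≤ θ})
      linarith [ht.2, hξ.2]
    have e2 := hv x1 hx1 ξ ⟨hx1.1.trans hξ.1.le, hξ.2.le.trans hy0.2⟩ hξ.1.le hge
    rw [hξe] at e2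
    have : (u y0 - u x1) / (y0 - x1) < 0 := div_neg_of_neg_of_pos (by linarith) (by linarith)
    linarith
  rw [hv x1 hx1 b ⟨hx1.1.trans hx1.2, le_rfl⟩ hx1.2 (fun t ht => (hall t ht).le)]
  exact hv1

lemma TlcScal.exit_one {a b lam s : ℝ} {w p v : ℝ → ℝ} (h : TlcScal a b lam s w p v) (hs : s < 1)
    {x : ℝ} (hx : x ∈ Icc a b) (hpx : 1 < p x) : 0 < v b := by
  refine tlc_exit h.hp (θ := 1) (fun x hx y hy hxy ht => ?_) (h.pa.trans_lt hs) hx hpx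
  have := h.vsub hx hy
  rw [intervalIntegral.integral_congr (g := fun _ => 0)] at this
  · simp at this; linarith
  · intro t htm
    rw [uIcc_of_le hxy] at htm
    simp [tlcF_of_one_le (ht t htm)]

lemma TlcScal.exit_zero {a b lam s : ℝ} {w p v : ℝ → ℝ} (h : TlcScal a b lam s w p v) (hs : 0 < s)
    {x : ℝ} (hx : x ∈ Icc a b) (hpx : p x < 0) : v b < 0 := by
  have : 0 < -v b := by
    refine tlc_exit (u := fun x => -p x) (v := fun x => -v x) (a := a) (fun x => (h.hp x).neg) (θ := 0) (fun x hx y hy hxy ht => ?_)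
      (by simp only [h.pa]; linarith) hx (by linarith)
    have := h.vsub hx hy
    rw [intervalIntegral.integral_congr (g := fun _ => 0)] at this
    · simp at this; linarith
    · intro t htm
      rw [uIcc_of_le hxy] at htm
      simp [tlcF_of_nonpos (z := p t) (by linarith [ht t htm])]
  linarith

lemma TlcScal.mem_of_zero {a b lam s : ℝ} {w p v : ℝ → ℝ} (h : TlcScal a b lam s w p v) (hs : 0 < s)
    (hs1 : s < 1) (hb : v b = 0) : ∀ x ∈ Icc a b, p x ∈ Icc (0:ℝ) 1 := by
  intro x hx
  constructor
  · by_contra hc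
    exact absurd hb (h.exit_zero hs hx (not_le.1 hc)).ne
  · by_contra hc
    exact absurd hb (h.exit_one hs1 hx (not_le.1 hc)).ne'

lemma TlcScal.var {a b lam s : ℝ} {w p v W : ℝ → ℝ} (h : TlcScal a b lam s w p v) (hlam : 0 < lam)
    (hW : IntervalIntegrable W volume a b) (hwW : ∀ t ∈ Ioo a b, |w t| ≤ W t)
    {θ : ℝ} (hθ : ∀ z, tlcF z ≤ 2 * |z - θ|) {x y : ℝ} (hx : x ∈ Icc a b) (hy : y ∈ Icc a b)
    (hxy : x ≤ y) :
    |p y - p x| + |v y - v x| ≤ ∫ t in x..y, (1 + 2 * lam * W t) * (|p t - θ| + |v t|) := by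
  have cp := h.cp
  have cv := h.cv
  have hW' := hW.mono_set (tlc_sub hx hy)
  have iB : IntervalIntegrable (fun t => lam * W t * (2 * |p t - θ|)) volume x y :=
    (hW'.const_mul lam).mul_continuousOn (by fun_prop)
  have iA : IntervalIntegrable (fun t => |v t|) volume x y := (cv.abs).intervalIntegrable _ _
  have iC : IntervalIntegrable (fun t => (1 + 2 * lam * W t) * (|p t - θ| + |v t|)) volume x y :=
    ((intervalIntegrable_const (c := (1:ℝ))).add (hW'.const_mul (2 * lam))).mul_continuousOn (by fun_prop)
  have h1 : |p y - p x| ≤ ∫ t in x..y, |v t| := by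
    rw [h.psub]; exact intervalIntegral.abs_integral_le_integral_abs hxy
  have hne : ∀ᵐ t : ℝ, t ≠ b := by simp [ae_iff]
  have h2 : |v y - v x| ≤ ∫ t in x..y, lam * W t * (2 * |p t - θ|) := by
    rw [h.vsub hx hy, ← Real.norm_eq_abs]
    apply intervalIntegral.norm_integral_le_of_norm_le hxy _ iB
    filter_upwards [hne] with t htb ht
    have ht' : t ∈ Ioo a b := ⟨hx.1.trans_lt ht.1, lt_of_le_of_ne (ht.2.trans hy.2) htb⟩
    rw [norm_neg, Real.norm_eq_abs, abs_mul, abs_mul, abs_of_pos hlam, abs_of_nonneg (tlcF_nonneg _)]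
    have := hwW t ht'
    have := hθ (p t)
    have := tlcF_nonneg (p t)
    have : 0 ≤ W t := (abs_nonneg _).trans (hwW t ht')
    gcongr
  have h3 : ∫ t in x..y, (|v t| + lam * W t * (2 * |p t - θ|)) ≤
      ∫ t in x..y, (1 + 2 * lam * W t) * (|p t - θ| + |v t|) := by
    apply intervalIntegral.integral_mono_on_of_le_Ioo hxy (iA.add iB) iC
    intro t ht
    have ht' : t ∈ Ioo a b := ⟨hx.1.trans_lt ht.1, ht.2.trans_le hy.2⟩
    have : 0 ≤ W t := (abs_nonneg _).trans (hwW t ht')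
    have := mul_nonneg (mul_nonneg hlam.le this) (abs_nonneg (v t))
    nlinarith [abs_nonneg (p t - θ)]
  rw [intervalIntegral.integral_add iA iB] at h3
  linarith

lemma TlcScal.grow {a b lam s : ℝ} {w p v W : ℝ → ℝ} (h : TlcScal a b lam s w p v) (hlam : 0 < lam)
    (hab : a ≤ b)
    (hW : IntervalIntegrable W volume a b) (hwW : ∀ t ∈ Ioo a b, |w t| ≤ W t)
    {θ : ℝ} (hθ : ∀ z, tlcF z ≤ 2 * |z - θ|) : ∀ x ∈ Icc a b,
    |p x - θ| + |v x| ≤ 2 * |s - θ| * Real.exp (2 * ∫ t in a..b, (1 + 2 * lam * W t)) := by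
  have cp := h.cp
  have cv := h.cv
  have ha : a ∈ Icc a b := ⟨le_rfl, hab⟩
  have va : v a = 0 := by rw [h.hv a ha]; simp
  refine tlc_gronwall (φ := fun x => |p x - θ| + |v x|) hab
    ((intervalIntegrable_const (c := (1:ℝ))).add (hW.const_mul (2 * lam))) ?_ (by fun_prop) ?_ ?_
  · intro t ht
    have : 0 ≤ W t := (abs_nonneg _).trans (hwW t ht)
    positivity
  · intro x hx
    have := h.var hlam hW hwW hθ ha hx hx.1
    rw [va, sub_zero, h.pa] at this
    have := abs_sub_le (p x) s θ
    linarith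
  · intro x; positivity

lemma TlcScal.back {a b lam s : ℝ} {w p v W : ℝ → ℝ} (h : TlcScal a b lam s w p v) (hlam : 0 < lam)
    (hW : IntervalIntegrable W volume a b) (hwW : ∀ t ∈ Ioo a b, |w t| ≤ W t)
    {θ : ℝ} (hθ : ∀ z, tlcF z ≤ 2 * |z - θ|) {x0 : ℝ} (hx0 : x0 ∈ Icc a b) (hp : p x0 = θ)
    (hv : v x0 = 0) : s = θ := by
  have cp := h.cp
  have cv := h.cv
  have ha : a ∈ Icc a b := ⟨le_rfl, hx0.1.trans hx0.2⟩
  have := tlc_gronwall_back (L := fun t => 1 + 2 * lam * W t) (φ := fun x => |p x - θ| + |v x|) hx0.1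
    (((intervalIntegrable_const (c := (1:ℝ))).add (hW.const_mul (2 * lam))).mono_set (tlc_sub ha hx0))
    (fun t ht => by
      have : 0 ≤ W t := (abs_nonneg _).trans (hwW t ⟨ht.1, ht.2.trans_le hx0.2⟩)
      positivity) (by fun_prop)
    (fun x hx => by
      have := h.var hlam hW hwW hθ ⟨hx.1, hx.2.trans hx0.2⟩ hx0 hx.2
      rw [hv, hp, zero_sub, abs_neg, abs_sub_comm] at this
      exact this)
    (fun x => by positivity) a ⟨le_rfl, hx0.1⟩
  rw [h.pa] at this
  have h2 : |s - θ| = 0 := by linarith [abs_nonneg (v a), abs_nonneg (s - θ)]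
  linarith [abs_eq_zero.1 h2]

lemma tlc_small {a b lam : ℝ} (hab : a < b) (hlam : 0 < lam) {W β : ℝ → ℝ}
    (hW : IntervalIntegrable W volume a b) (hβ : IntervalIntegrable β volume a b)
    (hβn : ∫ t in a..b, β t < 0) :
    ∃ ε0 > 0, ∀ s w p v, TlcScal a b lam s w p v → (∀ t ∈ Ioo a b, |w t| ≤ W t) →
      (∀ t ∈ Ioo a b, w t ≤ β t) → 0 < s → s ≤ ε0 → 0 < v b ∧ ∀ x ∈ Icc a b, p x < 1 / 2 := by
  by_cases hW0 : ∀ t ∈ Ioo a b, 0 ≤ W t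
  swap
  · push Not at hW0
    obtain ⟨t, ht, htn⟩ := hW0
    refine ⟨1, one_pos, fun s w p v _ h2 => ?_⟩
    linarith [h2 t ht, abs_nonneg (w t)]
  set C := 2 * Real.exp (2 * ∫ t in a..b, (1 + 2 * lam * W t)) with hC
  set K := ∫ t in a..b, W t with hK
  set η := -∫ t in a..b, β t with hη
  have hC0 : 0 < C := by positivity
  have hWint : ∀ x ∈ Icc a b, ∫ t in a..x, W t ≤ K := by
    intro x hx
    have hb : b ∈ Icc a b := ⟨hab.le, le_rfl⟩
    have ha : a ∈ Icc a b := ⟨le_rfl, hab.le⟩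
    rw [hK, ← intervalIntegral.integral_add_adjacent_intervals (hW.mono_set (tlc_sub ha hx))
      (hW.mono_set (tlc_sub hx hb))]
    have : 0 ≤ ∫ t in x..b, W t := by
      have := intervalIntegral.integral_mono_on_of_le_Ioo hx.2
        (intervalIntegrable_const (c := (0:ℝ))) (hW.mono_set (tlc_sub hx hb))
        (fun t ht => hW0 t ⟨hx.1.trans_lt ht.1, ht.2⟩)
      simpa using this
    linarith
  have hK0 : 0 ≤ K := by simpa using hWint a ⟨le_rfl, hab.le⟩
  have hη0 : 0 < η := by linarith
  set C1 := (b - a) * (lam * K * (2 * C ^ 2)) with hC1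
  have hba : 0 < b - a := by linarith
  have hC10 : 0 ≤ C1 := by positivity
  set C2 := 6 * C1 * (C + 1) with hC2
  have hC20 : 0 ≤ C2 := by positivity
  refine ⟨min (1 / (2 * (C + 1))) (η / (K * C2 + 1)), by positivity, ?_⟩
  intro s w p v h hwW hwβ hs0 hsε
  have hs1 := hsε.trans (min_le_left _ _)
  have hs2 := hsε.trans (min_le_right _ _)
  rw [le_div_iff₀ (by positivity)] at hs1 hs2
  have hsh : s ≤ 1 / 2 := by nlinarith
  have hgr := h.grow hlam hab.le hW hwW (θ := 0) (fun z => by simpa using tlcF_le_abs z)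
  have hp : ∀ x ∈ Icc a b, |p x| ≤ C * s := by
    intro x hx
    have := hgr x hx
    simp only [sub_zero, abs_of_pos hs0] at this
    have := abs_nonneg (v x)
    rw [hC]; nlinarith
  refine ⟨?_, fun x hx => by nlinarith [hp x hx, le_abs_self (p x)]⟩
  have hne : ∀ᵐ t : ℝ, t ≠ b := by simp [ae_iff]
  have ha : a ∈ Icc a b := ⟨le_rfl, hab.le⟩
  have hb : b ∈ Icc a b := ⟨hab.le, le_rfl⟩
  have hv : ∀ x ∈ Icc a b, |v x| ≤ lam * K * (2 * C ^ 2) * s ^ 2 := by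
    intro x hx
    rw [h.hv x hx]
    have : ‖∫ t in a..x, -(lam * w t * tlcF (p t))‖ ≤ ∫ t in a..x, (lam * (2 * (C * s) ^ 2)) * W t := by
      apply intervalIntegral.norm_integral_le_of_norm_le hx.1 _ ((hW.mono_set (tlc_sub ha hx)).const_mul _)
      filter_upwards [hne] with t htb ht
      have ht' : t ∈ Ioo a b := ⟨ht.1, lt_of_le_of_ne (ht.2.trans hx.2) htb⟩
      rw [norm_neg, Real.norm_eq_abs, abs_mul, abs_mul, abs_of_pos hlam, abs_of_nonneg (tlcF_nonneg _)]
      have h1 := hwW t ht'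
      have h2 : tlcF (p t) ≤ 2 * (C * s) ^ 2 := by
        refine (tlcF_le_sq _).trans ?_
        have := hp t (Ioo_subset_Icc_self ht')
        gcongr
      calc lam * |w t| * tlcF (p t) ≤ lam * W t * (2 * (C * s) ^ 2) :=
            mul_le_mul (mul_le_mul_of_nonneg_left h1 hlam.le) h2 (tlcF_nonneg _)
              (mul_nonneg hlam.le (hW0 t ht'))
        _ = _ := by ring
    rw [intervalIntegral.integral_const_mul] at this
    refine this.trans ?_
    calc _ ≤ lam * (2 * (C * s) ^ 2) * K := by
          gcongr; exact hWint x hx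
      _ = _ := by ring
  have hps : ∀ x ∈ Icc a b, |p x - s| ≤ C1 * s ^ 2 := by
    intro x hx
    rw [← h.pa, h.psub, ← Real.norm_eq_abs]
    refine (intervalIntegral.norm_integral_le_of_norm_le_const (C := lam * K * (2 * C ^ 2) * s ^ 2) ?_).trans ?_
    · intro t ht
      rw [uIoc_of_le hx.1] at ht
      exact hv t ⟨ht.1.le, ht.2.trans hx.2⟩
    · rw [abs_of_nonneg (by linarith [hx.1]), hC1]
      have : x - a ≤ b - a := by linarith [hx.2]
      calc _ ≤ lam * K * (2 * C ^ 2) * s ^ 2 * (b - a) := by gcongr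
        _ = _ := by rw [h.pa]; ring
  have hFd : ∀ x ∈ Icc a b, |tlcF (p x) - tlcF s| ≤ C2 * s ^ 3 := by
    intro x hx
    refine (tlcF_diff _ _).trans ?_
    have h1 := (tlcC_le_abs (p x)).trans (hp x hx)
    have h2 := tlcC_le_abs s
    rw [abs_of_pos hs0] at h2
    have h3 := hps x hx
    have := tlcC_mem (p x)
    have := tlcC_mem s
    have hn : 0 ≤ tlcC (p x) + tlcC s := by linarith
    calc _ ≤ 6 * (C1 * s ^ 2) * (C * s + s) := by gcongr
      _ = _ := by rw [hC2]; ring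
  have hFs : s ^ 2 ≤ tlcF s := by
    rw [tlcF_of_mem hs0.le (by linarith)]
    nlinarith [sq_nonneg s]
  have hlow : ∫ t in a..b, (-(lam * tlcF s) * β t + -(lam * (C2 * s ^ 3)) * W t) ≤ v b := by
    rw [h.hv b hb]
    apply intervalIntegral.integral_mono_on_of_le_Ioo hab.le _ h.gint
    · intro t ht
      have h1 := hFd t (Ioo_subset_Icc_self ht)
      have h2 : w t * (tlcF (p t) - tlcF s) ≤ W t * (C2 * s ^ 3) := by
        refine (le_abs_self _).trans ?_
        rw [abs_mul]
        have := hW0 t ht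
        have := hwW t ht
        gcongr
      have h3 : w t * tlcF s ≤ β t * tlcF s := mul_le_mul_of_nonneg_right (hwβ t ht) (tlcF_nonneg _)
      nlinarith
    · exact (hβ.const_mul _).add (hW.const_mul _)
  rw [intervalIntegral.integral_add (hβ.const_mul _) (hW.const_mul _), intervalIntegral.integral_const_mul,
    intervalIntegral.integral_const_mul] at hlow
  have e : -(lam * tlcF s) * (∫ t in a..b, β t) = lam * tlcF s * η := by rw [hη]; ring
  rw [e] at hlow
  have h1 : lam * s ^ 2 * η ≤ lam * tlcF s * η := by gcongr
  have h2 : 0 < lam * s ^ 2 * (η - C2 * s * K) := by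
    have : 0 < η - C2 * s * K := by nlinarith
    positivity
  nlinarith

lemma tlc_mid {a b lam c d : ℝ} (hcd : c < d) (hsub : Icc c d ⊆ Ioo a b) (hlam : 0 < lam)
    {α : ℝ → ℝ} (hα : IntervalIntegrable α volume a b) (hαp : ∀ t ∈ Icc c d, 0 < α t)
    {δ m i1 i2 : ℝ} (hδ : δ = (d - c) / 4) (hm : m = (c + d) / 2)
    (hi1 : i1 = ∫ t in (m - δ)..m, α t) (hi2 : i2 = ∫ t in m..(m + δ), α t)
    (hl1 : 8 < lam * (δ * i1)) (hl2 : 8 < lam * (δ * i2)) :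
    ∀ s w p v, TlcScal a b lam s w p v → (∀ t ∈ Ioo a b, α t ≤ w t) → 0 < s → p m = 1 / 2 →
      v b < 0 := by
  intro s w p v h hαw hs hpm
  by_contra hvb
  have hpos : ∀ x ∈ Icc a b, 0 ≤ p x := by
    intro x hx
    by_contra hc
    exact hvb (h.exit_zero hs hx (not_le.1 hc))
  have hIcc : ∀ x ∈ Icc c d, x ∈ Icc a b := fun x hx => Ioo_subset_Icc_self (hsub hx)
  have hδ0 : 0 < δ := by rw [hδ]; linarith
  have hanti : ∀ x ∈ Icc c d, ∀ y ∈ Icc c d, x ≤ y → v y ≤ v x := by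
    intro x hx y hy hxy
    have := h.vsub (hIcc x hx) (hIcc y hy)
    have h2 : (∫ t in x..y, -(lam * w t * tlcF (p t))) ≤ 0 := by
      have := intervalIntegral.integral_mono_on hxy (h.gint.mono_set (tlc_sub (hIcc x hx) (hIcc y hy)))
        (intervalIntegrable_const (c := (0:ℝ))) (fun t ht => by
          have ht' : t ∈ Icc c d := ⟨hx.1.trans ht.1, ht.2.trans hy.2⟩
          have : 0 < w t := (hαp t ht').trans_le (hαw t (hsub ht'))
          have := tlcF_nonneg (p t)
          have : 0 ≤ lam * w t * tlcF (p t) := by positivity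
          linarith)
      simpa using this
    linarith
  have hdrop : ∀ x ∈ Icc c d, ∀ y ∈ Icc c d, x ≤ y → (∀ t ∈ Icc x y, 1 / 4 ≤ p t ∧ p t ≤ 1 / 2) →
      v y - v x ≤ - (lam / 16 * ∫ t in x..y, α t) := by
    intro x hx y hy hxy hq
    rw [h.vsub (hIcc x hx) (hIcc y hy), ← intervalIntegral.integral_const_mul,
      ← intervalIntegral.integral_neg]
    apply intervalIntegral.integral_mono_on hxy (h.gint.mono_set (tlc_sub (hIcc x hx) (hIcc y hy)))
      ((hα.const_mul _).neg.mono_set (tlc_sub (hIcc x hx) (hIcc y hy)))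
    intro t ht
    have ht' : t ∈ Icc c d := ⟨hx.1.trans ht.1, ht.2.trans hy.2⟩
    have h1 := hαp t ht'
    have h2 := hαw t (hsub ht')
    have h3 : 1 / 16 ≤ tlcF (p t) := by
      obtain ⟨q1, q2⟩ := hq t ht
      rw [tlcF_of_mem (by linarith) (by linarith)]
      nlinarith
    have : α t * (1 / 16) ≤ w t * tlcF (p t) := mul_le_mul h2 h3 (by norm_num) (by linarith)
    show -(lam * w t * tlcF (p t)) ≤ -(lam / 16 * α t)
    nlinarith
  have mm : m ∈ Icc c d := by constructor <;> rw [hm] <;> linarith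
  have mp : m + δ ∈ Icc c d := by constructor <;> rw [hm, hδ] <;> linarith
  have mn : m - δ ∈ Icc c d := by constructor <;> rw [hm, hδ] <;> linarith
  have md : d ∈ Icc c d := ⟨hcd.le, le_rfl⟩
  have mc : c ∈ Icc c d := ⟨le_rfl, hcd.le⟩
  have ed : d - (m + δ) = δ := by rw [hm, hδ]; ring
  have ec : (m - δ) - c = δ := by rw [hm, hδ]; ring
  have mvt : ∀ x y, x < y → ∃ ξ ∈ Ioo x y, p y - p x = v ξ * (y - x) := by
    intro x y hxy
    obtain ⟨ξ, hξ, e⟩ := exists_hasDerivAt_eq_slope p v hxy h.cp.continuousOn (fun x _ => h.hp x)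
    refine ⟨ξ, hξ, ?_⟩
    rw [e, div_mul_cancel₀ _ (by linarith)]
  rcases le_total (v m) 0 with hvm | hvm
  · have hdec : ∀ x ∈ Icc m d, ∀ y ∈ Icc m d, x ≤ y → p y ≤ p x := by
      intro x hx y hy hxy
      rcases hxy.eq_or_lt with rfl | hlt
      · exact le_rfl
      obtain ⟨ξ, hξ, e⟩ := mvt x y hlt
      have : v ξ ≤ v m := hanti m mm ξ ⟨mm.1.trans (hx.1.trans hξ.1.le), hξ.2.le.trans hy.2⟩ (hx.1.trans hξ.1.le)
      nlinarith
    obtain ⟨ξ1, hξ1, e1⟩ := mvt m (m + δ) (by linarith)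
    obtain ⟨ξ2, hξ2, e2⟩ := mvt (m + δ) d (by linarith)
    rw [ed] at e2
    have a1 : v (m + δ) ≤ v ξ1 := hanti ξ1 ⟨mm.1.trans hξ1.1.le, hξ1.2.le.trans mp.2⟩ _ mp hξ1.2.le
    have a2 : v ξ2 ≤ v (m + δ) := hanti _ mp ξ2 ⟨mp.1.trans hξ2.1.le, hξ2.2.le⟩ hξ2.1.le
    have pd := hpos d (hIcc d md)
    have hq : 1 / 4 ≤ p (m + δ) := by nlinarith
    have hd := hdrop m mm (m + δ) mp (by linarith) (fun t ht =>
      ⟨hq.trans (hdec t ⟨ht.1, ht.2.trans mp.2⟩ _ ⟨by linarith, mp.2⟩ ht.2),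
        (hdec m ⟨le_rfl, mm.2⟩ t ⟨ht.1, ht.2.trans mp.2⟩ ht.1).trans hpm.le⟩)
    rw [← hi2] at hd
    have hq2 : p (m + δ) ≤ 1 / 2 := (hdec m ⟨le_rfl, mm.2⟩ _ ⟨by linarith, mp.2⟩ (by linarith)).trans hpm.le
    have : v ξ2 * δ ≤ -(lam / 16 * i2) * δ := by
      apply mul_le_mul_of_nonneg_right _ hδ0.le
      linarith
    nlinarith
  · have hinc : ∀ x ∈ Icc c m, ∀ y ∈ Icc c m, x ≤ y → p x ≤ p y := by
      intro x hx y hy hxy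
      rcases hxy.eq_or_lt with rfl | hlt
      · exact le_rfl
      obtain ⟨ξ, hξ, e⟩ := mvt x y hlt
      have : v m ≤ v ξ := hanti ξ ⟨hx.1.trans hξ.1.le, hξ.2.le.trans (hy.2.trans mm.2)⟩ m mm (hξ.2.le.trans hy.2)
      nlinarith
    obtain ⟨ξ1, hξ1, e1⟩ := mvt (m - δ) m (by linarith)
    obtain ⟨ξ2, hξ2, e2⟩ := mvt c (m - δ) (by linarith)
    rw [ec] at e2
    have a1 : v ξ1 ≤ v (m - δ) := hanti _ mn ξ1 ⟨mn.1.trans hξ1.1.le, hξ1.2.le.trans mm.2⟩ hξ1.1.le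
    have a2 : v (m - δ) ≤ v ξ2 := hanti ξ2 ⟨hξ2.1.le, hξ2.2.le.trans mn.2⟩ _ mn hξ2.2.le
    have pc := hpos c (hIcc c mc)
    have hq : 1 / 4 ≤ p (m - δ) := by nlinarith
    have hd := hdrop (m - δ) mn m mm (by linarith) (fun t ht =>
      ⟨hq.trans (hinc _ ⟨mn.1, by linarith⟩ t ⟨mn.1.trans ht.1, ht.2⟩ ht.1),
        (hinc t ⟨mn.1.trans ht.1, ht.2⟩ m ⟨mm.1, le_rfl⟩ ht.2).trans hpm.le⟩)
    rw [← hi1] at hd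
    have hq2 : p (m - δ) ≤ 1 / 2 := (hinc _ ⟨mn.1, by linarith⟩ m ⟨mm.1, le_rfl⟩ (by linarith)).trans hpm.le
    have : (lam / 16 * i1) * δ ≤ v ξ2 * δ := by
      apply mul_le_mul_of_nonneg_right _ hδ0.le
      linarith
    nlinarith

lemma TlcScal.large_core {a b lam s : ℝ} {w p v β : ℝ → ℝ} (h : TlcScal a b lam s w p v)
    (hlam : 0 < lam) (hab : a < b) (hβ : IntervalIntegrable β volume a b)
    (hβn : ∫ t in a..b, β t < 0) (hwβ : ∀ t ∈ Ioo a b, w t ≤ β t)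
    (hp : ∀ x ∈ Icc a b, 2 / 3 < p x ∧ p x < 1) : 0 < v b := by
  have hu : uIcc a b = Icc a b := uIcc_of_le hab.le
  have hpC : ContDiff ℝ 1 p := by
    rw [contDiff_one_iff_deriv]
    refine ⟨fun x => (h.hp x).differentiableAt, ?_⟩
    have : deriv p = v := funext fun x => (h.hp x).deriv
    rw [this]; exact h.cv
  have hf0 : ∀ x ∈ Icc a b, 0 < 2 * p x ^ 2 * (1 - p x) := by
    intro x hx
    obtain ⟨h1, h2⟩ := hp x hx
    have : 0 < p x := by linarith
    have : 0 < 1 - p x := by linarith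
    positivity
  have hacu : AbsolutelyContinuousOnInterval (fun x => (2 * p x ^ 2 * (1 - p x))⁻¹) a b := by
    apply ContDiffOn.absolutelyContinuousOnInterval
    apply ContDiffOn.inv
    · exact (((contDiff_const.mul (hpC.pow 2)).mul (contDiff_const.sub hpC))).contDiffOn
    · intro x hx
      rw [hu] at hx
      exact (hf0 x hx).ne'
  have hacv := h.gint.absolutelyContinuousOnInterval_intervalIntegral (c := a) (by simp)
  have hac := hacv.fun_mul hacu
  have e := hac.integral_deriv_eq_sub
  have hb : b ∈ Icc a b := ⟨hab.le, le_rfl⟩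
  rw [← h.hv b hb] at e
  simp only [intervalIntegral.integral_same, zero_mul, sub_zero] at e
  have hne : ∀ᵐ t : ℝ, t ≠ b := by simp [ae_iff]
  have hne' : ∀ᵐ t : ℝ, t ≠ a := by simp [ae_iff]
  have hle : ∫ t in a..b, -lam * β t ≤ ∫ t in a..b, deriv (fun x => (∫ t in a..x, -(lam * w t * tlcF (p t))) * (2 * p x ^ 2 * (1 - p x))⁻¹) t := by
    apply intervalIntegral.integral_mono_ae_restrict hab.le (hβ.const_mul _) hac.intervalIntegrable_deriv
    rw [Filter.EventuallyLE, ae_restrict_iff' measurableSet_Icc]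
    filter_upwards [hne, hne', h.gint.ae_hasDerivAt_integral] with x hxb hxa hd hx
    have hxo : x ∈ Ioo a b := ⟨lt_of_le_of_ne hx.1 (Ne.symm hxa), lt_of_le_of_ne hx.2 hxb⟩
    have hd1 := hd (hu ▸ hx) a (by simp)
    have hp1 := h.hp x
    have hd2 : HasDerivAt (fun x => (2 * p x ^ 2 * (1 - p x))⁻¹)
        (-((4 * p x * v x) * (1 - p x) + (2 * p x ^ 2) * (-v x)) / (2 * p x ^ 2 * (1 - p x)) ^ 2) x := by
      have q1 : HasDerivAt (fun x => 2 * p x ^ 2) (4 * p x * v x) x := by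
        convert! (hp1.pow 2).const_mul 2 using 1
        simp; ring
      exact (q1.mul (hp1.const_sub 1)).inv (hf0 x hx).ne'
    rw [(hd1.fun_mul hd2).deriv, ← h.hv x hx]
    obtain ⟨h1, h2⟩ := hp x hx
    have h3 := hf0 x hx
    rw [tlcF_of_mem (by linarith) h2.le]
    have e1 : -(lam * w x * (2 * p x ^ 2 * (1 - p x))) * (2 * p x ^ 2 * (1 - p x))⁻¹ = - lam * w x := by
      have h3' := h3.ne'
      rw [neg_mul, mul_assoc, mul_inv_cancel₀ h3']; ring
    rw [e1]
    have h4 : 0 ≤ v x * (-((4 * p x * v x) * (1 - p x) + (2 * p x ^ 2) * (-v x)) / (2 * p x ^ 2 * (1 - p x)) ^ 2) := by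
      rw [← mul_div_assoc]
      apply div_nonneg _ (by positivity)
      have : 0 ≤ (v x) ^ 2 * (p x * (6 * p x - 4)) := by
        apply mul_nonneg (sq_nonneg _)
        apply mul_nonneg <;> linarith
      nlinarith
    have := hwβ x hxo
    nlinarith
  rw [e, intervalIntegral.integral_const_mul] at hle
  have h1 : 0 < v b * (2 * p b ^ 2 * (1 - p b))⁻¹ := by nlinarith
  exact (pos_iff_pos_of_mul_pos h1).2 (inv_pos.2 (hf0 b hb))

lemma tlc_large {a b lam : ℝ} (hab : a < b) (hlam : 0 < lam) {W β : ℝ → ℝ}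
    (hW : IntervalIntegrable W volume a b) (hβ : IntervalIntegrable β volume a b)
    (hβn : ∫ t in a..b, β t < 0) :
    ∃ ε0 > 0, ∀ s w p v, TlcScal a b lam s w p v → (∀ t ∈ Ioo a b, |w t| ≤ W t) →
      (∀ t ∈ Ioo a b, w t ≤ β t) → s < 1 → 1 - ε0 ≤ s → 0 < v b ∧ ∀ x ∈ Icc a b, 1 / 2 < p x := by
  set C := 2 * Real.exp (2 * ∫ t in a..b, (1 + 2 * lam * W t)) with hC
  have hC0 : 0 < C := by positivity
  refine ⟨1 / (4 * C), by positivity, ?_⟩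
  intro s w p v h hwW hwβ hs1 hs
  have hθ : ∀ z, tlcF z ≤ 2 * |z - 1| := fun z => by
    rw [abs_sub_comm]; exact tlcF_le_one_sub z
  have hgr := h.grow hlam hab.le hW hwW hθ
  have hsC : (1 - s) * (4 * C) ≤ 1 := by
    rw [← le_div_iff₀ (by positivity)]; linarith
  have hp : ∀ x ∈ Icc a b, 2 / 3 < p x := by
    intro x hx
    have h1 := hgr x hx
    rw [abs_of_neg (show s - 1 < 0 by linarith)] at h1
    have h2 := abs_nonneg (v x)
    have h3 := neg_abs_le (p x - 1)
    have h4 : 2 * -(s - 1) * Real.exp (2 * ∫ t in a..b, (1 + 2 * lam * W t)) = (1 - s) * C := by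
      rw [hC]; ring
    rw [h4] at h1
    nlinarith
  refine ⟨?_, fun x hx => by linarith [hp x hx]⟩
  by_cases hle : ∀ x ∈ Icc a b, p x ≤ 1
  swap
  · push Not at hle
    obtain ⟨x, hx, hx1⟩ := hle
    exact h.exit_one hs1 hx hx1
  by_cases hlt : ∀ x ∈ Icc a b, p x < 1
  · exact h.large_core hlam hab hβ hβn hwβ fun x hx => ⟨hp x hx, hlt x hx⟩
  push Not at hlt
  obtain ⟨x0, hx0, hx01⟩ := hlt
  have he : p x0 = 1 := le_antisymm (hle x0 hx0) hx01
  have hv0 : v x0 ≠ 0 := fun hv => hs1.ne (h.back hlam hW hwW hθ hx0 he hv)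
  have hax : a < x0 := lt_of_le_of_ne hx0.1 (by rintro rfl; linarith [h.pa])
  rcases hx0.2.eq_or_lt with rfl | hxb
  · rcases lt_or_gt_of_ne hv0 with hn | hn
    swap
    · exact hn
    exfalso
    have hev := (hasDerivAt_iff_tendsto_slope.1 (h.hp x0)).eventually (Iio_mem_nhds hn)
    have hev2 := hev.filter_mono (nhdsWithin_mono x0 (show Iio x0 ⊆ {x0}ᶜ from fun y hy => ne_of_lt hy))
    obtain ⟨y, hy, hy2⟩ := (hev2.and (Ioo_mem_nhdsLT hax)).exists
    have hy' : slope p x0 y < 0 := hy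
    rw [slope_def_field, he] at hy'
    have := hle y ⟨hy2.1.le, hy2.2.le⟩
    have : 0 ≤ (p y - 1) / (y - x0) := div_nonneg_of_nonpos (by linarith) (by linarith [hy2.2])
    linarith
  · exfalso
    have hmax : IsLocalMax p x0 := by
      filter_upwards [Icc_mem_nhds hax hxb] with y hy
      rw [he]; exact hle y hy
    exact hv0 (hmax.hasDerivAt_eq_zero (h.hp x0))

lemma tlc_locus {a b : ℝ} (hab : a < b) {α β W : ℝ → ℝ}
    (hα : IntervalIntegrable α volume a b) (hβ : IntervalIntegrable β volume a b)
    (hW : IntervalIntegrable W volume a b)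
    (hI : ∃ c d : ℝ, c < d ∧ Icc c d ⊆ Ioo a b ∧ ∀ x ∈ Icc c d, 0 < α x)
    (hβn : ∫ t in a..b, β t < 0) :
    ∃ m ∈ Icc a b, ∃ L : ℝ, 0 < L ∧ ∀ lam, L < lam → ∃ ε : ℝ, 0 < ε ∧ ∀ s w p v,
      TlcScal a b lam s w p v → (∀ t ∈ Ioo a b, |w t| ≤ W t) → (∀ t ∈ Ioo a b, α t ≤ w t) →
      (∀ t ∈ Ioo a b, w t ≤ β t) → 0 < s → s < 1 →
      (s ≤ ε → 0 < v b ∧ p m < 1 / 2) ∧ (1 - ε ≤ s → 0 < v b ∧ 1 / 2 < p m) ∧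
      (p m = 1 / 2 → v b < 0) := by
  obtain ⟨c, d, hcd, hsub, hpos⟩ := hI
  obtain ⟨δ, hδ⟩ : ∃ δ, δ = (d - c) / 4 := ⟨_, rfl⟩
  obtain ⟨m, hm⟩ : ∃ m, m = (c + d) / 2 := ⟨_, rfl⟩
  obtain ⟨i1, hi1⟩ : ∃ i1, i1 = ∫ t in (m - δ)..m, α t := ⟨_, rfl⟩
  obtain ⟨i2, hi2⟩ : ∃ i2, i2 = ∫ t in m..(m + δ), α t := ⟨_, rfl⟩
  have hδ0 : 0 < δ := by rw [hδ]; linarith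
  have mm : m ∈ Icc c d := by constructor <;> rw [hm] <;> linarith
  have mp : m + δ ∈ Icc c d := by constructor <;> rw [hm, hδ] <;> linarith
  have mn : m - δ ∈ Icc c d := by constructor <;> rw [hm, hδ] <;> linarith
  have hIcc : ∀ x ∈ Icc c d, x ∈ Icc a b := fun x hx => Ioo_subset_Icc_self (hsub hx)
  have hi1p : 0 < i1 := by
    rw [hi1]
    apply intervalIntegral.intervalIntegral_pos_of_pos_on (hα.mono_set (tlc_sub (hIcc _ mn) (hIcc _ mm)))
    · intro x hx; exact hpos x ⟨mn.1.trans hx.1.le, hx.2.le.trans mm.2⟩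
    · linarith
  have hi2p : 0 < i2 := by
    rw [hi2]
    apply intervalIntegral.intervalIntegral_pos_of_pos_on (hα.mono_set (tlc_sub (hIcc _ mm) (hIcc _ mp)))
    · intro x hx; exact hpos x ⟨mm.1.trans hx.1.le, hx.2.le.trans mp.2⟩
    · linarith
  refine ⟨m, hIcc m mm, max (8 / (δ * i1)) (8 / (δ * i2)), lt_max_of_lt_left (by positivity), ?_⟩
  intro lam hlam
  have hl1 := (le_max_left _ _).trans_lt hlam
  have hl2 := (le_max_right _ _).trans_lt hlam
  have hl0 : 0 < lam := lt_trans (by positivity) hl1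
  rw [div_lt_iff₀ (by positivity)] at hl1 hl2
  obtain ⟨e1, he1, h1⟩ := tlc_small hab hl0 hW hβ hβn
  obtain ⟨e2, he2, h2⟩ := tlc_large hab hl0 hW hβ hβn
  refine ⟨min e1 e2, lt_min he1 he2, ?_⟩
  intro s w p v h hwW hwα hwβ hs0 hs1
  refine ⟨fun hs => ?_, fun hs => ?_, fun hpm => ?_⟩
  · have := h1 s w p v h hwW hwβ hs0 (hs.trans (min_le_left _ _))
    exact ⟨this.1, this.2 m (hIcc m mm)⟩
  · have := h2 s w p v h hwW hwβ hs1 (by linarith [min_le_right e1 e2])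
    exact ⟨this.1, this.2 m (hIcc m mm)⟩
  · exact tlc_mid hcd hsub hl0 hα hpos hδ hm hi1 hi2 hl1 hl2 s w p v h hwα hs0 hpm

lemma tlc_gs {X : Type*} [TopologicalSpace X] {P M : X → ℝ} (hP : Continuous P) (hM : Continuous M)
    (h : ∀ x, M x = 1 / 2 → P x < 0) : ∃ g : X → ℝ, Continuous g ∧
      (∀ x, 0 < P x → M x < 1 / 2 → 0 < g x) ∧ (∀ x, 1 / 2 < M x → g x < 0) ∧
      ∀ x, g x = 0 → P x = 0 ∧ M x < 1 / 2 := by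
  refine ⟨fun x => if M x ≤ 1 / 2 then P x else -|P x| - (M x - 1 / 2), ?_, ?_, ?_, ?_⟩
  · refine Continuous.if_le hP (by fun_prop) hM continuous_const ?_
    intro x hx
    rw [abs_of_neg (h x hx), hx]; ring
  · intro x h1 h2
    simp only [h2.le, if_true]; exact h1
  · intro x h1
    simp only [not_le.2 h1, if_false]
    linarith [abs_nonneg (P x)]
  · intro x hx
    by_cases hc : M x ≤ 1 / 2
    · simp only [hc, if_true] at hx
      refine ⟨hx, lt_of_le_of_ne hc fun he => ?_⟩
      linarith [h x he]
    · simp only [hc, if_false] at hx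
      linarith [abs_nonneg (P x)]

lemma tlc_gg {X : Type*} [TopologicalSpace X] {P M : X → ℝ} (hP : Continuous P) (hM : Continuous M)
    (h : ∀ x, M x = 1 / 2 → P x < 0) (e : Bool) : ∃ g : X → ℝ, Continuous g ∧
      (∀ x, 0 < P x → M x < 1 / 2 → 0 < g x) ∧ (∀ x, 0 < P x → 1 / 2 < M x → g x < 0) ∧
      ∀ x, g x = 0 → P x = 0 ∧ (if e then M x < 1 / 2 else 1 / 2 < M x) := by
  cases e
  · obtain ⟨g, h0, h1, h2, h3⟩ := tlc_gs (P := P) (M := fun x => 1 - M x) hP (by fun_prop)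
      (fun x hx => h x (by linarith))
    refine ⟨fun x => -g x, h0.neg, fun x _ hx => ?_, fun x hP hx => ?_, fun x hx => ?_⟩
    · linarith [h2 x (by linarith)]
    · linarith [h1 x hP (by linarith)]
    · have := h3 x (by linarith)
      refine ⟨this.1, ?_⟩
      simp only [Bool.false_eq_true, if_false]; linarith
  · obtain ⟨g, h0, h1, h2, h3⟩ := tlc_gs hP hM h
    exact ⟨g, h0, h1, fun x _ => h2 x, fun x hx => by simpa using h3 x hx⟩

noncomputable def tlcW (A B : ℝ → ℝ) (q : ℝ → ℝ) (t : ℝ) : ℝ :=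
  tlcC (q t) ^ 2 * A t + (1 - tlcC (q t) ^ 2) * B t

lemma tlc_lip_comp (lam A B p q p' q' : ℝ) (hlam : 0 < lam) (n : ℝ) (hp : |p - p'| ≤ n)
    (hq : |q - q'| ≤ n) :
    |-(lam * (tlcC q ^ 2 * A + (1 - tlcC q ^ 2) * B) * tlcF p) -
      -(lam * (tlcC q' ^ 2 * A + (1 - tlcC q' ^ 2) * B) * tlcF p')| ≤
      16 * lam * (|A| + |B|) * n := by
  have e : -(lam * (tlcC q ^ 2 * A + (1 - tlcC q ^ 2) * B) * tlcF p) -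
      -(lam * (tlcC q' ^ 2 * A + (1 - tlcC q' ^ 2) * B) * tlcF p') =
      -(lam * ((tlcC q ^ 2 * A + (1 - tlcC q ^ 2) * B) * (tlcF p - tlcF p') +
        (tlcC q - tlcC q') * (tlcC q + tlcC q') * (A - B) * tlcF p')) := by ring
  have hq1 := tlcC_mem q
  have hq2 := tlcC_mem q'
  have hn : 0 ≤ n := (abs_nonneg _).trans hp
  have hc : tlcC q ^ 2 ≤ 1 := by nlinarith
  have h1 : |tlcC q ^ 2 * A + (1 - tlcC q ^ 2) * B| ≤ |A| + |B| := by
    refine (abs_add_le _ _).trans ?_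
    rw [abs_mul, abs_mul, abs_of_nonneg (sq_nonneg _), abs_of_nonneg (show 0 ≤ 1 - tlcC q ^ 2 by linarith)]
    nlinarith [abs_nonneg A, abs_nonneg B, sq_nonneg (tlcC q)]
  have h2 : |tlcF p - tlcF p'| ≤ 12 * n := (tlcF_lip p p').trans (by linarith)
  have h3 : |tlcC q - tlcC q'| ≤ n := (tlcC_lip q q').trans hq
  have h4 : |tlcC q + tlcC q'| ≤ 2 := by rw [abs_le]; constructor <;> linarith
  have h5 : |A - B| ≤ |A| + |B| := abs_sub A B
  have h6 : |tlcF p'| ≤ 2 := by rw [abs_of_nonneg (tlcF_nonneg _)]; exact tlcF_le_two p'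
  rw [e, abs_neg, abs_mul, abs_of_pos hlam]
  have h7 : |(tlcC q ^ 2 * A + (1 - tlcC q ^ 2) * B) * (tlcF p - tlcF p')| ≤ (|A| + |B|) * (12 * n) := by
    rw [abs_mul]; gcongr
  have h8 : |(tlcC q - tlcC q') * (tlcC q + tlcC q') * (A - B) * tlcF p'| ≤ n * 2 * (|A| + |B|) * 2 := by
    rw [abs_mul, abs_mul, abs_mul]; gcongr
  have h9 := (abs_add_le _ _).trans (add_le_add h7 h8)
  calc _ ≤ lam * ((|A| + |B|) * (12 * n) + n * 2 * (|A| + |B|) * 2) := by gcongr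
    _ = _ := by ring

lemma tlcW_int {a b : ℝ} {A B q : ℝ → ℝ} (hA : IntervalIntegrable A volume a b)
    (hB : IntervalIntegrable B volume a b) (hq : Continuous q) :
    IntervalIntegrable (tlcW A B q) volume a b := by
  have hc : Continuous fun t => tlcC (q t) := tlcC_cont.comp hq
  exact (hA.continuousOn_mul (hc.pow 2).continuousOn).add
    (hB.continuousOn_mul (continuous_const.sub (hc.pow 2)).continuousOn)

lemma tlc_system {a b lam : ℝ} (hab : a < b) (hlam : 0 < lam) {A B C D : ℝ → ℝ}
    (hA : IntervalIntegrable A volume a b) (hB : IntervalIntegrable B volume a b)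
    (hC : IntervalIntegrable C volume a b) (hD : IntervalIntegrable D volume a b) :
    ∃ p v q z : ℝ × ℝ → ℝ → ℝ,
      (∀ y, TlcScal a b lam y.1 (tlcW A B (q y)) (p y) (v y)) ∧
      (∀ y, TlcScal a b lam y.2 (tlcW C D (p y)) (q y) (z y)) ∧
      ∀ x ∈ Icc a b, Continuous (fun y => p y x) ∧ Continuous (fun y => v y x) ∧
        Continuous (fun y => q y x) ∧ Continuous (fun y => z y x) := by
  let F : ℝ → ℝ × ℝ × ℝ × ℝ → ℝ × ℝ × ℝ × ℝ := fun t y =>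
    (y.2.1, -(lam * (tlcC y.2.2.1 ^ 2 * A t + (1 - tlcC y.2.2.1 ^ 2) * B t) * tlcF y.1),
      y.2.2.2, -(lam * (tlcC y.1 ^ 2 * C t + (1 - tlcC y.1 ^ 2) * D t) * tlcF y.2.2.1))
  let L : ℝ → ℝ := fun t => 1 + 16 * lam * (|A t| + |B t| + (|C t| + |D t|))
  have hL : IntervalIntegrable L volume a b :=
    (intervalIntegrable_const (c := (1:ℝ))).add
      (((hA.abs.add hB.abs).add (hC.abs.add hD.abs)).const_mul (16 * lam))
  have hL0 : ∀ t ∈ Ioo a b, 0 ≤ L t := fun t _ => by simp only [L]; positivity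
  have hLip : ∀ t ∈ Ioo a b, ∀ y z, ‖F t y - F t z‖ ≤ L t * ‖y - z‖ := by
    intro t _ y z
    have n1 : |y.1 - z.1| ≤ ‖y - z‖ := norm_fst_le (y - z)
    have n2' : ‖(y - z).2‖ ≤ ‖y - z‖ := norm_snd_le (y - z)
    have n2 : |y.2.1 - z.2.1| ≤ ‖y - z‖ := (norm_fst_le (y - z).2).trans n2'
    have n3' : ‖(y - z).2.2‖ ≤ ‖y - z‖ := (norm_snd_le (y - z).2).trans n2'
    have n3 : |y.2.2.1 - z.2.2.1| ≤ ‖y - z‖ := (norm_fst_le (y - z).2.2).trans n3'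
    have n4 : |y.2.2.2 - z.2.2.2| ≤ ‖y - z‖ := (norm_snd_le (y - z).2.2).trans n3'
    have hn := norm_nonneg (y - z)
    have k1 := tlc_lip_comp lam (A t) (B t) y.1 y.2.2.1 z.1 z.2.2.1 hlam _ n1 n3
    have k2 := tlc_lip_comp lam (C t) (D t) y.2.2.1 y.1 z.2.2.1 z.1 hlam _ n3 n1
    have q1 : 0 ≤ 16 * lam * (|A t| + |B t|) * ‖y - z‖ := by positivity
    have q2 : 0 ≤ 16 * lam * (|C t| + |D t|) * ‖y - z‖ := by positivity
    have eL : L t * ‖y - z‖ = ‖y - z‖ + 16 * lam * (|A t| + |B t|) * ‖y - z‖ +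
      16 * lam * (|C t| + |D t|) * ‖y - z‖ := by simp only [L]; ring
    rw [eL]
    refine norm_prod_le_iff.2 ⟨?_, norm_prod_le_iff.2 ⟨?_, norm_prod_le_iff.2 ⟨?_, ?_⟩⟩⟩
    · exact n2.trans (by linarith)
    · exact k1.trans (by linarith)
    · exact n4.trans (by linarith)
    · exact k2.trans (by linarith)
  have hint : ∀ y, Continuous y → IntervalIntegrable (fun t => F t (y t)) volume a b := by
    intro y hy
    have i1 : IntervalIntegrable (fun t => (y t).2.1) volume a b :=
      (show Continuous fun t => (y t).2.1 by fun_prop).intervalIntegrable _ _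
    have i3 : IntervalIntegrable (fun t => (y t).2.2.2) volume a b :=
      (show Continuous fun t => (y t).2.2.2 by fun_prop).intervalIntegrable _ _
    have c1 : Continuous fun t => tlcF (y t).1 := tlcF_cont.comp (by fun_prop)
    have c2 : Continuous fun t => tlcF (y t).2.2.1 := tlcF_cont.comp (by fun_prop)
    have i2 : IntervalIntegrable (fun t => -(lam * tlcW A B (fun t => (y t).2.2.1) t * tlcF (y t).1)) volume a b :=
      (((tlcW_int hA hB (by fun_prop)).const_mul lam).mul_continuousOn c1.continuousOn).neg
    have i4 : IntervalIntegrable (fun t => -(lam * tlcW C D (fun t => (y t).1) t * tlcF (y t).2.2.1)) volume a b :=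
      (((tlcW_int hC hD (by fun_prop)).const_mul lam).mul_continuousOn c2.continuousOn).neg
    rw [intervalIntegrable_iff] at *
    exact Integrable.prodMk i1 (Integrable.prodMk i2 (Integrable.prodMk i3 i4))
  obtain ⟨Y, Yc, Ye, Yd⟩ := tlc_ivp hab.le hL hL0 hLip hint
  let y0 : ℝ × ℝ → ℝ × ℝ × ℝ × ℝ := fun y => (y.1, 0, y.2, 0)
  have cy0 : Continuous y0 := by fun_prop
  have ha : a ∈ Icc a b := ⟨le_rfl, hab.le⟩
  have hcomp : ∀ (ℓ : (ℝ × ℝ × ℝ × ℝ) →L[ℝ] ℝ) (y : ℝ × ℝ) (x : ℝ), x ∈ Icc a b →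
      ℓ (Y (y0 y) x) = ℓ (y0 y) + ∫ t in a..x, ℓ (F t (Y (y0 y) t)) := by
    intro ℓ y x hx
    have hi : IntervalIntegrable (fun t => F t (Y (y0 y) t)) volume a x :=
      (hint _ (Yc (y0 y))).mono_set (tlc_sub ha hx)
    conv_lhs => rw [Ye (y0 y) x hx, map_add, ← ContinuousLinearMap.intervalIntegral_comp_comm ℓ hi]
  let f1 := ContinuousLinearMap.fst ℝ ℝ (ℝ × ℝ × ℝ)
  let s1 := ContinuousLinearMap.snd ℝ ℝ (ℝ × ℝ × ℝ)
  let f2 := ContinuousLinearMap.fst ℝ ℝ (ℝ × ℝ)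
  let s2 := ContinuousLinearMap.snd ℝ ℝ (ℝ × ℝ)
  let f3 := ContinuousLinearMap.fst ℝ ℝ ℝ
  let s3 := ContinuousLinearMap.snd ℝ ℝ ℝ
  have c1 := hcomp f1
  have c2 := hcomp (f2.comp s1)
  have c3 := hcomp (f3.comp (s2.comp s1))
  have c4 := hcomp (s3.comp (s2.comp s1))
  have hvc : ∀ y, Continuous (fun x => (Y (y0 y) x).2.1) := fun y => by
    have := Yc (y0 y); fun_prop
  have hzc : ∀ y, Continuous (fun x => (Y (y0 y) x).2.2.2) := fun y => by
    have := Yc (y0 y); fun_prop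
  let p : ℝ × ℝ → ℝ → ℝ := fun y x => y.1 + ∫ t in a..x, (Y (y0 y) t).2.1
  let q : ℝ × ℝ → ℝ → ℝ := fun y x => y.2 + ∫ t in a..x, (Y (y0 y) t).2.2.2
  have hpe : ∀ y, ∀ x ∈ Icc a b, p y x = (Y (y0 y) x).1 := fun y x hx => (c1 y x hx).symm
  have hqe : ∀ y, ∀ x ∈ Icc a b, q y x = (Y (y0 y) x).2.2.1 := fun y x hx => (c3 y x hx).symm
  have hpd : ∀ y x, HasDerivAt (p y) ((Y (y0 y) x).2.1) x := fun y x =>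
    (((hvc y).integral_hasStrictDerivAt a x).hasDerivAt).const_add _
  have hqd : ∀ y x, HasDerivAt (q y) ((Y (y0 y) x).2.2.2) x := fun y x =>
    (((hzc y).integral_hasStrictDerivAt a x).hasDerivAt).const_add _
  have hpc : ∀ y, Continuous (p y) := fun y => continuous_iff_continuousAt.2 fun x => (hpd y x).continuousAt
  have hqc : ∀ y, Continuous (q y) := fun y => continuous_iff_continuousAt.2 fun x => (hqd y x).continuousAt
  refine ⟨p, fun y x => (Y (y0 y) x).2.1, q, fun y x => (Y (y0 y) x).2.2.2, ?_, ?_, ?_⟩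
  · intro y
    refine ⟨tlcW_int hA hB (hqc y), hvc y, hpd y, by simp [p], ?_⟩
    intro x hx
    have e : (Y (y0 y) x).2.1 = 0 + ∫ t in a..x, (F t (Y (y0 y) t)).2.1 := c2 y x hx
    refine e.trans ?_
    rw [zero_add]
    apply intervalIntegral.integral_congr
    intro t ht
    rw [uIcc_of_le hx.1] at ht
    have ht' : t ∈ Icc a b := ⟨ht.1, ht.2.trans hx.2⟩
    simp only [tlcW, hpe y t ht', hqe y t ht', F]
  · intro y
    refine ⟨tlcW_int hC hD (hpc y), hzc y, hqd y, by simp [q], ?_⟩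
    intro x hx
    have e : (Y (y0 y) x).2.2.2 = 0 + ∫ t in a..x, (F t (Y (y0 y) t)).2.2.2 := c4 y x hx
    refine e.trans ?_
    rw [zero_add]
    apply intervalIntegral.integral_congr
    intro t ht
    rw [uIcc_of_le hx.1] at ht
    have ht' : t ∈ Icc a b := ⟨ht.1, ht.2.trans hx.2⟩
    simp only [tlcW, hpe y t ht', hqe y t ht', F]
  · intro x hx
    have hY : Continuous fun y => Y (y0 y) x := (Yd x hx).comp cy0
    refine ⟨?_, by fun_prop, ?_, by fun_prop⟩
    · simp only [hpe _ x hx]; fun_prop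
    · simp only [hqe _ x hx]; fun_prop

lemma tlcW_bd {k A B q : ℝ} (hk : 0 < k) :
    min A B / k ≤ tlcC q ^ 2 * (A / k) + (1 - tlcC q ^ 2) * (B / k) ∧
    tlcC q ^ 2 * (A / k) + (1 - tlcC q ^ 2) * (B / k) ≤ max A B / k ∧
    |tlcC q ^ 2 * (A / k) + (1 - tlcC q ^ 2) * (B / k)| ≤ |A / k| + |B / k| := by
  have hq := tlcC_mem q
  have h0 := sq_nonneg (tlcC q)
  have h1 : tlcC q ^ 2 ≤ 1 := by nlinarith
  have e : tlcC q ^ 2 * (A / k) + (1 - tlcC q ^ 2) * (B / k) =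
      (tlcC q ^ 2 * A + (1 - tlcC q ^ 2) * B) / k := by ring
  refine ⟨?_, ?_, ?_⟩
  · rw [e]
    apply div_le_div_of_nonneg_right _ hk.le
    nlinarith [min_le_left A B, min_le_right A B]
  · rw [e]
    apply div_le_div_of_nonneg_right _ hk.le
    nlinarith [le_max_left A B, le_max_right A B]
  · refine (abs_add_le _ _).trans ?_
    rw [abs_mul, abs_mul, abs_of_nonneg h0, abs_of_nonneg (show 0 ≤ 1 - tlcC q ^ 2 by linarith)]
    nlinarith [abs_nonneg (A / k), abs_nonneg (B / k)]

lemma tlc_neumann {a b lam s : ℝ} (hab : a < b) {A B k p v q : ℝ → ℝ}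
    (h : TlcScal a b lam s (tlcW (fun x => A x / k x) (fun x => B x / k x) q) p v)
    (hs : 0 < s) (hs1 : s < 1) (hb : v b = 0) (hq : ∀ x ∈ Icc a b, q x ∈ Icc (0:ℝ) 1) :
    NeumannComp a b (fun x => lam * (((q x) ^ 2 * A x + (1 - (q x) ^ 2) * B x) / k x) *
      (2 * (p x) ^ 2 * (1 - p x))) p := by
  have hp := h.mem_of_zero hs hs1 hb
  have ha : a ∈ Icc a b := ⟨le_rfl, hab.le⟩
  have va : v a = 0 := by rw [h.hv a ha]; simp
  refine ⟨hp, v, _, fun x _ => (h.hp x).hasDerivWithinAt, h.cv.continuousOn,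
    (intervalIntegrable_iff_integrableOn_Ioo_of_le hab.le).1 h.gint, ?_, ?_, va, hb⟩
  · intro x hx
    rw [va, zero_add]; exact h.hv x hx
  · rw [ae_restrict_iff' measurableSet_Ioo]
    refine Filter.Eventually.of_forall fun x hx => ?_
    have hx' := Ioo_subset_Icc_self hx
    simp only [tlcW]
    rw [tlcC_of_mem (hq x hx').1 (hq x hx').2, tlcF_of_mem (hp x hx').1 (hp x hx').2]
    ring

lemma tlc_div_int {a b κ0 : ℝ} {κ r : ℝ → ℝ} (hab : a < b) (hκ0 : 0 < κ0)
    (hκ : ∀ x ∈ Ioo a b, κ0 ≤ κ x) (hκint : IntegrableOn κ (Ioo a b))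
    (hr : IntegrableOn r (Ioo a b)) : IntervalIntegrable (fun x => r x / κ x) volume a b := by
  rw [intervalIntegrable_iff_integrableOn_Ioo_of_le hab.le]
  have hm : AEStronglyMeasurable (fun x => (κ x)⁻¹) (volume.restrict (Ioo a b)) :=
    (hκint.aestronglyMeasurable.aemeasurable.inv).aestronglyMeasurable
  have : IntegrableOn (fun x => r x * (κ x)⁻¹) (Ioo a b) := by
    refine Integrable.mul_bdd (c := κ0⁻¹) hr hm ?_
    rw [ae_restrict_iff' measurableSet_Ioo]
    refine Filter.Eventually.of_forall fun x hx => ?_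
    have := hκ x hx
    rw [Real.norm_eq_abs, abs_of_pos (inv_pos.2 (by linarith))]
    exact inv_anti₀ hκ0 this
  exact this

lemma tlc_bool {u u' : Bool} (h : u ≠ u') {r : ℝ} (h1 : if u then r < 1 / 2 else 1 / 2 < r)
    (h2 : if u' then r < 1 / 2 else 1 / 2 < r) : False := by
  cases u <;> cases u' <;> simp at h h1 h2 <;> linarith

/-- The two-locus population genetics model: with `f(s) = 2s²(1-s)`,
fitnesses `r_ab, r_Ab, r_aB, r_AB ∈ L¹(Ω)`, dispersal `κ ≥ κ₀ > 0`, under conditions (i)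
and (ii) there is `λ* > 0` such that for every `λ > λ*` the Neumann system admits at least
four pairwise distinct fully nontrivial solutions. -/
theorem two_locus_clines
    (a b : ℝ) (hab : a < b)
    (κ rab rAb raB rAB : ℝ → ℝ) (κ0 : ℝ) (hκ0 : 0 < κ0)
    (hκ : ∀ x ∈ Set.Ioo a b, κ0 ≤ κ x)
    (hκint : IntegrableOn κ (Set.Ioo a b))
    (hr1 : IntegrableOn rab (Set.Ioo a b)) (hr2 : IntegrableOn rAb (Set.Ioo a b))
    (hr3 : IntegrableOn raB (Set.Ioo a b)) (hr4 : IntegrableOn rAB (Set.Ioo a b))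
    -- (i): intervals `I_p, I_q ⊆ Ω` on which `α_a`, resp. `α_b`, is positive
    (hIp : ∃ c d : ℝ, c < d ∧ Set.Icc c d ⊆ Set.Ioo a b ∧
      ∀ x ∈ Set.Icc c d, 0 < min (rab x - rAb x) (raB x - rAB x) / κ x)
    (hIq : ∃ c d : ℝ, c < d ∧ Set.Icc c d ⊆ Set.Ioo a b ∧
      ∀ x ∈ Set.Icc c d, 0 < min (rab x - raB x) (rAb x - rAB x) / κ x)
    -- (ii): `∫_Ω β_a < 0` and `∫_Ω β_b < 0`
    (hβa : (∫ x in Set.Ioo a b, max (rab x - rAb x) (raB x - rAB x) / κ x) < 0)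
    (hβb : (∫ x in Set.Ioo a b, max (rab x - raB x) (rAb x - rAB x) / κ x) < 0) :
    ∃ lamStar : ℝ, 0 < lamStar ∧ ∀ lam : ℝ, lamStar < lam →
      ∃ sols : Fin 4 → (ℝ → ℝ) × (ℝ → ℝ),
        (∀ m m' : Fin 4, m ≠ m' → ∃ x ∈ Set.Icc a b,
          (sols m).1 x ≠ (sols m').1 x ∨ (sols m).2 x ≠ (sols m').2 x) ∧
        ∀ m : Fin 4,
          NeumannComp a b (fun x => lam *
            ((((sols m).2 x) ^ 2 * (rab x - rAb x) +
              (1 - ((sols m).2 x) ^ 2) * (raB x - rAB x)) / κ x) *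
            (2 * ((sols m).1 x) ^ 2 * (1 - (sols m).1 x))) (sols m).1 ∧
          NeumannComp a b (fun x => lam *
            ((((sols m).1 x) ^ 2 * (rab x - raB x) +
              (1 - ((sols m).1 x) ^ 2) * (rAb x - rAB x)) / κ x) *
            (2 * ((sols m).2 x) ^ 2 * (1 - (sols m).2 x))) (sols m).2 ∧
          (∃ x ∈ Set.Icc a b, (sols m).1 x ≠ 0) ∧
          (∃ x ∈ Set.Icc a b, (sols m).1 x ≠ 1) ∧
          (∃ x ∈ Set.Icc a b, (sols m).2 x ≠ 0) ∧
          (∃ x ∈ Set.Icc a b, (sols m).2 x ≠ 1) := by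
  have i1 := tlc_div_int hab hκ0 hκ hκint (hr1.sub hr2)
  have i2 := tlc_div_int hab hκ0 hκ hκint (hr3.sub hr4)
  have i3 := tlc_div_int hab hκ0 hκ hκint (hr1.sub hr3)
  have i4 := tlc_div_int hab hκ0 hκ hκint (hr2.sub hr4)
  have n1 := tlc_div_int hab hκ0 hκ hκint ((hr1.sub hr2).inf (hr3.sub hr4))
  have n2 := tlc_div_int hab hκ0 hκ hκint ((hr1.sub hr3).inf (hr2.sub hr4))
  have x1 := tlc_div_int hab hκ0 hκ hκint ((hr1.sub hr2).sup (hr3.sub hr4))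
  have x2 := tlc_div_int hab hκ0 hκ hκint ((hr1.sub hr3).sup (hr2.sub hr4))
  rw [← integral_Ioc_eq_integral_Ioo, ← intervalIntegral.integral_of_le hab.le] at hβa hβb
  obtain ⟨mp, hmp, L1, hL1, H1⟩ := tlc_locus hab n1 x1 (i1.abs.add i2.abs) hIp hβa
  obtain ⟨mq, hmq, L2, hL2, H2⟩ := tlc_locus hab n2 x2 (i3.abs.add i4.abs) hIq hβb
  refine ⟨max L1 L2, lt_max_of_lt_left hL1, ?_⟩
  intro lam hlam
  have hlam1 := (le_max_left _ _).trans_lt hlam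
  have hlam2 := (le_max_right _ _).trans_lt hlam
  have hlam0 : 0 < lam := hL1.trans hlam1
  obtain ⟨e1, he1, K1⟩ := H1 lam hlam1
  obtain ⟨e2, he2, K2⟩ := H2 lam hlam2
  obtain ⟨p, v, q, z, hS1, hS2, hc⟩ := tlc_system hab hlam0 i1 i2 i3 i4
  have B1 := fun y => K1 _ _ _ _ (hS1 y) (fun t ht => (tlcW_bd (hκ0.trans_le (hκ t ht))).2.2)
    (fun t ht => (tlcW_bd (hκ0.trans_le (hκ t ht))).1)
    (fun t ht => (tlcW_bd (hκ0.trans_le (hκ t ht))).2.1)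
  have B2 := fun y => K2 _ _ _ _ (hS2 y) (fun t ht => (tlcW_bd (hκ0.trans_le (hκ t ht))).2.2)
    (fun t ht => (tlcW_bd (hκ0.trans_le (hκ t ht))).1)
    (fun t ht => (tlcW_bd (hκ0.trans_le (hκ t ht))).2.1)
  clear K1 K2 H1 H2
  obtain ⟨ε, hε0, hεh, hε1, hε2⟩ : ∃ ε : ℝ, 0 < ε ∧ ε < 1 / 2 ∧ ε ≤ e1 ∧ ε ≤ e2 :=
    ⟨min (1 / 4) (min e1 e2), by positivity, (min_le_left _ _).trans_lt (by norm_num),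
      (min_le_right _ _).trans (min_le_left _ _), (min_le_right _ _).trans (min_le_right _ _)⟩
  let cl : ℝ → ℝ := fun s => max ε (min (1 - ε) s)
  have clc : Continuous cl := by fun_prop
  have clm : ∀ s, ε ≤ cl s ∧ cl s ≤ 1 - ε := fun s =>
    ⟨le_max_left _ _, max_le (by linarith) (min_le_left _ _)⟩
  have cle : ∀ s ∈ Icc ε (1 - ε), cl s = s := fun s hs => by
    simp only [cl]; rw [min_eq_right hs.2, max_eq_right hs.1]
  let c2 : ℝ × ℝ → ℝ × ℝ := fun y => (cl y.1, cl y.2)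
  have c2c : Continuous c2 := by fun_prop
  have hb : b ∈ Icc a b := ⟨hab.le, le_rfl⟩
  have ha : a ∈ Icc a b := ⟨le_rfl, hab.le⟩
  have D1 := fun y => B1 (c2 y) (hε0.trans_le (clm y.1).1) (by linarith [(clm y.1).2])
  have D2 := fun y => B2 (c2 y) (hε0.trans_le (clm y.2).1) (by linarith [(clm y.2).2])
  have main : ∀ u1 u2 : Bool, ∃ y : ℝ × ℝ, (0 < y.1 ∧ y.1 < 1) ∧ (0 < y.2 ∧ y.2 < 1) ∧
      (v y b = 0 ∧ if u1 then p y mp < 1 / 2 else 1 / 2 < p y mp) ∧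
      (z y b = 0 ∧ if u2 then q y mq < 1 / 2 else 1 / 2 < q y mq) := by
    intro u1 u2
    obtain ⟨g1, g1c, g1p, g1n, g1z⟩ := tlc_gg (P := fun y => v (c2 y) b) (M := fun y => p (c2 y) mp)
      ((hc b hb).2.1.comp c2c) ((hc mp hmp).1.comp c2c) (fun y => (D1 y).2.2) u1
    obtain ⟨g2, g2c, g2p, g2n, g2z⟩ := tlc_gg (P := fun y => z (c2 y) b) (M := fun y => q (c2 y) mq)
      ((hc b hb).2.2.2.comp c2c) ((hc mq hmq).2.2.1.comp c2c) (fun y => (D2 y).2.2) u2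
    have hle : ε ≤ 1 - ε := by linarith
    have cl1 : cl ε = ε := cle ε ⟨le_rfl, hle⟩
    have cl2 : cl (1 - ε) = 1 - ε := cle _ ⟨hle, le_rfl⟩
    obtain ⟨s, hs, t, ht, z1, z2⟩ := tlc_pm g1c g2c hle
      (fun t _ => by
        have := (D1 (ε, t)).1 (by simp only [c2, cl1]; exact hε1)
        exact g1p _ this.1 this.2)
      (fun t _ => by
        have := (D1 (1 - ε, t)).2.1 (by simp only [c2, cl2]; linarith)
        exact g1n _ this.1 this.2)
      (fun s _ => by
        have := (D2 (s, ε)).1 (by simp only [c2, cl1]; exact hε2)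
        exact g2p _ this.1 this.2)
      (fun s _ => by
        have := (D2 (s, 1 - ε)).2.1 (by simp only [c2, cl2]; linarith)
        exact g2n _ this.1 this.2)
    refine ⟨c2 (s, t), ⟨?_, ?_⟩, ⟨?_, ?_⟩, g1z _ z1, g2z _ z2⟩
    · exact hε0.trans_le (clm s).1
    · exact lt_of_le_of_lt (clm s).2 (by linarith)
    · exact hε0.trans_le (clm t).1
    · exact lt_of_le_of_lt (clm t).2 (by linarith)
  choose Y hY1 hY2 hY3 hY4 using main
  let e : Fin 4 ≃ Bool × Bool := (Fintype.equivFinOfCardEq (by decide)).symm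
  refine ⟨fun m => (p (Y (e m).1 (e m).2), q (Y (e m).1 (e m).2)), ?_, ?_⟩
  · intro m m' hne
    have hne' : e m ≠ e m' := fun h => hne (e.injective h)
    by_cases h1 : (e m).1 = (e m').1
    · have h2 : (e m).2 ≠ (e m').2 := fun h => hne' (Prod.ext h1 h)
      refine ⟨mq, hmq, Or.inr fun heq => ?_⟩
      have k1 := (hY4 (e m).1 (e m).2).2
      have k2 := (hY4 (e m').1 (e m').2).2
      simp only at heq
      rw [heq] at k1
      exact tlc_bool h2 k1 k2
    · refine ⟨mp, hmp, Or.inl fun heq => ?_⟩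
      have k1 := (hY3 (e m).1 (e m).2).2
      have k2 := (hY3 (e m').1 (e m').2).2
      simp only at heq
      rw [heq] at k1
      exact tlc_bool h1 k1 k2
  · intro m
    have a1 := hY1 (e m).1 (e m).2
    have a2 := hY2 (e m).1 (e m).2
    have a3 := (hY3 (e m).1 (e m).2).1
    have a4 := (hY4 (e m).1 (e m).2).1
    simp only
    generalize Y (e m).1 (e m).2 = y at *
    have s1 := hS1 y
    have s2 := hS2 y
    have m1 := s1.mem_of_zero a1.1 a1.2 a3
    have m2 := s2.mem_of_zero a2.1 a2.2 a4
    refine ⟨tlc_neumann hab s1 a1.1 a1.2 a3 m2, tlc_neumann hab s2 a2.1 a2.2 a4 m1,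
      ⟨a, ha, ?_⟩, ⟨a, ha, ?_⟩, ⟨a, ha, ?_⟩, ⟨a, ha, ?_⟩⟩
    · rw [s1.pa]; exact a1.1.ne'
    · rw [s1.pa]; exact a1.2.ne
    · rw [s2.pa]; exact a2.1.ne'
    · rw [s2.pa]; exact a2.2.ne
end

section
/- (Small solutions are trivial.) Let λ_i > 0 for i = 1,…,N. For every k ∈ {1,…,N} there exists r_k ∈ (0,1) such that for all θ ∈ (0,1], every solution p = (p_1,…,p_N) of the Neumann problem (S_θ): p_i'' + θ λ_i w_i(x, p̂^i) f_i(p_i) = 0 in Ω, p_i'(ω̲) = p_i'(ω̄) = 0 (i = 1,…,N), with sup-norm ‖p_k‖_∞ ≤ r_k, satisfies p_k(x) = 0 for all x ∈ cl(Ω). -/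
open MeasureTheory Set Filter

/-- Hypothesis `(w_{i,*})` together with the L¹-Carathéodory conditions, for a single weight
`w : Ω × ℝ^{N-1} → ℝ` (here `Ω = Ioo a b`, `cl(Ω) = Icc a b`, and `ℝ^{N-1}` is `Fin n → ℝ`). -/
def WeightHyp (n : ℕ) (a b : ℝ) (w : ℝ → (Fin n → ℝ) → ℝ)
    (I : Set ℝ) (α β : ℝ → ℝ) : Prop :=
  -- `I` is a non-empty closed interval contained in `cl(Ω)`
  (∃ c d : ℝ, c ≤ d ∧ I = Set.Icc c d) ∧
  I ⊆ Set.Icc a b ∧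
  -- Carathéodory conditions: measurability in `x`, continuity in `ξ` for a.e. `x`
  (∀ ξ : Fin n → ℝ,
    AEStronglyMeasurable (fun x => w x ξ) (volume.restrict (Set.Ioo a b))) ∧
  (∀ᵐ x ∂(volume.restrict (Set.Ioo a b)), Continuous fun ξ => w x ξ) ∧
  -- sign condition on `I`
  (∀ ξ : Fin n → ℝ, (∀ j, ξ j ∈ Set.Icc (0:ℝ) 1) →
    (∀ x ∈ I, 0 ≤ w x ξ) ∧ ∃ x ∈ I, w x ξ ≠ 0) ∧
  -- `α, β ∈ L¹(Ω)`
  IntegrableOn α (Set.Ioo a b) ∧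
  IntegrableOn β (Set.Ioo a b) ∧
  -- `α ≥ 0` and `α ≢ 0` on `I`
  (∀ x ∈ I, 0 ≤ α x) ∧
  (∃ x ∈ I, α x ≠ 0) ∧
  -- `∫_Ω β < 0`
  (∫ x in Set.Ioo a b, β x) < 0 ∧
  -- `α(x) ≤ w(x,ξ) ≤ β(x)` for a.e. `x ∈ Ω` and all `ξ ∈ [0,1]^{N-1}`
  (∀ᵐ x ∂(volume.restrict (Set.Ioo a b)), ∀ ξ : Fin n → ℝ,
    (∀ j, ξ j ∈ Set.Icc (0:ℝ) 1) → α x ≤ w x ξ ∧ w x ξ ≤ β x)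

/-- Hypothesis `(f_{i,*})` for a continuous nonlinearity `f : [0,1] → [0,∞)`. -/
def NonlinC0 (f : ℝ → ℝ) : Prop :=
  ContinuousOn f (Set.Icc (0:ℝ) 1) ∧
  (∀ s ∈ Set.Icc (0:ℝ) 1, 0 ≤ f s) ∧
  f 0 = 0 ∧ f 1 = 0 ∧
  ∀ s ∈ Set.Ioo (0:ℝ) 1, 0 < f s

/-- Hypothesis `(f_{i,*})` for a continuously differentiable nonlinearity
`f : [0,1] → [0,∞)` with derivative `f'` on `[0,1]`. -/
def NonlinC1 (f f' : ℝ → ℝ) : Prop :=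
  NonlinC0 f ∧
  (∀ s ∈ Set.Icc (0:ℝ) 1, HasDerivWithinAt f (f' s) (Set.Icc (0:ℝ) 1) s) ∧
  ContinuousOn f' (Set.Icc (0:ℝ) 1)

/-- A (Carathéodory) solution of the Neumann problem `(S)`:
`p_i'' + λ_i w_i(x, p̂^i) f_i(p_i) = 0` in `Ω = Ioo a b`, `p_i'(a) = p_i'(b) = 0`.
Each `p_i : cl(Ω) → [0,1]` is `C¹` on `cl(Ω)` with absolutely continuous derivative
(encoded by the integral representation with an integrable second derivative `p''`),
and the equation holds a.e. in `Ω`. -/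
def IsSol (n : ℕ) (a b : ℝ) (w : Fin (n+1) → ℝ → (Fin n → ℝ) → ℝ)
    (f : Fin (n+1) → ℝ → ℝ) (lam : Fin (n+1) → ℝ)
    (p : Fin (n+1) → ℝ → ℝ) : Prop :=
  (∀ i, ∀ x ∈ Set.Icc a b, p i x ∈ Set.Icc (0:ℝ) 1) ∧
  ∀ i : Fin (n+1), ∃ p' p'' : ℝ → ℝ,
    (∀ x ∈ Set.Icc a b, HasDerivWithinAt (p i) (p' x) (Set.Icc a b) x) ∧
    ContinuousOn p' (Set.Icc a b) ∧
    IntegrableOn p'' (Set.Ioo a b) ∧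
    (∀ x ∈ Set.Icc a b, p' x = p' a + ∫ t in a..x, p'' t) ∧
    (∀ᵐ x ∂(volume.restrict (Set.Ioo a b)),
      p'' x + lam i * w i x (fun j => p (i.succAbove j) x) * f i (p i x) = 0) ∧
    p' a = 0 ∧ p' b = 0

/-- A solution is fully nontrivial if no component is identically `0` or identically `1`
on `cl(Ω)`. -/
def FullyNontrivial (n : ℕ) (a b : ℝ) (p : Fin (n+1) → ℝ → ℝ) : Prop :=
  ∀ i, (∃ x ∈ Set.Icc a b, p i x ≠ 0) ∧ (∃ x ∈ Set.Icc a b, p i x ≠ 1)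

lemma bnd {a x : ℝ} (hx : a ≤ x) {F g : ℝ → ℝ}
    (hg : IntervalIntegrable g volume a x)
    (h : ∀ᵐ t, t ∈ Ioc a x → |F t| ≤ g t) : |∫ t in a..x, F t| ≤ ∫ t in a..x, g t :=
  by
  rw [← Real.norm_eq_abs]
  exact intervalIntegral.norm_integral_le_of_norm_le hx h hg

lemma int_le {a x b : ℝ} (hx : a ≤ x) (hxb : x ≤ b) {g : ℝ → ℝ} (h0 : ∀ t, 0 ≤ g t)
    (hg : IntervalIntegrable g volume a b) : ∫ t in a..x, g t ≤ ∫ t in a..b, g t := by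
  apply intervalIntegral.integral_mono_interval le_rfl hx hxb _ hg
  exact Eventually.of_forall h0

lemma parts {a b : ℝ} (hab : a ≤ b) {h u u' : ℝ → ℝ}
    (hh : IntervalIntegrable h volume a b)
    (hu : ∀ x ∈ Icc a b, HasDerivWithinAt u (u' x) (Icc a b) x)
    (hu' : ContinuousOn u' (Icc a b)) {x : ℝ} (hx : x ∈ Icc a b) :
    (∫ t in a..x, h t) * u x = ∫ t in a..x, (h t * u t + (∫ s in a..t, h s) * u' t) := by
  have hsub : uIcc a x ⊆ uIcc a b := by
    rw [uIcc_of_le hx.1, uIcc_of_le hab]; exact Icc_subset_Icc_right hx.2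
  have h1 := (hh.absolutelyContinuousOnInterval_intervalIntegral (c := a) (by simp)).mono hsub
  obtain ⟨C, hC⟩ := isCompact_Icc.exists_bound_of_continuousOn hu'
  have h2 : AbsolutelyContinuousOnInterval u a b := by
    apply LipschitzOnWith.absolutelyContinuousOnInterval (K := C.toNNReal)
    rw [uIcc_of_le hab]
    apply (convex_Icc a b).lipschitzOnWith_of_nnnorm_hasDerivWithin_le hu
    intro y hy
    rw [← NNReal.coe_le_coe]
    exact (hC y hy).trans (Real.le_coe_toNNReal C)
  have h3 := h1.integral_deriv_mul_eq_sub (h2.mono hsub)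
  simp only [intervalIntegral.integral_same, zero_mul, sub_zero] at h3
  rw [← h3]
  apply intervalIntegral.integral_congr_ae
  have e1 : ∀ᵐ y : ℝ, y ≠ b := by simp [ae_iff, measure_singleton]
  filter_upwards [hh.ae_hasDerivAt_integral, e1] with y hy hyb hyx
  rw [uIoc_of_le hx.1] at hyx
  have hyI : y ∈ Icc a b := ⟨hyx.1.le, hyx.2.trans hx.2⟩
  rw [(hy (by rwa [uIcc_of_le hab]) a (by simp)).deriv,
    ((hu y hyI).hasDerivAt (Icc_mem_nhds hyx.1 (lt_of_le_of_ne hyI.2 hyb))).deriv]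

lemma core {a b : ℝ} (hab : a < b) {p p' p'' f f' g β W : ℝ → ℝ} {θ lam ε r G B : ℝ}
    (hf : NonlinC1 f f') (hr : r ∈ Ioo (0:ℝ) 1) (hfr : ∀ s ∈ Icc (0:ℝ) r, |f' s| ≤ ε)
    (hθ : θ ∈ Ioc (0:ℝ) 1) (hlam : 0 < lam) (hε : 0 < ε)
    (hg : IntervalIntegrable g volume a b) (hg0 : ∀ t, 0 ≤ g t)
    (hβ : IntervalIntegrable β volume a b)
    (hG : (∫ t in a..b, g t) < G) (hB : (∫ t in a..b, β t) = - B)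
    (c1 : lam * G * ε * (b - a) < 1) (c2 : 4 * ε * (b - a) * (lam * G) < 1)
    (c3 : ε * (b - a) * 4 * lam * G ^ 2 < B)
    (hW : ∀ᵐ t, t ∈ Ioc a b → |W t| ≤ g t ∧ W t ≤ β t)
    (hp : ∀ x ∈ Icc a b, p x ∈ Icc 0 r)
    (hd : ∀ x ∈ Icc a b, HasDerivWithinAt p (p' x) (Icc a b) x)
    (hi : IntervalIntegrable p'' volume a b)
    (hp' : ∀ x ∈ Icc a b, p' x = ∫ t in a..x, p'' t)
    (hpb : p' b = 0)
    (heq : ∀ᵐ t, t ∈ Ioc a b → p'' t = - (θ * lam * W t * f (p t))) :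
    ∀ x ∈ Icc a b, p x = 0 := by
  by_contra! hne
  obtain ⟨x₁, hx₁, hx₁0⟩ := hne
  have hL : 0 < b - a := sub_pos.2 hab
  have hG0 : 0 < G := lt_of_le_of_lt (intervalIntegral.integral_nonneg hab.le fun t _ => hg0 t) hG
  obtain ⟨⟨hfc, hfn, hf0, -, hfp⟩, hfd, hfc'⟩ := hf
  have hpc : ContinuousOn p (Icc a b) := fun x hx => (hd x hx).continuousWithinAt
  have hp01 : ∀ x ∈ Icc a b, p x ∈ Icc (0:ℝ) 1 := fun x hx =>
    ⟨(hp x hx).1, (hp x hx).2.trans hr.2.le⟩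
  have hμ : 0 < θ * lam := mul_pos hθ.1 hlam
  have hμl : θ * lam ≤ lam := by nlinarith [hθ.2]
  -- f s ≤ ε s
  have hfs : ∀ s ∈ Icc (0:ℝ) r, |f s| ≤ ε * s := by
    intro s hs
    have hsub : Icc (0:ℝ) s ⊆ Icc 0 1 := Icc_subset_Icc_right (hs.2.trans hr.2.le)
    have := (convex_Icc (0:ℝ) s).norm_image_sub_le_of_norm_hasDerivWithin_le
      (f := f) (f' := f') (C := ε) (fun y hy => (hfd y (hsub hy)).mono hsub)
      (fun y hy => hfr y ⟨hy.1, hy.2.trans hs.2⟩) (left_mem_Icc.2 hs.1) (right_mem_Icc.2 hs.1)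
    simpa [hf0, abs_of_nonneg hs.1] using this
  obtain ⟨xM, hxM, hmax⟩ := isCompact_Icc.exists_isMaxOn (nonempty_Icc.2 hab.le) hpc
  have hM0 : 0 < p xM := lt_of_lt_of_le
    (lt_of_le_of_ne (hp x₁ hx₁).1 (Ne.symm hx₁0)) (hmax hx₁)
  have hp'b : ∀ x ∈ Icc a b, |p' x| ≤ lam * ε * p xM * G := by
    intro x hx
    rw [hp' x hx]
    have hgx : IntervalIntegrable g volume a x := hg.mono_set (by
      rw [uIcc_of_le hx.1, uIcc_of_le hab.le]; exact Icc_subset_Icc_right hx.2)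
    have := bnd (F := p'') hx.1 (hgx.const_mul (lam * ε * p xM)) (by
      filter_upwards [hW, heq] with t h1 h2 ht
      have ht' : t ∈ Ioc a b := ⟨ht.1, ht.2.trans hx.2⟩
      have htI := Ioc_subset_Icc_self ht'
      rw [h2 ht', abs_neg, abs_mul, abs_mul, abs_of_pos hμ]
      calc θ * lam * |W t| * |f (p t)| ≤ lam * g t * (ε * p xM) := by
            have h3 := (h1 ht').1
            have h4 := (hfs _ (hp t htI)).trans (mul_le_mul_of_nonneg_left (hmax htI) hε.le)
            have := hg0 t
            gcongr
        _ = _ := by ring)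
    refine this.trans ?_
    rw [intervalIntegral.integral_const_mul]
    have := (int_le hx.1 hx.2 hg0 hg).trans hG.le
    gcongr
  have hpos : ∀ x ∈ Icc a b, 0 < p x := by
    intro x hx
    have h1 := (convex_Icc a b).norm_image_sub_le_of_norm_hasDerivWithin_le hd hp'b hx hxM
    have h2 : |xM - x| ≤ b - a := by
      rw [abs_le]; constructor <;> linarith [hx.1, hx.2, hxM.1, hxM.2]
    have h3 : p xM - p x ≤ lam * ε * p xM * G * (b - a) := by
      refine (le_abs_self _).trans (h1.trans ?_)
      rw [Real.norm_eq_abs]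
      gcongr
    nlinarith
  have hpI : ∀ x ∈ Icc a b, p x ∈ Ioo (0:ℝ) 1 := fun x hx =>
    ⟨hpos x hx, (hp x hx).2.trans_lt hr.2⟩
  have hfpos : ∀ x ∈ Icc a b, 0 < f (p x) := fun x hx => hfp _ (hpI x hx)
  set u : ℝ → ℝ := fun x => (f (p x))⁻¹ with hu
  set u' : ℝ → ℝ := fun x => -(f' (p x) * p' x) / f (p x) ^ 2 with hu'
  have hp'c : ContinuousOn p' (Icc a b) := by
    have := intervalIntegral.continuousOn_primitive_interval' hi (left_mem_uIcc)
    rw [uIcc_of_le hab.le] at this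
    exact this.congr hp'
  have hfpc : ContinuousOn (fun x => f (p x)) (Icc a b) := hfc.comp hpc hp01
  have huc : ContinuousOn u (Icc a b) := hfpc.inv₀ fun x hx => (hfpos x hx).ne'
  have hfpc' : ContinuousOn (fun x => f' (p x)) (Icc a b) := hfc'.comp hpc hp01
  have huc' : ContinuousOn u' (Icc a b) :=
    ((hfpc'.mul hp'c).neg).div (hfpc.pow 2) fun x hx => (pow_pos (hfpos x hx) 2).ne'
  have hud : ∀ x ∈ Icc a b, HasDerivWithinAt u (u' x) (Icc a b) x := by
    intro x hx
    have h1 : HasDerivAt f (f' (p x)) (p x) :=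
      (hfd _ (hp01 x hx)).hasDerivAt (Icc_mem_nhds (hpI x hx).1 (hpI x hx).2)
    exact (h1.comp_hasDerivWithinAt x (hd x hx)).inv (hfpos x hx).ne'
  set q : ℝ → ℝ := fun x => p' x * u x with hq
  have hqc : ContinuousOn q (Icc a b) := hp'c.mul huc
  have hqeq : ∀ x ∈ Icc a b,
      q x = ∫ t in a..x, (p'' t * u t - f' (p t) * q t ^ 2) := by
    intro x hx
    have h1 := parts hab.le hi hud huc' hx
    simp only [hq]
    rw [hp' x hx, h1]
    apply intervalIntegral.integral_congr
    intro t ht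
    rw [uIcc_of_le hx.1] at ht
    have htI : t ∈ Icc a b := ⟨ht.1, ht.2.trans hx.2⟩
    have := (hfpos t htI).ne'
    simp only [hu', hu]
    rw [← hp' t htI]
    field_simp
    ring
  have hpu : ∀ᵐ t, t ∈ Ioc a b → p'' t * u t = - (θ * lam * W t) := by
    filter_upwards [heq] with t h1 ht
    have := (hfpos t (Ioc_subset_Icc_self ht)).ne'
    rw [h1 ht]; simp only [hu]; field_simp
  obtain ⟨K, hK⟩ : ∃ K, K = θ * lam * G := ⟨_, rfl⟩
  have hK0 : 0 < K := hK ▸ mul_pos hμ hG0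
  have hKl : K ≤ lam * G := by rw [hK]; gcongr
  have hqa : q a = 0 := by
    simp [hq, hp' a (left_mem_Icc.2 hab.le)]
  have hqK : ∀ x ∈ Icc a b, |q x| ≤ 2 * K := by
    by_contra! hne
    obtain ⟨y, hy, hyK⟩ := hne
    have hcl : IsCompact {x ∈ Icc a b | 2 * K ≤ |q x|} := by
      apply isCompact_Icc.of_isClosed_subset _ (fun x hx => hx.1)
      exact ContinuousOn.preimage_isClosed_of_isClosed (hqc.abs) isClosed_Icc isClosed_Ici
    obtain ⟨x0, ⟨hx0, hx0K⟩, hmin⟩ := hcl.exists_isLeast ⟨y, hy, hyK.le⟩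
    have hgx : IntervalIntegrable g volume a x0 := hg.mono_set (by
      rw [uIcc_of_le hx0.1, uIcc_of_le hab.le]; exact Icc_subset_Icc_right hx0.2)
    have e1 : ∀ᵐ y : ℝ, y ≠ x0 := by simp [ae_iff, measure_singleton]
    have h1 := bnd (F := fun t => p'' t * u t - f' (p t) * q t ^ 2) hx0.1
      ((hgx.const_mul (θ * lam)).add (intervalIntegrable_const (c := ε * (2 * K) ^ 2))) (by
      filter_upwards [hW, hpu, e1] with t h1 h2 h3 ht
      have ht' : t ∈ Ioc a b := ⟨ht.1, ht.2.trans hx0.2⟩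
      have htI := Ioc_subset_Icc_self ht'
      have h4 : |q t| ≤ 2 * K := by
        by_contra! hc
        exact absurd (hmin ⟨htI, hc.le⟩) (not_le.2 (lt_of_le_of_ne ht.2 h3))
      have h5 : |f' (p t) * q t ^ 2| ≤ ε * (2 * K) ^ 2 := by
        rw [abs_mul, abs_pow]
        have := hfr _ (hp t htI)
        gcongr
      have h6 : |p'' t * u t| ≤ θ * lam * g t := by
        rw [h2 ht', abs_neg, abs_mul, abs_of_pos hμ]
        have := (h1 ht').1
        gcongr
      exact (abs_sub _ _).trans (add_le_add h6 h5))
    rw [← hqeq x0 hx0, intervalIntegral.integral_add (hgx.const_mul _) (by simp),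
      intervalIntegral.integral_const_mul, intervalIntegral.integral_const, smul_eq_mul] at h1
    have h2 := mul_le_mul_of_nonneg_left ((int_le hx0.1 hx0.2 hg0 hg).trans hG.le) hμ.le
    have h3 : (x0 - a) * (ε * (2 * K) ^ 2) ≤ (b - a) * (ε * (2 * K) ^ 2) := by
      have := hx0.2
      gcongr
    have h4 : 4 * ε * (b - a) * K < 1 :=
      lt_of_le_of_lt (by gcongr) c2
    rw [← hK] at h2
    nlinarith
  have hbI := right_mem_Icc.2 hab.le
  have h1 := hqeq b hbI
  have hqb : q b = 0 := by simp [hq, hpb]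
  have hi1 : IntervalIntegrable (fun t => p'' t * u t) volume a b :=
    hi.mul_continuousOn (by rwa [uIcc_of_le hab.le])
  have hi2 : IntervalIntegrable (fun t => f' (p t) * q t ^ 2) volume a b :=
    ContinuousOn.intervalIntegrable (by
      rw [uIcc_of_le hab.le]; exact hfpc'.mul (hqc.pow 2))
  rw [hqb, intervalIntegral.integral_sub hi1 hi2] at h1
  have h2 : |∫ t in a..b, f' (p t) * q t ^ 2| ≤ ∫ t in a..b, ε * (2 * K) ^ 2 := by
    apply bnd hab.le (by simp)
    refine Eventually.of_forall fun t ht => ?_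
    have htI := Ioc_subset_Icc_self ht
    rw [abs_mul, abs_pow]
    have := hfr _ (hp t htI)
    have := hqK t htI
    gcongr
  have h3 : ∫ t in a..b, (-(θ * lam)) * β t ≤ ∫ t in a..b, p'' t * u t := by
    apply intervalIntegral.integral_mono_ae_restrict hab.le (hβ.const_mul _) hi1
    rw [← restrict_Ioc_eq_restrict_Icc]
    refine (ae_restrict_iff' measurableSet_Ioc).2 ?_
    filter_upwards [hW, hpu] with t h1 h2 ht
    rw [h2 ht]
    have := (h1 ht).2
    nlinarith
  rw [intervalIntegral.integral_const_mul, hB] at h3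
  rw [intervalIntegral.integral_const, smul_eq_mul] at h2
  have h4 := (le_abs_self _).trans h2
  have h5 : (b - a) * (ε * (2 * K) ^ 2) ≤ θ * lam * (ε * (b - a) * 4 * lam * G ^ 2) := by
    have : K ^ 2 ≤ θ * lam * (lam * G ^ 2) := by
      rw [hK]
      calc (θ * lam * G) ^ 2 = θ * lam * ((θ * lam) * G ^ 2) := by ring
        _ ≤ _ := by gcongr
    calc (b - a) * (ε * (2 * K) ^ 2) = 4 * (b - a) * ε * K ^ 2 := by ring
      _ ≤ 4 * (b - a) * ε * (θ * lam * (lam * G ^ 2)) := by gcongr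
      _ = _ := by ring
  have h6 := mul_lt_mul_of_pos_left c3 hμ
  linarith

/-- Small solutions are trivial: for every `k` there is `r_k ∈ (0,1)` such
that for all `θ ∈ (0,1]`, every solution of `(S_θ)` with `‖p_k‖_∞ ≤ r_k` has `p_k ≡ 0`. -/
theorem small_solutions_trivial
    (n : ℕ) (hn : 1 ≤ n) (a b : ℝ) (hab : a < b)
    (w : Fin (n+1) → ℝ → (Fin n → ℝ) → ℝ)
    (I : Fin (n+1) → Set ℝ) (α β : Fin (n+1) → ℝ → ℝ)
    (hw : ∀ i, WeightHyp n a b (w i) (I i) (α i) (β i))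
    (f f' : Fin (n+1) → ℝ → ℝ)
    (hf : ∀ i, NonlinC1 (f i) (f' i))
    (hf0 : ∀ i, f' i 0 = 0)
    (lam : Fin (n+1) → ℝ) (hlam : ∀ i, 0 < lam i) :
    ∀ k : Fin (n+1), ∃ r : ℝ, r ∈ Set.Ioo (0:ℝ) 1 ∧
      ∀ θ : ℝ, θ ∈ Set.Ioc (0:ℝ) 1 →
        ∀ p : Fin (n+1) → ℝ → ℝ, IsSol n a b w f (fun i => θ * lam i) p →
          sSup (p k '' Set.Icc a b) ≤ r →
          ∀ x ∈ Set.Icc a b, p k x = 0 := by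
  intro k
  obtain ⟨-, -, -, -, -, hα, hβ, -, -, hβneg, hwb⟩ := hw k
  have conv : ∀ {F : ℝ → ℝ}, IntegrableOn F (Ioo a b) → IntervalIntegrable F volume a b :=
    fun h => (intervalIntegrable_iff_integrableOn_Ioo_of_le hab.le).2 h
  have hrest : ∀ {P : ℝ → Prop}, (∀ᵐ x ∂(volume.restrict (Ioo a b)), P x) →
      ∀ᵐ x, x ∈ Ioc a b → P x := by
    intro P h
    rw [restrict_Ioo_eq_restrict_Ioc] at h
    exact (ae_restrict_iff' measurableSet_Ioc).1 h
  obtain ⟨g, hgdef⟩ : ∃ g : ℝ → ℝ, g = fun t => |α k t| + |β k t| := ⟨_, rfl⟩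
  have hg : IntervalIntegrable g volume a b := by
    rw [hgdef]; exact (conv hα).abs.add (conv hβ).abs
  have hg0 : ∀ t, 0 ≤ g t := fun t => by rw [hgdef]; positivity
  have hint0 : 0 ≤ ∫ t in a..b, g t := intervalIntegral.integral_nonneg hab.le fun t _ => hg0 t
  obtain ⟨G, hGdef⟩ : ∃ G, G = (∫ t in a..b, g t) + 1 := ⟨_, rfl⟩
  have hG1 : 1 ≤ G := by linarith
  obtain ⟨B, hBdef⟩ : ∃ B, B = -(∫ t in a..b, β k t) := ⟨_, rfl⟩
  have hB0 : 0 < B := by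
    rw [hBdef, intervalIntegral.integral_of_le hab.le, integral_Ioc_eq_integral_Ioo]
    linarith
  have hL : 0 < b - a := sub_pos.2 hab
  have hl := hlam k
  obtain ⟨m, hm⟩ : ∃ m, m = min 1 B := ⟨_, rfl⟩
  have hm0 : 0 < m := by rw [hm]; exact lt_min one_pos hB0
  have hm1 : m ≤ 1 := hm ▸ min_le_left _ _
  have hmB : m ≤ B := hm ▸ min_le_right _ _
  have hG0 : 0 < G := by linarith
  obtain ⟨ε, hεdef⟩ : ∃ ε, ε = m / (8 * (b - a) * lam k * G ^ 2) := ⟨_, rfl⟩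
  have hε : 0 < ε := by rw [hεdef]; positivity
  have hkey : ε * (b - a) * lam k * G ^ 2 = m / 8 := by
    rw [hεdef]; field_simp
  have hkey2 : ε * (b - a) * lam k * G ≤ m / 8 := by
    rw [← hkey]
    have : G ≤ G ^ 2 := by nlinarith
    gcongr
  obtain ⟨hf1, hfd, hfc⟩ := hf k
  have h0 := Metric.continuousWithinAt_iff.1 (hfc 0 (by simp)) ε hε
  obtain ⟨δ, hδ, hδf⟩ := h0
  refine ⟨min (δ / 2) (1 / 2), ⟨by positivity, ?_⟩, ?_⟩
  · exact lt_of_le_of_lt (min_le_right _ _) (by norm_num)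
  have hr2 : min (δ / 2) (1 / 2) ≤ 1 / 2 := min_le_right _ _
  have hr1 : min (δ / 2) (1 / 2) ≤ δ / 2 := min_le_left _ _
  intro θ hθ p hsol hsup
  obtain ⟨hp01, hsol⟩ := hsol
  obtain ⟨p', p'', hd, -, hi, hp', heq, hpa, hpb⟩ := hsol k
  refine core (p' := p') (p'' := p'') (f := f k) (f' := f' k) (g := g) (β := β k)
    (W := fun t => w k t (fun j => p (k.succAbove j) t)) (θ := θ) (lam := lam k) (ε := ε)
    (r := min (δ / 2) (1 / 2)) (G := G) (B := B) hab (hf k) ⟨by positivity, by linarith⟩ ?_ hθ hl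
    hε hg hg0 (conv hβ) (by linarith) (by linarith) (by linarith) (by linarith) (by linarith) ?_ ?_
    hd (conv hi) ?_ hpb ?_
  · intro s hs
    have h1 := hδf (x := s) ⟨hs.1, by linarith [hs.2]⟩ (by
      rw [Real.dist_eq, sub_zero, abs_of_nonneg hs.1]; linarith [hs.2])
    rw [hf0 k, Real.dist_eq, sub_zero] at h1
    exact h1.le
  · filter_upwards [hrest hwb] with t h1 ht
    have htI := Ioc_subset_Icc_self ht
    have h2 := h1 ht (fun j => p (k.succAbove j) t) (fun j => hp01 _ t htI)
    refine ⟨?_, h2.2⟩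
    rw [hgdef]
    have e1 := neg_abs_le (α k t)
    have e2 := le_abs_self (β k t)
    have e3 := abs_nonneg (α k t)
    have e4 := abs_nonneg (β k t)
    rw [abs_le]
    constructor <;> dsimp only <;> linarith [h2.1, h2.2]
  · intro x hx
    refine ⟨(hp01 k x hx).1, (le_csSup ?_ (mem_image_of_mem _ hx)).trans hsup⟩
    refine ⟨1, ?_⟩
    rintro _ ⟨y, hy, rfl⟩
    exact (hp01 k y hy).2
  · intro x hx
    rw [hp' x hx, hpa, zero_add]
  · filter_upwards [hrest heq] with t h1 ht
    have := h1 ht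
    linarith
end

section
/- (Weak maximum principle for the truncated system.) Let λ_i > 0 for i = 1,…,N and define, for i = 1,…,N, the truncated nonlinearity h_i(x, ξ) = −ξ_i if ξ_i ≤ 0, h_i(x, ξ) = λ_i w_i(x, ξ̂^i) f_i(ξ_i) if 0 ≤ ξ_i ≤ 1, and h_i(x, ξ) = 1 − ξ_i if ξ_i ≥ 1, where ξ̂^i ∈ ℝ^{N−1} is obtained from ξ ∈ ℝ^N by removing the i-th component. Then every function p = (p_1,…,p_N), with each p_i : cl(Ω) → ℝ continuously differentiable on cl(Ω), p_i' absolutely continuous, satisfying p_i'' + h_i(x, p(x)) = 0 for a.e. x ∈ Ω and p_i'(ω̲) = p_i'(ω̄) = 0 for every i, satisfies 0 ≤ p_i(x) ≤ 1 for all x ∈ cl(Ω) and every i = 1,…,N; in particular p solves the Neumann problem p_i'' + λ_i w_i(x, p̂^i) f_i(p_i) = 0 with the same boundary conditions. -/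
open MeasureTheory Set Filter

/-- The truncated nonlinearity `h_i(x, ξ)`. -/
noncomputable def htrunc (n : ℕ) (w : Fin (n+1) → ℝ → (Fin n → ℝ) → ℝ)
    (f : Fin (n+1) → ℝ → ℝ) (lam : Fin (n+1) → ℝ) (i : Fin (n+1))
    (x : ℝ) (ξ : Fin (n+1) → ℝ) : ℝ :=
  if ξ i ≤ 0 then -ξ i
  else if ξ i ≤ 1 then lam i * w i x (fun j => ξ (i.succAbove j)) * f i (ξ i)
  else 1 - ξ i

lemma wmp_int_neg {a b : ℝ} {q q'' : ℝ → ℝ} (hq : ContinuousOn q (Icc a b))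
    (hae : ∀ᵐ x ∂(volume.restrict (Ioo a b)), q x < 0 → q'' x = q x)
    {c d : ℝ} (hac : a ≤ c) (hcd : c < d) (hdb : d ≤ b) (hneg : ∀ x ∈ Ioo c d, q x < 0) :
    ∫ t in c..d, q'' t < 0 := by
  have h1 : ∫ t in c..d, q'' t = ∫ t in c..d, q t := by
    rw [intervalIntegral.integral_of_le hcd.le, intervalIntegral.integral_of_le hcd.le,
      integral_Ioc_eq_integral_Ioo, integral_Ioc_eq_integral_Ioo]
    apply integral_congr_ae
    have h2 := ae_restrict_of_ae_restrict_of_subset (Ioo_subset_Ioo hac hdb) hae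
    filter_upwards [h2, ae_restrict_mem measurableSet_Ioo] with x hx hm
    exact hx (hneg x hm)
  rw [h1]
  have hi : IntervalIntegrable q volume c d := by
    apply ContinuousOn.intervalIntegrable
    rw [uIcc_of_le hcd.le]
    exact hq.mono (Icc_subset_Icc hac hdb)
  have := intervalIntegral.intervalIntegral_pos_of_pos_on hi.neg
    (fun x hx => by simpa using hneg x hx) hcd
  simp only [Pi.neg_apply, intervalIntegral.integral_neg] at this
  linarith

lemma wmp_nonneg {a b : ℝ} (hab : a < b) {q q' q'' : ℝ → ℝ}
    (hd : ∀ x ∈ Icc a b, HasDerivWithinAt q (q' x) (Icc a b) x)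
    (hint : IntegrableOn q'' (Ioo a b))
    (hr : ∀ x ∈ Icc a b, q' x = q' a + ∫ t in a..x, q'' t)
    (hae : ∀ᵐ x ∂(volume.restrict (Ioo a b)), q x < 0 → q'' x = q x)
    (ha : q' a = 0) (hb : q' b = 0) : ∀ x ∈ Icc a b, 0 ≤ q x := by
  have hq : ContinuousOn q (Icc a b) := fun x hx => (hd x hx).continuousWithinAt
  obtain ⟨x0, hx0, hmin⟩ := isCompact_Icc.exists_isMinOn (nonempty_Icc.2 hab.le) hq
  by_contra! hcon
  obtain ⟨z, hz, hz0⟩ := hcon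
  have hx0neg : q x0 < 0 := lt_of_le_of_lt (hmin hz) hz0
  have hq0 : q' x0 = 0 := by
    rcases eq_or_lt_of_le hx0.1 with h | h
    · rw [← h, ha]
    rcases eq_or_lt_of_le hx0.2 with h' | h'
    · rw [h', hb]
    have hn : Icc a b ∈ nhds x0 := Icc_mem_nhds h h'
    exact (hmin.isLocalMin hn).hasDerivAt_eq_zero ((hd x0 hx0).hasDerivAt hn)
  have hii : ∀ x ∈ Icc a b, IntervalIntegrable q'' volume a x := by
    intro x hx
    rw [intervalIntegrable_iff_integrableOn_Ioo_of_le hx.1]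
    exact hint.mono_set (Ioo_subset_Ioo le_rfl hx.2)
  have hdiff : ∀ x ∈ Icc a b, ∀ y ∈ Icc a b, q' y - q' x = ∫ t in x..y, q'' t := by
    intro x hx y hy
    rw [hr x hx, hr y hy, ← intervalIntegral.integral_interval_sub_left (hii y hy) (hii x hx)]
    ring
  have hev : ∀ᶠ x in nhdsWithin x0 (Icc a b), q x < 0 := (hq x0 hx0).eventually (gt_mem_nhds hx0neg)
  obtain ⟨ε, hε, hball⟩ := Metric.mem_nhdsWithin_iff.1 hev
  have hball' : ∀ x ∈ Icc a b, |x - x0| < ε → q x < 0 := fun x hx h =>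
    hball ⟨by simpa [Real.dist_eq] using h, hx⟩
  rcases lt_or_ge x0 b with h | h
  · obtain ⟨y, hy1, hy2⟩ := exists_between (lt_min h (lt_add_of_pos_right x0 hε))
    have hyb := lt_of_lt_of_le hy2 (min_le_left _ _)
    have hye := lt_of_lt_of_le hy2 (min_le_right _ _)
    have hsub : Icc x0 y ⊆ Icc a b := Icc_subset_Icc hx0.1 hyb.le
    obtain ⟨c, hc, hc'⟩ := exists_hasDerivAt_eq_slope q q' hy1 (hq.mono hsub) (fun x hx =>
      (hd x (hsub (Ioo_subset_Icc_self hx))).hasDerivAt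
        (Icc_mem_nhds (by linarith [hx.1, hx0.1]) (by linarith [hx.2])))
    have hcI := hsub (Ioo_subset_Icc_self hc)
    have h1 := hdiff x0 hx0 c hcI
    have h2 := wmp_int_neg hq hae hx0.1 hc.1 hcI.2 (fun x hx => hball' x
      ⟨by linarith [hx.1, hx0.1], by linarith [hx.2, hcI.2]⟩
      (by rw [abs_of_pos (by linarith [hx.1])]; linarith [hx.2, hc.2]))
    have h3 : q x0 ≤ q y := hmin (hsub ⟨hy1.le, le_rfl⟩)
    have h4 : 0 ≤ (q y - q x0) / (y - x0) := div_nonneg (by linarith) (by linarith)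
    linarith
  · have hax : a < x0 := by linarith
    obtain ⟨y, hy1, hy2⟩ := exists_between (max_lt hax (sub_lt_self x0 hε))
    have hyb := lt_of_le_of_lt (le_max_left _ _) hy1
    have hye := lt_of_le_of_lt (le_max_right _ _) hy1
    have hsub : Icc y x0 ⊆ Icc a b := Icc_subset_Icc hyb.le hx0.2
    obtain ⟨c, hc, hc'⟩ := exists_hasDerivAt_eq_slope q q' hy2 (hq.mono hsub) (fun x hx =>
      (hd x (hsub (Ioo_subset_Icc_self hx))).hasDerivAt
        (Icc_mem_nhds (by linarith [hx.1]) (by linarith [hx.2, hx0.2])))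
    have hcI := hsub (Ioo_subset_Icc_self hc)
    have h1 := hdiff c hcI x0 hx0
    have h2 := wmp_int_neg hq hae hcI.1 hc.2 hx0.2 (fun x hx => hball' x
      ⟨by linarith [hx.1, hcI.1], by linarith [hx.2, hx0.2]⟩
      (by rw [abs_of_neg (by linarith [hx.2])]; linarith [hx.1, hc.1]))
    have h3 : q x0 ≤ q y := hmin (hsub ⟨le_rfl, hy2.le⟩)
    have h4 : (q x0 - q y) / (x0 - y) ≤ 0 := div_nonpos_of_nonpos_of_nonneg (by linarith) (by linarith)
    linarith

/-- Weak maximum principle for the truncated system: any Neumann solution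
of `p_i'' + h_i(x, p) = 0` satisfies `0 ≤ p_i ≤ 1` on `cl(Ω)` and hence solves `(S)`. -/
theorem weak_maximum_principle
    (n : ℕ) (hn : 1 ≤ n) (a b : ℝ) (hab : a < b)
    (w : Fin (n+1) → ℝ → (Fin n → ℝ) → ℝ)
    (I : Fin (n+1) → Set ℝ) (α β : Fin (n+1) → ℝ → ℝ)
    (hw : ∀ i, WeightHyp n a b (w i) (I i) (α i) (β i))
    (f : Fin (n+1) → ℝ → ℝ)
    (hf : ∀ i, NonlinC0 (f i))
    (lam : Fin (n+1) → ℝ) (hlam : ∀ i, 0 < lam i)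
    (p : Fin (n+1) → ℝ → ℝ)
    (hp : ∀ i : Fin (n+1), ∃ p' p'' : ℝ → ℝ,
      (∀ x ∈ Set.Icc a b, HasDerivWithinAt (p i) (p' x) (Set.Icc a b) x) ∧
      ContinuousOn p' (Set.Icc a b) ∧
      IntegrableOn p'' (Set.Ioo a b) ∧
      (∀ x ∈ Set.Icc a b, p' x = p' a + ∫ t in a..x, p'' t) ∧
      (∀ᵐ x ∂(volume.restrict (Set.Ioo a b)),
        p'' x + htrunc n w f lam i x (fun j => p j x) = 0) ∧
      p' a = 0 ∧ p' b = 0) :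
    (∀ i, ∀ x ∈ Set.Icc a b, p i x ∈ Set.Icc (0:ℝ) 1) ∧
    IsSol n a b w f lam p := by
  have hmain : ∀ i, ∀ x ∈ Set.Icc a b, p i x ∈ Set.Icc (0:ℝ) 1 := by
    intro i
    obtain ⟨p', p'', hd, -, hint, hr, hae, ha, hb⟩ := hp i
    have h0 := wmp_nonneg hab hd hint hr (by
      filter_upwards [hae] with x hx hneg
      simp only [htrunc, if_pos hneg.le] at hx
      linarith) ha hb
    have h1 := wmp_nonneg (q := fun x => 1 - p i x) (q' := fun x => - p' x)
      (q'' := fun x => - p'' x) hab (fun x hx => (hd x hx).const_sub 1) hint.neg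
      (fun x hx => by rw [hr x hx, intervalIntegral.integral_neg]; ring) (by
      filter_upwards [hae] with x hx hneg
      have h2 : ¬ p i x ≤ 1 := by linarith
      have h3 : ¬ p i x ≤ 0 := by linarith
      simp only [htrunc, if_neg h2, if_neg h3] at hx
      linarith) (by simp [ha]) (by simp [hb])
    intro x hx
    exact ⟨h0 x hx, by have := h1 x hx; linarith⟩
  refine ⟨hmain, hmain, fun i => ?_⟩
  obtain ⟨p', p'', hd, hc, hint, hr, hae, ha, hb⟩ := hp i
  refine ⟨p', p'', hd, hc, hint, hr, ?_, ha, hb⟩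
  filter_upwards [hae, ae_restrict_mem measurableSet_Ioo] with x hx hm
  have hI := hmain i x (Ioo_subset_Icc_self hm)
  by_cases h0 : p i x ≤ 0
  · have he : p i x = 0 := le_antisymm h0 hI.1
    simp only [htrunc, if_pos h0] at hx
    rw [he, (hf i).2.2.1]
    linarith
  · simpa only [htrunc, if_neg h0, if_pos hI.2] using hx
end

section
/- (Strong bounds for nontrivial components.) Let λ_i > 0 for i = 1,…,N and assume each f_i is continuously differentiable on [0,1]. If p = (p_1,…,p_N) is a solution of the Neumann problem (S): p_i'' + λ_i w_i(x, p̂^i) f_i(p_i) = 0 in Ω, p_i'(ω̲) = p_i'(ω̄) = 0 (i = 1,…,N), and for some index k the component p_k is not identically 0 and not identically 1, then 0 < p_k(x) < 1 for all x ∈ cl(Ω). -/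
open MeasureTheory Set Filter

lemma sb_aux (a b : ℝ) (hab : a < b) (u u' u'' g : ℝ → ℝ)
    (hu0 : ∀ x ∈ Icc a b, 0 ≤ u x)
    (hd : ∀ x ∈ Icc a b, HasDerivWithinAt u (u' x) (Icc a b) x)
    (hi : IntegrableOn u'' (Ioo a b))
    (hrep : ∀ x ∈ Icc a b, u' x = u' a + ∫ t in a..x, u'' t)
    (ha : u' a = 0) (hb : u' b = 0)
    (hg : IntegrableOn g (Ioo a b)) (hg0 : ∀ x, 0 ≤ g x)
    (hbd : ∀ᵐ x ∂(volume.restrict (Ioo a b)), |u'' x| ≤ g x * u x)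
    (x0 : ℝ) (hx0 : x0 ∈ Icc a b) (hux0 : u x0 = 0) :
    ∀ x ∈ Icc a b, u x = 0 := by
  have hcont : ContinuousOn u (Icc a b) := fun x hx => (hd x hx).continuousWithinAt
  have hi1 : IntegrableOn u'' (Icc a b) := by rwa [integrableOn_Icc_iff_integrableOn_Ioo]
  have hg1 : IntegrableOn g (Icc a b) := by rwa [integrableOn_Icc_iff_integrableOn_Ioo]
  have hII : ∀ h : ℝ → ℝ, IntegrableOn h (Icc a b) → ∀ x ∈ Icc a b, ∀ y ∈ Icc a b,
      IntervalIntegrable h volume x y := by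
    intro h hh x hx y hy
    apply IntegrableOn.intervalIntegrable
    exact hh.mono_set (uIcc_subset_Icc hx hy)
  have haa : a ∈ Icc a b := left_mem_Icc.2 hab.le
  have hbd2 : ∀ᵐ x ∂(volume.restrict (Icc a b)), |u'' x| ≤ g x * u x := by
    rwa [← restrict_Ioo_eq_restrict_Icc]
  have hG : ContinuousOn (fun x => ∫ t in a..x, g t) (Icc a b) :=
    intervalIntegral.continuousOn_primitive_interval (by rwa [uIcc_of_le hab.le])|>.mono
      (by rw [uIcc_of_le hab.le])
  have key : ∀ z ∈ Icc a b, u z = 0 → ∃ ε > 0, ∀ x ∈ Icc a b, |x - z| < ε → u x = 0 := by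
    intro z hz huz
    have hu'z : u' z = 0 := by
      rcases eq_or_lt_of_le hz.1 with h | h
      · rw [← h, ha]
      rcases eq_or_lt_of_le hz.2 with h2 | h2
      · rw [h2, hb]
      have hnh : Icc a b ∈ nhds z := Icc_mem_nhds h h2
      have hmin : IsLocalMin u z := by
        filter_upwards [hnh] with y hy
        rw [huz]; exact hu0 y hy
      exact hmin.hasDerivAt_eq_zero ((hd z hz).hasDerivAt hnh)
    obtain ⟨δ, hδ, hδG⟩ := Metric.continuousWithinAt_iff.1 (hG z hz) (1/2) (by norm_num)
    set δ' := min (δ/2) 1 with hδ'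
    have hδ'0 : 0 < δ' := lt_min (by linarith) one_pos
    have hδ'1 : δ' ≤ 1 := min_le_right _ _
    have hδ'2 : δ' ≤ δ/2 := min_le_left _ _
    refine ⟨δ', hδ'0, ?_⟩
    set J := Icc (max a (z - δ')) (min b (z + δ')) with hJ
    have hJs : J ⊆ Icc a b := Icc_subset_Icc (le_max_left _ _) (min_le_left _ _)
    have hzJ : z ∈ J := ⟨max_le hz.1 (by linarith), le_min hz.2 (by linarith)⟩
    have hJd : ∀ x ∈ J, |x - z| ≤ δ' := by
      intro x hx
      have h1 := (le_max_right a (z - δ')).trans hx.1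
      have h2 := hx.2.trans (min_le_right b (z + δ'))
      rw [abs_le]; constructor <;> linarith
    obtain ⟨y, hyJ, hy⟩ := isCompact_Icc.exists_isMaxOn ⟨z, hzJ⟩ (hcont.mono hJs)
    have hm0 : 0 ≤ u y := hu0 y (hJs hyJ)
    have hu'b : ∀ x ∈ J, ‖u' x‖ ≤ u y / 2 := by
      intro x hx
      have e1 : u' x = ∫ t in z..x, u'' t := by
        have h1 := hrep x (hJs hx)
        have h2 := hrep z hz
        have h3 := intervalIntegral.integral_add_adjacent_intervals
          (hII u'' hi1 a haa z hz) (hII u'' hi1 z hz x (hJs hx))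
        linarith
      have e2 : |∫ t in z..x, g t| ≤ 1/2 := by
        have h3 := intervalIntegral.integral_add_adjacent_intervals
          (hII g hg1 a haa z hz) (hII g hg1 z hz x (hJs hx))
        have h4 := hδG (hJs hx) (by rw [Real.dist_eq]; linarith [hJd x hx])
        rw [Real.dist_eq] at h4
        have : ∫ t in z..x, g t = (∫ t in a..x, g t) - ∫ t in a..z, g t := by linarith
        rw [this]; exact h4.le
      have hsub : uIoc z x ⊆ J := uIoc_subset_uIcc.trans (uIcc_subset_Icc hzJ hx)
      have e3 : ‖∫ t in z..x, u'' t‖ ≤ |∫ t in z..x, g t * u y| := by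
        apply intervalIntegral.norm_integral_le_abs_of_norm_le
        · have := ae_restrict_of_ae_restrict_of_subset (hsub.trans hJs) hbd2
          filter_upwards [this, ae_restrict_mem measurableSet_uIoc] with t ht htm
          exact ht.trans (mul_le_mul_of_nonneg_left (hy (hsub htm)) (hg0 t))
        · exact (hII g hg1 z hz x (hJs hx)).mul_const _
      rw [intervalIntegral.integral_mul_const, abs_mul, abs_of_nonneg hm0] at e3
      rw [e1]
      nlinarith
    have hmv := (convex_Icc (max a (z - δ')) (min b (z + δ'))).norm_image_sub_le_of_norm_hasDerivWithin_le
      (fun x hx => (hd x (hJs hx)).mono hJs) hu'b hzJ hyJ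
    rw [huz, sub_zero, Real.norm_eq_abs, Real.norm_eq_abs, abs_of_nonneg hm0] at hmv
    have hm : u y = 0 := by
      have := hJd y hyJ
      nlinarith
    intro x hx hxz
    have hxJ : x ∈ J := by
      rw [abs_lt] at hxz
      exact ⟨max_le hx.1 (by linarith), le_min hx.2 (by linarith)⟩
    exact le_antisymm (hm ▸ hy hxJ) (hu0 x hx)
  have hclopen : IsClopen {x : Icc a b | u x = 0} := by
    constructor
    · exact isClosed_eq (continuousOn_iff_continuous_domRestrict.1 hcont) continuous_const
    · rw [Metric.isOpen_iff]
      rintro ⟨z, hz⟩ hzu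
      obtain ⟨ε, hε, h⟩ := key z hz hzu
      exact ⟨ε, hε, fun x hx => h x.1 x.2 hx⟩
  have : PreconnectedSpace (Icc a b) := Subtype.preconnectedSpace isPreconnected_Icc
  have := hclopen.eq_univ ⟨⟨x0, hx0⟩, hux0⟩
  intro x hx
  have h : (⟨x, hx⟩ : Icc a b) ∈ {x : Icc a b | u x = 0} := by rw [this]; trivial
  exact h

/-- Strong bounds for nontrivial components: if `p` solves `(S)` and
`p_k` is not identically `0` nor identically `1`, then `0 < p_k < 1` on `cl(Ω)`. -/
theorem strong_bounds
    (n : ℕ) (hn : 1 ≤ n) (a b : ℝ) (hab : a < b)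
    (w : Fin (n+1) → ℝ → (Fin n → ℝ) → ℝ)
    (I : Fin (n+1) → Set ℝ) (α β : Fin (n+1) → ℝ → ℝ)
    (hw : ∀ i, WeightHyp n a b (w i) (I i) (α i) (β i))
    (f f' : Fin (n+1) → ℝ → ℝ)
    (hf : ∀ i, NonlinC1 (f i) (f' i))
    (lam : Fin (n+1) → ℝ) (hlam : ∀ i, 0 < lam i)
    (p : Fin (n+1) → ℝ → ℝ) (hp : IsSol n a b w f lam p)
    (k : Fin (n+1))
    (hk0 : ∃ x ∈ Set.Icc a b, p k x ≠ 0)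
    (hk1 : ∃ x ∈ Set.Icc a b, p k x ≠ 1) :
    ∀ x ∈ Set.Icc a b, 0 < p k x ∧ p k x < 1 := by
  have hfk := hf k
  obtain ⟨⟨-, hf0, hfz, hfo, -⟩, hfd, hfc⟩ := hfk
  obtain ⟨-, -, -, -, -, hα, hβ, -, -, -, hwb⟩ := hw k
  obtain ⟨hr, hsol⟩ := hp
  obtain ⟨q, q2, hd, -, hi, hrep, heq, hqa, hqb⟩ := hsol k
  have hl := hlam k
  obtain ⟨M, hM⟩ := isCompact_Icc.exists_bound_of_continuousOn hfc
  have z01 : (0:ℝ) ∈ Icc (0:ℝ) 1 := by simp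
  have o01 : (1:ℝ) ∈ Icc (0:ℝ) 1 := by simp
  have hM0 : 0 ≤ M := (norm_nonneg _).trans (hM 0 z01)
  have hb0 : ∀ s ∈ Icc (0:ℝ) 1, f k s ≤ M * s := by
    intro s hs
    have := (convex_Icc (0:ℝ) 1).norm_image_sub_le_of_norm_hasDerivWithin_le hfd hM z01 hs
    rw [hfz, sub_zero, sub_zero, Real.norm_eq_abs, Real.norm_eq_abs, abs_of_nonneg hs.1] at this
    exact (le_abs_self _).trans this
  have hb1 : ∀ s ∈ Icc (0:ℝ) 1, f k s ≤ M * (1 - s) := by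
    intro s hs
    have := (convex_Icc (0:ℝ) 1).norm_image_sub_le_of_norm_hasDerivWithin_le hfd hM hs o01
    rw [hfo, zero_sub, norm_neg, Real.norm_eq_abs, Real.norm_eq_abs,
      abs_of_nonneg (sub_nonneg.2 hs.2)] at this
    exact (le_abs_self _).trans this
  set g : ℝ → ℝ := fun x => (lam k * M) * (|α k x| + |β k x|) with hgdef
  have hg : IntegrableOn g (Ioo a b) := (hα.abs.add hβ.abs).const_mul _
  have hg0 : ∀ x, 0 ≤ g x := fun x => by positivity
  have hq2 : ∀ᵐ x ∂(volume.restrict (Ioo a b)), ∀ v, f k (p k x) ≤ M * v →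
      |q2 x| ≤ g x * v := by
    filter_upwards [hwb, heq, ae_restrict_mem measurableSet_Ioo] with x h1 h2 hx v hv
    have hxc := Ioo_subset_Icc_self hx
    obtain ⟨h3, h4⟩ := h1 (fun j => p (k.succAbove j) x) (fun j => hr _ x hxc)
    have h5 := hf0 _ (hr k x hxc)
    set W := w k x (fun j => p (k.succAbove j) x)
    have h6 : |W| ≤ |α k x| + |β k x| := by
      rw [abs_le]
      constructor
      · linarith [neg_abs_le (α k x), abs_nonneg (β k x)]
      · linarith [le_abs_self (β k x), abs_nonneg (α k x)]
    have h7 : q2 x = -(lam k * W * f k (p k x)) := by linarith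
    rw [h7, abs_neg, abs_mul, abs_mul, abs_of_pos hl, abs_of_nonneg h5]
    calc lam k * |W| * f k (p k x) ≤ lam k * (|α k x| + |β k x|) * (M * v) := by gcongr
      _ = g x * v := by rw [hgdef]; ring
  intro x hx
  constructor
  · refine lt_of_le_of_ne (hr k x hx).1 fun h => ?_
    obtain ⟨y, hy, hne⟩ := hk0
    refine hne (sb_aux a b hab (p k) q q2 g (fun x hx => (hr k x hx).1) hd hi hrep hqa hqb hg hg0
      ?_ x hx h.symm y hy)
    filter_upwards [hq2, ae_restrict_mem measurableSet_Ioo] with t ht htm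
    exact ht _ (hb0 _ (hr k t (Ioo_subset_Icc_self htm)))
  · refine lt_of_le_of_ne (hr k x hx).2 fun h => ?_
    obtain ⟨y, hy, hne⟩ := hk1
    have := sb_aux a b hab (fun x => 1 - p k x) (fun x => - q x) (fun x => - q2 x) g
      (fun x hx => sub_nonneg.2 (hr k x hx).2) (fun x hx => (hd x hx).const_sub 1) hi.neg
      (fun x hx => by rw [intervalIntegral.integral_neg, hrep x hx]; ring)
      (by simp [hqa]) (by simp [hqb]) hg hg0
      (by
        filter_upwards [hq2, ae_restrict_mem measurableSet_Ioo] with t ht htm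
        rw [abs_neg]
        exact ht _ (hb1 _ (hr k t (Ioo_subset_Icc_self htm)))) x hx (by simp [h]) y hy
    exact hne (by linarith)
end

section
/- (Pointwise energy-type estimate near 1.) Fix k ∈ {1,…,N}, let λ_i > 0 for i = 1,…,N and θ ∈ (0,1]. Set γ_k(x) = λ_k max{|α_k(x)|, |β_k(x)|} and let C > 0 be such that f_k(s) ≤ C(1−s) for all s ∈ [0,1]. If p = (p_1,…,p_N) is a solution of the Neumann problem (S_θ): p_i'' + θ λ_i w_i(x, p̂^i) f_i(p_i) = 0 in Ω, p_i'(ω̲) = p_i'(ω̄) = 0 (i = 1,…,N), with p_k not identically equal to 1, then for all x ∈ cl(Ω): (1 − p_k(x))² + (p_k'(x))² ≤ (1 − ‖p_k‖_∞)² · e^{|Ω| + C‖γ_k‖_{L¹(Ω)}}, where ‖p_k‖_∞ is the sup-norm of p_k on cl(Ω) and |Ω| is the length of Ω. -/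
open MeasureTheory Set Filter

theorem aux_exp_ac {f : ℝ → ℝ} {a b : ℝ} (hf : AbsolutelyContinuousOnInterval f a b) :
    AbsolutelyContinuousOnInterval (fun x => Real.exp (f x)) a b := by
  obtain ⟨M, hM⟩ := hf.exists_bound
  have hlip : ∀ x ∈ uIcc a b, ∀ y ∈ uIcc a b,
      dist (Real.exp (f x)) (Real.exp (f y)) ≤ Real.exp M * dist (f x) (f y) := by
    intro x hx y hy
    have := Convex.norm_image_sub_le_of_norm_hasDerivWithin_le (f := Real.exp) (f' := Real.exp)
      (s := Iic M) (C := Real.exp M) (x := f y) (y := f x)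
      (fun z _ => (Real.hasDerivAt_exp z).hasDerivWithinAt)
      (fun z hz => by
        rw [Real.norm_eq_abs, abs_of_pos (Real.exp_pos z)]
        exact Real.exp_le_exp.2 hz) (convex_Iic M)
      ((le_abs_self _).trans (hM y hy)) ((le_abs_self _).trans (hM x hx))
    simpa [dist_eq_norm] using this
  rw [absolutelyContinuousOnInterval_iff] at hf ⊢
  intro ε hε
  have hpos := Real.exp_pos M
  obtain ⟨δ, hδ, h⟩ := hf (ε / Real.exp M) (by positivity)
  refine ⟨δ, hδ, fun E hE hlt => ?_⟩
  have h1 := h E hE hlt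
  rw [lt_div_iff₀ hpos, mul_comm, Finset.mul_sum] at h1
  refine lt_of_le_of_lt (Finset.sum_le_sum fun i hi => ?_) h1
  have hE2 := hE.1 i (Finset.mem_coe.1 hi)
  exact hlip _ hE2.1 _ hE2.2

theorem aux_gron {a b : ℝ} (hab : a ≤ b) {E g : ℝ → ℝ} (s : ℝ)
    (hE : AbsolutelyContinuousOnInterval E a b)
    (hg : IntervalIntegrable g volume a b)
    (h : ∀ᵐ x, x ∈ Icc a b → ∃ d, HasDerivAt E d x ∧ 0 ≤ d + s * g x * E x)
    {u v : ℝ} (hu : a ≤ u) (huv : u ≤ v) (hv : v ≤ b) :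
    E u * Real.exp (s * ∫ t in a..u, g t) ≤ E v * Real.exp (s * ∫ t in a..v, g t) := by
  have hG : AbsolutelyContinuousOnInterval (fun x => ∫ t in a..x, g t) a b :=
    hg.absolutelyContinuousOnInterval_intervalIntegral (by simp)
  have hH := hE.fun_mul (aux_exp_ac (hG.const_mul s))
  have hH' := (hH.mono (c := u) (d := v) (by
    rw [uIcc_of_le huv, uIcc_of_le hab]; exact Icc_subset_Icc hu hv)).integral_deriv_eq_sub
  have hnn : 0 ≤ ∫ x in u..v, deriv (fun x => E x * Real.exp (s * ∫ t in a..x, g t)) x := by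
    apply intervalIntegral.integral_nonneg_of_ae_restrict huv
    rw [EventuallyLE, ae_restrict_iff' measurableSet_Icc]
    filter_upwards [h, hg.ae_hasDerivAt_integral] with x hx1 hx2 hx
    have hxab : x ∈ Icc a b := ⟨hu.trans hx.1, hx.2.trans hv⟩
    obtain ⟨d, hd, hd0⟩ := hx1 hxab
    have h2 := hx2 (by rwa [uIcc_of_le hab]) a (by simp)
    have h3 := hd.fun_mul ((h2.const_mul s).exp)
    rw [h3.deriv]
    have := mul_nonneg hd0 (Real.exp_pos (s * ∫ t in a..x, g t)).le
    simp only [Pi.zero_apply]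
    linarith
  rw [hH'] at hnn
  linarith

/-- Pointwise energy-type estimate near `1` for solutions of `(S_θ)`:
with `γ_k = λ_k max{|α_k|, |β_k|}` and `f_k(s) ≤ C (1-s)` on `[0,1]`, if `p_k ≢ 1` then
`(1 - p_k(x))² + (p_k'(x))² ≤ (1 - ‖p_k‖_∞)² e^{|Ω| + C ‖γ_k‖_{L¹}}` on `cl(Ω)`. -/
theorem energy_estimate_near_one
    (n : ℕ) (hn : 1 ≤ n) (a b : ℝ) (hab : a < b)
    (w : Fin (n+1) → ℝ → (Fin n → ℝ) → ℝ)
    (I : Fin (n+1) → Set ℝ) (α β : Fin (n+1) → ℝ → ℝ)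
    (hw : ∀ i, WeightHyp n a b (w i) (I i) (α i) (β i))
    (f f' : Fin (n+1) → ℝ → ℝ)
    (hf : ∀ i, NonlinC1 (f i) (f' i))
    (lam : Fin (n+1) → ℝ) (hlam : ∀ i, 0 < lam i)
    (k : Fin (n+1)) (θ : ℝ) (hθ : θ ∈ Set.Ioc (0:ℝ) 1)
    (C : ℝ) (hC : 0 < C)
    (hfC : ∀ s ∈ Set.Icc (0:ℝ) 1, f k s ≤ C * (1 - s))
    (p : Fin (n+1) → ℝ → ℝ)
    (hp : IsSol n a b w f (fun i => θ * lam i) p)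
    (pk' pk'' : ℝ → ℝ)
    (hder : ∀ x ∈ Set.Icc a b, HasDerivWithinAt (p k) (pk' x) (Set.Icc a b) x)
    (hcont : ContinuousOn pk' (Set.Icc a b))
    (hint : IntegrableOn pk'' (Set.Ioo a b))
    (hAC : ∀ x ∈ Set.Icc a b, pk' x = pk' a + ∫ t in a..x, pk'' t)
    (heq : ∀ᵐ x ∂(volume.restrict (Set.Ioo a b)),
      pk'' x + θ * lam k * w k x (fun j => p (k.succAbove j) x) * f k (p k x) = 0)
    (hbca : pk' a = 0) (hbcb : pk' b = 0)
    (hne1 : ∃ x ∈ Set.Icc a b, p k x ≠ 1) :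
    ∀ x ∈ Set.Icc a b,
      (1 - p k x) ^ 2 + pk' x ^ 2 ≤
        (1 - sSup (p k '' Set.Icc a b)) ^ 2 *
          Real.exp ((b - a) + C * ∫ x in Set.Ioo a b, lam k * max |α k x| |β k x|) := by
  have hp01 := hp.1 k
  obtain ⟨-, -, -, -, -, hα, hβ, -, -, -, hwb⟩ := hw k
  obtain ⟨⟨-, hf0, -, -, -⟩, -, -⟩ := hf k
  set P : ℝ → ℝ := fun x => ∫ t in a..x, pk'' t with hP
  set γ : ℝ → ℝ := fun x => lam k * max |α k x| |β k x| with hγ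
  set g : ℝ → ℝ := fun x => 1 + C * γ x with hgdef
  set E : ℝ → ℝ := fun x => (1 - p k x) * (1 - p k x) + P x * P x with hEdef
  have hPeq : ∀ x ∈ Icc a b, pk' x = P x := fun x hx => by rw [hAC x hx, hbca, zero_add]
  have hpi : IntervalIntegrable pk'' volume a b := by
    rw [intervalIntegrable_iff_integrableOn_Ioo_of_le hab.le]; exact hint
  have hγi : IntegrableOn γ (Ioo a b) := (hα.abs.sup hβ.abs).const_mul _
  have hγint : IntervalIntegrable γ volume a b := by
    rw [intervalIntegrable_iff_integrableOn_Ioo_of_le hab.le]; exact hγi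
  have hgi : IntervalIntegrable g volume a b :=
    intervalIntegrable_const.add (hγint.const_mul C)
  have hγ0 : ∀ x, 0 ≤ γ x := fun x =>
    mul_nonneg (hlam k).le (le_max_of_le_left (abs_nonneg _))
  have hg0 : ∀ x, 0 ≤ g x := fun x => by
    have := mul_nonneg hC.le (hγ0 x)
    simp only [hgdef]; linarith
  have hGb : ∫ t in a..b, g t = (b - a) + C * ∫ x in Ioo a b, γ x := by
    simp only [hgdef]
    rw [intervalIntegral.integral_add intervalIntegrable_const (hγint.const_mul C),
      intervalIntegral.integral_const_mul, intervalIntegral.integral_of_le hab.le (f := γ),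
      integral_Ioc_eq_integral_Ioo]
    simp
  have hPac : AbsolutelyContinuousOnInterval P a b :=
    hpi.absolutelyContinuousOnInterval_intervalIntegral (by simp)
  have hpac : AbsolutelyContinuousOnInterval (fun x => 1 - p k x) a b := by
    obtain ⟨M, hM⟩ := isCompact_Icc.exists_bound_of_continuousOn hcont
    have hM0 : 0 ≤ M := (norm_nonneg _).trans (hM a (left_mem_Icc.2 hab.le))
    apply LipschitzOnWith.absolutelyContinuousOnInterval (K := ⟨M, hM0⟩)
    rw [uIcc_of_le hab.le]
    refine (convex_Icc a b).lipschitzOnWith_of_nnnorm_hasDerivWithin_le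
      (f' := fun x => - pk' x) (fun x hx => (hder x hx).const_sub 1) (fun x hx => ?_)
    rw [nnnorm_neg]
    exact hM x hx
  have hEac : AbsolutelyContinuousOnInterval E a b :=
    (hpac.fun_mul hpac).fun_add (hPac.fun_mul hPac)
  have hE0 : ∀ x, 0 ≤ E x := fun x => add_nonneg (mul_self_nonneg _) (mul_self_nonneg _)
  have hmain : ∀ᵐ x, x ∈ Icc a b → ∃ d, HasDerivAt E d x ∧ |d| ≤ g x * E x := by
    have e1 := (ae_restrict_iff' measurableSet_Ioo).1 heq
    have e2 := (ae_restrict_iff' measurableSet_Ioo).1 hwb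
    have ha : ∀ᵐ x : ℝ, x ≠ a := by simp [ae_iff]
    have hb : ∀ᵐ x : ℝ, x ≠ b := by simp [ae_iff]
    filter_upwards [e1, e2, ha, hb, hpi.ae_hasDerivAt_integral] with x h1 h2 hxa hxb h3 hx
    have hxo : x ∈ Ioo a b := ⟨lt_of_le_of_ne hx.1 (Ne.symm hxa), lt_of_le_of_ne hx.2 hxb⟩
    have hdP : HasDerivAt P (pk'' x) x := h3 (by rwa [uIcc_of_le hab.le]) a (by simp)
    have hdp : HasDerivAt (fun x => 1 - p k x) (- pk' x) x :=
      ((hder x hx).hasDerivAt (Icc_mem_nhds hxo.1 hxo.2)).const_sub 1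
    refine ⟨_, (hdp.fun_mul hdp).fun_add (hdP.fun_mul hdP), ?_⟩
    have h1' := h1 hxo
    obtain ⟨hw1, hw2⟩ := h2 hxo (fun j => p (k.succAbove j) x) (fun j => hp.1 _ x hx)
    set W := w k x (fun j => p (k.succAbove j) x) with hW
    have hWabs : |W| ≤ max |α k x| |β k x| := abs_le_max_abs_abs hw1 hw2
    have hq := hp01 x hx
    have hf1 := hfC _ hq
    have hf2 := hf0 _ hq
    rw [hPeq x hx]
    set q := 1 - p k x with hqdef
    have hq0 : 0 ≤ q := by linarith [hq.2]
    have hp2 : |pk'' x| ≤ C * γ x * q := by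
      have : pk'' x = - (θ * lam k * W * f k (p k x)) := by linarith
      rw [this, abs_neg, abs_mul, abs_mul, abs_mul, abs_of_pos hθ.1, abs_of_pos (hlam k),
        abs_of_nonneg hf2]
      have t1 : θ * lam k ≤ lam k := by nlinarith [hθ.2, hlam k]
      have t2 : θ * lam k * |W| ≤ γ x :=
        mul_le_mul t1 hWabs (abs_nonneg _) (hlam k).le
      calc θ * lam k * |W| * f k (p k x) ≤ γ x * (C * q) :=
            mul_le_mul t2 hf1 hf2 (hγ0 x)
        _ = _ := by ring
    have hR : |-q + pk'' x| ≤ g x * q := by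
      calc |-q + pk'' x| ≤ |-q| + |pk'' x| := abs_add_le _ _
        _ ≤ q + C * γ x * q := by rw [abs_neg, abs_of_nonneg hq0]; linarith
        _ = g x * q := by simp only [hgdef]; ring
    have hd : -P x * q + q * -P x + (pk'' x * P x + P x * pk'' x)
        = 2 * P x * (-q + pk'' x) := by ring
    rw [hd, abs_mul, abs_mul, abs_two]
    have hP2 := abs_mul_abs_self (P x)
    calc 2 * |P x| * |-q + pk'' x| ≤ 2 * |P x| * (g x * q) :=
          mul_le_mul_of_nonneg_left hR (by positivity)
      _ = g x * (2 * |P x| * q) := by ring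
      _ ≤ g x * E x := by
        apply mul_le_mul_of_nonneg_left _ (hg0 x)
        simp only [hEdef]
        rw [← hqdef, ← hP2]
        nlinarith [sq_nonneg (|P x| - q)]
  have hpc : ContinuousOn (p k) (Icc a b) := fun x hx => (hder x hx).continuousWithinAt
  obtain ⟨x₀, hx₀, hmax⟩ := isCompact_Icc.exists_isMaxOn (nonempty_Icc.2 hab.le) hpc
  have hsup : sSup (p k '' Icc a b) = p k x₀ :=
    IsGreatest.csSup_eq ⟨⟨x₀, hx₀, rfl⟩, by rintro _ ⟨y, hy, rfl⟩; exact hmax hy⟩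
  have hcrit : pk' x₀ = 0 := by
    rcases eq_or_lt_of_le hx₀.1 with h | h
    · rw [← h]; exact hbca
    rcases eq_or_lt_of_le hx₀.2 with h' | h'
    · rw [h']; exact hbcb
    have hn := Icc_mem_nhds h h'
    exact (hmax.isLocalMax hn).hasDerivAt_eq_zero ((hder x₀ hx₀).hasDerivAt hn)
  have hE00 : E x₀ = (1 - p k x₀) ^ 2 := by
    simp only [hEdef]; rw [← hPeq x₀ hx₀, hcrit]; ring
  intro x hx
  rw [hsup, ← hE00, ← hGb]
  have hEx : (1 - p k x) ^ 2 + pk' x ^ 2 = E x := by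
    rw [hPeq x hx]; simp only [hEdef]; ring
  rw [hEx]
  have hGdiff : ∀ u v, a ≤ u → u ≤ v → v ≤ b →
      (∫ t in a..v, g t) - (∫ t in a..u, g t) ≤ ∫ t in a..b, g t := by
    intro u v hu huv hv
    have hv1 : ∫ t in a..v, g t ≤ ∫ t in a..b, g t :=
      intervalIntegral.integral_mono_interval le_rfl (hu.trans huv) hv
        (Eventually.of_forall hg0) hgi
    have hu1 : 0 ≤ ∫ t in a..u, g t := intervalIntegral.integral_nonneg hu fun t _ => hg0 t
    linarith
  rcases le_total x₀ x with hle | hle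
  · have h1 := aux_gron hab.le (-1) hEac.fun_neg hgi (by
      filter_upwards [hmain] with y hy hyI
      obtain ⟨d, hd, hd'⟩ := hy hyI
      exact ⟨-d, hd.fun_neg, by linarith [le_abs_self d]⟩) hx₀.1 hle hx.2
    have h2 : E x * Real.exp (-1 * ∫ t in a..x, g t)
        ≤ E x₀ * Real.exp (-1 * ∫ t in a..x₀, g t) := by linarith
    have h3 := mul_le_mul_of_nonneg_right h2 (Real.exp_pos (∫ t in a..x, g t)).le
    rw [mul_assoc, mul_assoc, ← Real.exp_add, ← Real.exp_add] at h3
    have h4 : (-1 * ∫ t in a..x, g t) + (∫ t in a..x, g t) = 0 := by ring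
    rw [h4, Real.exp_zero, mul_one] at h3
    refine h3.trans (mul_le_mul_of_nonneg_left (Real.exp_le_exp.2 ?_) (hE0 _))
    linarith [hGdiff x₀ x hx₀.1 hle hx.2]
  · have h2 := aux_gron hab.le 1 hEac hgi (by
      filter_upwards [hmain] with y hy hyI
      obtain ⟨d, hd, hd'⟩ := hy hyI
      exact ⟨d, hd, by linarith [neg_abs_le d]⟩) hx.1 hle hx₀.2
    have h3 := mul_le_mul_of_nonneg_right h2 (Real.exp_pos (-∫ t in a..x, g t)).le
    rw [mul_assoc, mul_assoc, ← Real.exp_add, ← Real.exp_add] at h3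
    have h4 : (1 * ∫ t in a..x, g t) + (-∫ t in a..x, g t) = 0 := by ring
    rw [h4, Real.exp_zero, mul_one] at h3
    refine h3.trans (mul_le_mul_of_nonneg_left (Real.exp_le_exp.2 ?_) (hE0 _))
    linarith [hGdiff x x₀ hx.1 hle hx₀.2]
end

section
/- (Bound on the forcing parameter.) Fix k ∈ {1,…,N}, let λ_i > 0 for i = 1,…,N and μ ≥ 0, and set γ_k(x) = λ_k max{|α_k(x)|, |β_k(x)|}. If p = (p_1,…,p_N), with each p_i : cl(Ω) → [0,1] continuously differentiable with absolutely continuous derivative, satisfies p_k'' + λ_k w_k(x, p̂^k) f_k(p_k) + μ = 0 for a.e. x ∈ Ω together with p_k'(ω̲) = p_k'(ω̄) = 0, then μ ≤ ‖γ_k‖_{L¹(Ω)} · max_{s ∈ [0,1]} f_k(s) / |Ω|, where |Ω| is the length of Ω. In particular, for μ strictly larger than this bound the problem has no such solution. -/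
open MeasureTheory Set Filter

/-- Bound on the forcing parameter: if `p_k` solves
`p_k'' + λ_k w_k(x, p̂^k) f_k(p_k) + μ = 0` with Neumann conditions, then
`μ ≤ ‖γ_k‖_{L¹} max_{[0,1]} f_k / |Ω|` where `γ_k = λ_k max{|α_k|, |β_k|}`. -/
theorem forcing_parameter_bound
    (n : ℕ) (hn : 1 ≤ n) (a b : ℝ) (hab : a < b)
    (w : Fin (n+1) → ℝ → (Fin n → ℝ) → ℝ)
    (I : Fin (n+1) → Set ℝ) (α β : Fin (n+1) → ℝ → ℝ)
    (hw : ∀ i, WeightHyp n a b (w i) (I i) (α i) (β i))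
    (f : Fin (n+1) → ℝ → ℝ)
    (hf : ∀ i, NonlinC0 (f i))
    (lam : Fin (n+1) → ℝ) (hlam : ∀ i, 0 < lam i)
    (k : Fin (n+1)) (μ : ℝ) (hμ : 0 ≤ μ)
    (p : Fin (n+1) → ℝ → ℝ)
    (hrange : ∀ i, ∀ x ∈ Set.Icc a b, p i x ∈ Set.Icc (0:ℝ) 1)
    (hreg : ∀ i : Fin (n+1), ∃ q' q'' : ℝ → ℝ,
      (∀ x ∈ Set.Icc a b, HasDerivWithinAt (p i) (q' x) (Set.Icc a b) x) ∧
      ContinuousOn q' (Set.Icc a b) ∧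
      IntegrableOn q'' (Set.Ioo a b) ∧
      (∀ x ∈ Set.Icc a b, q' x = q' a + ∫ t in a..x, q'' t))
    (pk' pk'' : ℝ → ℝ)
    (hder : ∀ x ∈ Set.Icc a b, HasDerivWithinAt (p k) (pk' x) (Set.Icc a b) x)
    (hcont : ContinuousOn pk' (Set.Icc a b))
    (hint : IntegrableOn pk'' (Set.Ioo a b))
    (hAC : ∀ x ∈ Set.Icc a b, pk' x = pk' a + ∫ t in a..x, pk'' t)
    (heq : ∀ᵐ x ∂(volume.restrict (Set.Ioo a b)),
      pk'' x + lam k * w k x (fun j => p (k.succAbove j) x) * f k (p k x) + μ = 0)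
    (hbca : pk' a = 0) (hbcb : pk' b = 0) :
    μ ≤ (∫ x in Set.Ioo a b, lam k * max |α k x| |β k x|) *
        sSup (f k '' Set.Icc (0:ℝ) 1) / (b - a) := by
  obtain ⟨-, -, -, -, -, hα, hβ, -, -, -, hwb⟩ := hw k
  obtain ⟨hfc, hf0, -⟩ := hf k
  have hbdd : BddAbove (f k '' Set.Icc (0:ℝ) 1) := (isCompact_Icc.image_of_continuousOn hfc).bddAbove
  have h0 : ∫ x in Set.Ioo a b, pk'' x = 0 := by
    have h := hAC b ⟨hab.le, le_rfl⟩
    rw [hbca, hbcb, intervalIntegral.integral_of_le hab.le, integral_Ioc_eq_integral_Ioo] at h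
    linarith
  have hmax : IntegrableOn (fun x => lam k * max |α k x| |β k x|) (Set.Ioo a b) :=
    (Integrable.sup (Integrable.abs hα) (Integrable.abs hβ)).const_mul _
  have hc : IntegrableOn (fun _ : ℝ => μ) (Set.Ioo a b) :=
    integrableOn_const (by simp)
  have key : ∫ x in Set.Ioo a b, (pk'' x + μ) ≤
      ∫ x in Set.Ioo a b, lam k * max |α k x| |β k x| * sSup (f k '' Set.Icc (0:ℝ) 1) := by
    refine integral_mono_ae (hint.add hc) (hmax.mul_const _) ?_
    filter_upwards [heq, hwb, ae_restrict_mem measurableSet_Ioo] with x hx hwx hxm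
    have hxm' : x ∈ Set.Icc a b := Set.Ioo_subset_Icc_self hxm
    obtain ⟨h1, h2⟩ := hwx (fun j => p (k.succAbove j) x) (fun j => hrange _ x hxm')
    have hF0 := hf0 _ (hrange k x hxm')
    have hF1 := le_csSup hbdd (Set.mem_image_of_mem (f k) (hrange k x hxm'))
    have hW : -w k x (fun j => p (k.succAbove j) x) ≤ max |α k x| |β k x| :=
      le_trans (by linarith [neg_abs_le (α k x)]) (le_max_left _ _)
    have hM : 0 ≤ max |α k x| |β k x| := le_trans (abs_nonneg _) (le_max_left _ _)
    have e1 : pk'' x + μ = lam k * (-w k x (fun j => p (k.succAbove j) x)) * f k (p k x) := by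
      linarith
    show pk'' x + μ ≤ _
    rw [e1]
    have := (hlam k).le
    calc _ ≤ lam k * max |α k x| |β k x| * f k (p k x) := by gcongr
      _ ≤ _ := by gcongr
  rw [integral_add hint hc, h0, integral_mul_const] at key
  simp [hab.le] at key
  rw [le_div_iff₀ (by linarith)]
  linarith
end

section
/- (Uniform convergence to 1 of large solutions.) Fix k ∈ {1,…,N} and λ_i > 0 for i = 1,…,N. If (p^n)_n is a sequence of solutions of the Neumann problems (S_{θ_n}) with θ_n ∈ (0,1], such that 0 < ‖p_k^n‖_∞ = R^n and R^n → 1 as n → ∞, then p_k^n → 1 uniformly on cl(Ω) as n → ∞. -/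
open MeasureTheory Set Filter

lemma core_gronwall (a b : ℝ) (hab : a < b) (g : ℝ → ℝ) (hg : IntegrableOn g (Set.Ioo a b)) :
    ∃ C : ℝ, ∀ q q' q'' : ℝ → ℝ,
      (∀ x ∈ Set.Icc a b, HasDerivWithinAt q (q' x) (Set.Icc a b) x) →
      ContinuousOn q' (Set.Icc a b) →
      IntegrableOn q'' (Set.Ioo a b) →
      (∀ x ∈ Set.Icc a b, q' x = q' a + ∫ t in a..x, q'' t) →
      (∀ᵐ x ∂(volume.restrict (Set.Ioo a b)), |q'' x| ≤ g x * |q x|) →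
      (∀ᵐ x ∂(volume.restrict (Set.Ioo a b)), 0 ≤ g x) →
      ∀ y ∈ Set.Icc a b, ∀ x ∈ Set.Icc a b, |q x| + |q' x| ≤ C * (|q y| + |q' y|) := by
  have hgI : IntervalIntegrable g volume a b := by
    rw [intervalIntegrable_iff_integrableOn_Ioo_of_le hab.le]; exact hg
  have hGc : ContinuousOn (fun x => ∫ t in a..x, g t) (Set.Icc a b) := by
    have := intervalIntegral.continuousOn_primitive_interval' hgI (left_mem_uIcc)
    rwa [uIcc_of_le hab.le] at this
  have hGu := isCompact_Icc.uniformContinuousOn_of_continuous hGc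
  rw [Metric.uniformContinuousOn_iff] at hGu
  obtain ⟨η₀, hη₀, hη⟩ := hGu (1/4) (by norm_num)
  set η := min (η₀ / 2) (1/4) with hηd
  have hηpos : 0 < η := by positivity
  have hη1 : η < η₀ := lt_of_le_of_lt (min_le_left _ _) (by linarith)
  have hη2 : η ≤ 1/4 := min_le_right _ _
  obtain ⟨N, hN⟩ := exists_nat_gt ((b - a) / η)
  rw [div_lt_iff₀ hηpos] at hN
  refine ⟨2 ^ N, ?_⟩
  intro q q' q'' hd hc hi hr hae hg0
  have hiI : IntervalIntegrable q'' volume a b := by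
    rw [intervalIntegrable_iff_integrableOn_Ioo_of_le hab.le]; exact hi
  have hqc : ContinuousOn q (Set.Icc a b) := fun x hx => (hd x hx).continuousWithinAt
  have step : ∀ y ∈ Set.Icc a b, ∀ x ∈ Set.Icc a b, |x - y| ≤ η →
      |q x| + |q' x| ≤ 2 * (|q y| + |q' y|) := by
    intro y hy x hx hxy
    have hsub : Set.uIcc y x ⊆ Set.Icc a b := Set.uIcc_subset_Icc hy hx
    have huc : ContinuousOn (fun t => |q t| + |q' t|) (Set.uIcc y x) :=
      ((hqc.mono hsub).abs).add ((hc.mono hsub).abs)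
    obtain ⟨t, ht, hmax⟩ := isCompact_uIcc.exists_isMaxOn ⟨y, left_mem_uIcc⟩ huc
    have htI := hsub ht
    set M := |q t| + |q' t| with hM
    have hM0 : 0 ≤ M := by positivity
    have hmax' : ∀ s ∈ Set.uIcc y x, |q s| + |q' s| ≤ M := fun s hs => hmax hs
    have hty : |t - y| ≤ η := le_trans (Set.abs_sub_left_of_mem_uIcc ht) hxy
    have hsub2 : Set.uIcc y t ⊆ Set.uIcc y x := Set.uIcc_subset_uIcc left_mem_uIcc ht
    have h1 : |q t - q y| ≤ M * |t - y| := by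
      have := (convex_uIcc y t).norm_image_sub_le_of_norm_hasDerivWithin_le (f := q) (f' := q')
        (C := M) (x := y) (y := t)
        (fun s hs => (hd s (hsub (hsub2 hs))).mono (hsub2.trans hsub))
        (fun s hs => by
          have := hmax' s (hsub2 hs)
          have h0 := abs_nonneg (q s)
          rw [Real.norm_eq_abs]; linarith) left_mem_uIcc right_mem_uIcc
      simpa using this
    have hsubI : ∀ {F : ℝ → ℝ}, IntervalIntegrable F volume a b →
        ∀ {u v : ℝ}, u ∈ Set.Icc a b → v ∈ Set.Icc a b → IntervalIntegrable F volume u v := by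
      intro F hF u v hu hv
      apply hF.mono_set
      rw [uIcc_of_le hab.le]
      exact Set.uIcc_subset_Icc hu hv
    have ha : a ∈ Set.Icc a b := ⟨le_rfl, hab.le⟩
    have h2 : |q' t - q' y| ≤ M * (1/4) := by
      have e1 : q' t - q' y = ∫ s in y..t, q'' s := by
        rw [hr t htI, hr y hy,
          ← intervalIntegral.integral_interval_sub_left (hsubI hiI ha htI) (hsubI hiI ha hy)]
        ring
      have e2 : |∫ s in y..t, g s| ≤ 1/4 := by
        rw [← intervalIntegral.integral_interval_sub_left (hsubI hgI ha htI) (hsubI hgI ha hy)]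
        have := hη t htI y hy (by rw [Real.dist_eq]; linarith)
        rw [Real.dist_eq] at this
        exact this.le
      have hae2 : ∀ᵐ s ∂(volume.restrict (Set.uIoc y t)), ‖q'' s‖ ≤ M * g s := by
        have hsm : Set.uIoc y t ⊆ Set.Ioc a b := by
          intro s hs
          rcases Set.mem_uIoc.1 hs with h | h
          · exact ⟨lt_of_le_of_lt hy.1 h.1, h.2.trans htI.2⟩
          · exact ⟨lt_of_le_of_lt htI.1 h.1, h.2.trans hy.2⟩
        rw [Measure.restrict_congr_set Ioo_ae_eq_Ioc] at hae hg0
        have A := ae_mono (Measure.restrict_mono hsm le_rfl) hae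
        have B := ae_mono (Measure.restrict_mono hsm le_rfl) hg0
        filter_upwards [A, B, ae_restrict_mem measurableSet_uIoc] with s hs1 hs2 hs3
        have := hmax' s (hsub2 (Set.uIoc_subset_uIcc hs3))
        have h0 := abs_nonneg (q' s)
        rw [Real.norm_eq_abs]
        calc _ ≤ g s * |q s| := hs1
          _ ≤ g s * M := by gcongr; linarith
          _ = _ := mul_comm _ _
      have e3 := intervalIntegral.norm_integral_le_abs_of_norm_le (μ := volume) hae2
        ((hsubI hgI hy htI).const_mul M)
      rw [intervalIntegral.integral_const_mul, abs_mul, abs_of_nonneg hM0,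
        Real.norm_eq_abs] at e3
      rw [e1]
      exact e3.trans (by gcongr)
    have h3 : M * |t - y| ≤ M * (1/4) := by gcongr; linarith
    have h4 := abs_sub_abs_le_abs_sub (q t) (q y)
    have h5 := abs_sub_abs_le_abs_sub (q' t) (q' y)
    have h6 := hmax' x right_mem_uIcc
    linarith
  have multi : ∀ N : ℕ, ∀ y ∈ Set.Icc a b, ∀ x ∈ Set.Icc a b, |x - y| ≤ N * η →
      |q x| + |q' x| ≤ 2 ^ N * (|q y| + |q' y|) := by
    intro N
    induction N with
    | zero =>
      intro y hy x hx h
      have : x = y := by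
        have : |x - y| = 0 := le_antisymm (by simpa using h) (abs_nonneg _)
        linarith [abs_eq_zero.1 this]
      subst this; simp
    | succ N ih =>
      intro y hy x hx h
      push_cast at h
      have hN1 : (0:ℝ) < N + 1 := by positivity
      set z := y + (x - y) * (N / (N + 1)) with hz
      have e0 : z - y = (x - y) * (N / (N+1)) := by rw [hz]; ring
      have e1 : x - z = (x - y) * (1 / (N + 1)) := by rw [hz]; field_simp; ring
      have hd : |x - y| / (N+1) ≤ η := by rw [div_le_iff₀ hN1]; linarith
      have z1 : |z - y| ≤ N * η := by
        rw [e0, abs_mul, abs_of_nonneg (show (0:ℝ) ≤ N / (N+1) by positivity)]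
        calc _ = N * (|x - y| / (N+1)) := by ring
          _ ≤ _ := by gcongr
      have z2 : |x - z| ≤ η := by
        rw [e1, abs_mul, abs_of_nonneg (show (0:ℝ) ≤ 1 / (N+1) by positivity)]
        calc _ = |x - y| / (N+1) := by ring
          _ ≤ _ := hd
      have hzI : z ∈ Set.Icc a b := by
        have t0 : (0:ℝ) ≤ N / (N+1) := by positivity
        have t1 : (N:ℝ) / (N+1) ≤ 1 := by rw [div_le_one hN1]; linarith
        have := (convex_Icc a b).add_smul_sub_mem hy hx ⟨t0, t1⟩
        rw [hz]; simpa [mul_comm] using this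
      have A := ih y hy z hzI z1
      have B := step z hzI x hx z2
      rw [pow_succ]; linarith
  intro y hy x hx
  apply multi N y hy x hx
  have : |x - y| ≤ b - a := by
    rw [abs_le]; constructor <;> linarith [hx.1, hx.2, hy.1, hy.2]
  linarith

/-- Uniform convergence to `1` of large solutions: if `p^n` solve
`(S_{θ_n})` with `0 < ‖p_k^n‖_∞ = R^n → 1`, then `p_k^n → 1` uniformly on `cl(Ω)`. -/
theorem uniform_convergence_to_one
    (n : ℕ) (hn : 1 ≤ n) (a b : ℝ) (hab : a < b)
    (w : Fin (n+1) → ℝ → (Fin n → ℝ) → ℝ)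
    (I : Fin (n+1) → Set ℝ) (α β : Fin (n+1) → ℝ → ℝ)
    (hw : ∀ i, WeightHyp n a b (w i) (I i) (α i) (β i))
    (f f' : Fin (n+1) → ℝ → ℝ)
    (hf : ∀ i, NonlinC1 (f i) (f' i))
    (lam : Fin (n+1) → ℝ) (hlam : ∀ i, 0 < lam i)
    (k : Fin (n+1))
    (p : ℕ → Fin (n+1) → ℝ → ℝ) (θ : ℕ → ℝ)
    (hθ : ∀ m, θ m ∈ Set.Ioc (0:ℝ) 1)
    (hsol : ∀ m, IsSol n a b w f (fun i => θ m * lam i) (p m))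
    (hRpos : ∀ m, 0 < sSup (p m k '' Set.Icc a b))
    (hRlim : Tendsto (fun m => sSup (p m k '' Set.Icc a b)) atTop (nhds 1)) :
    TendstoUniformlyOn (fun m x => p m k x) (fun _ => 1) atTop (Set.Icc a b) := by
  obtain ⟨-, -, -, -, -, hα, hβ, -, -, -, hαβ⟩ := hw k
  obtain ⟨⟨-, hf0, -, hf1, -⟩, hfd, hfc⟩ := hf k
  obtain ⟨L, hL⟩ := isCompact_Icc.exists_bound_of_continuousOn hfc
  have hL0 : 0 ≤ L := (norm_nonneg _).trans (hL 0 (by simp))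
  have hfL : ∀ s ∈ Set.Icc (0:ℝ) 1, |f k s| ≤ L * |1 - s| := by
    intro s hs
    have := (convex_Icc (0:ℝ) 1).norm_image_sub_le_of_norm_hasDerivWithin_le hfd hL
      (show (1:ℝ) ∈ Set.Icc (0:ℝ) 1 by simp) hs
    rw [hf1, sub_zero, Real.norm_eq_abs, Real.norm_eq_abs, abs_sub_comm] at this
    exact this
  obtain ⟨C, hC⟩ := core_gronwall a b hab (fun x => lam k * L * (|α k x| + |β k x|))
    ((hα.abs.add hβ.abs).const_mul _)
  have key : ∀ m, ∀ x ∈ Set.Icc a b,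
      |1 - p m k x| ≤ C * (1 - sSup (p m k '' Set.Icc a b)) := by
    intro m x hx
    obtain ⟨hp01, hs⟩ := hsol m
    obtain ⟨p', p'', hd, hc, hi, hr, hae, hpa, hpb⟩ := hs k
    have hpc : ContinuousOn (p m k) (Set.Icc a b) := fun x hx => (hd x hx).continuousWithinAt
    obtain ⟨y, hy, hsup, hmax⟩ := isCompact_Icc.exists_sSup_image_eq_and_ge
      (Set.nonempty_Icc.2 hab.le) hpc
    have hy0 : p' y = 0 := by
      rcases eq_or_lt_of_le hy.1 with h | h
      · rw [← h]; exact hpa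
      rcases eq_or_lt_of_le hy.2 with h' | h'
      · rw [h']; exact hpb
      have hn : Set.Icc a b ∈ nhds y := Icc_mem_nhds h h'
      have hloc : IsLocalMax (p m k) y := by
        filter_upwards [hn] with z hz using hmax z hz
      exact hloc.hasDerivAt_eq_zero ((hd y hy).hasDerivAt hn)
    have := hC (fun x => 1 - p m k x) (fun x => - p' x) (fun x => - p'' x)
      (fun x hx => by simpa using (hd x hx).const_sub 1) hc.neg hi.neg
      (fun x hx => by rw [hr x hx, intervalIntegral.integral_neg]; ring)
      (by
        filter_upwards [hae, hαβ, ae_restrict_mem measurableSet_Ioo] with z hz1 hz2 hz3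
        have hzI := Ioo_subset_Icc_self hz3
        obtain ⟨w1, w2⟩ := hz2 (fun j => p m (k.succAbove j) z) (fun j => hp01 _ z hzI)
        have hwb : |w k z (fun j => p m (k.succAbove j) z)| ≤ |α k z| + |β k z| := by
          rw [abs_le]
          constructor
          · linarith [neg_abs_le (α k z), abs_nonneg (β k z)]
          · linarith [le_abs_self (β k z), abs_nonneg (α k z)]
        have e : - p'' z = θ m * lam k * w k z (fun j => p m (k.succAbove j) z) *
          f k (p m k z) := by linarith
        have hF := hfL _ (hp01 k z hzI)
        have hl := (hlam k).le
        have ht := (hθ m).1.le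
        rw [e, abs_mul, abs_mul, abs_mul, abs_of_nonneg hl, abs_of_nonneg ht]
        calc _ ≤ 1 * lam k * (|α k z| + |β k z|) * (L * |1 - p m k z|) := by
              gcongr; exact (hθ m).2
          _ = _ := by ring)
      (Eventually.of_forall fun z => by have := (hlam k).le; positivity) y hy x hx
    simp only [hy0, neg_zero, abs_zero, add_zero, abs_neg] at this
    rw [abs_of_nonneg (show 0 ≤ 1 - p m k y by linarith [(hp01 k y hy).2])] at this
    rw [hsup]
    linarith [abs_nonneg (p' x)]
  rw [Metric.tendstoUniformlyOn_iff]
  intro ε hε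
  have hlim : Tendsto (fun m => C * (1 - sSup (p m k '' Set.Icc a b))) atTop (nhds 0) := by
    have := (hRlim.const_sub 1).const_mul C
    simpa using this
  filter_upwards [hlim.eventually_lt_const hε] with m hm x hx
  rw [Real.dist_eq]
  exact (key m x hx).trans_lt hm
end
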